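/- A simple 3-connected graph is Feynman 5-split if and only if it has no minor in F_0 = {K_{3,3}, K_5, C, H, O}. -/

import Mathlib

/-!  Common definitions: multigraphs, separations, width, minors,
Kirchhoff/Dodgson polynomials, Feynman 5-splitting, enhanced graphs. -/

noncomputable section

attribute [local instance] Classical.propDecidable

/-- A finite multigraph, given by finite vertex and edge types together with
source and target maps (an arbitrary orientation of each edge). -/
structure Multigraph : Type 1 where
  V : Type
  E : Type
  [fintypeV : Fintype V]
  [fintypeE : Fintype E]
  src : E → V
  tgt : E → V

attribute [instance] Multigraph.fintypeV Multigraph.fintypeE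

namespace Multigraph

variable (G : Multigraph)

/-- The endpoints of an edge as an unordered pair. -/
def ends (e : G.E) : Sym2 G.V := s(G.src e, G.tgt e)

/-- Incidence of a vertex with an edge. -/
def inc (v : G.V) (e : G.E) : Prop := v = G.src e ∨ v = G.tgt e

/-- `V(G_A)`: the vertices of the subgraph induced by an edge set `A`. -/
def edgeVerts (A : Set G.E) : Set G.V := {v | ∃ e ∈ A, G.inc v e}

/-- The order of the separation `(A, Aᶜ)` of the graph `G`,
i.e. `|V(G_A) ∩ V(G_B)|` where `B = Aᶜ`. -/
def sepOrder (A : Set G.E) : ℕ := (G.edgeVerts A ∩ G.edgeVerts Aᶜ).ncard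

/-- One step along an edge belonging to the edge set `A`. -/
def stepOn (A : Set G.E) (a b : G.V) : Prop :=
  ∃ e ∈ A, (G.src e = a ∧ G.tgt e = b) ∨ (G.src e = b ∧ G.tgt e = a)

/-- Reachability using only edges in `A`. -/
def reachOn (A : Set G.E) : G.V → G.V → Prop := Relation.ReflTransGen (G.stepOn A)

/-- Adjacency. -/
def Adj (a b : G.V) : Prop := G.stepOn Set.univ a b

/-- One adjacency step staying inside the vertex set `U`. -/
def stepWithin (U : Set G.V) (a b : G.V) : Prop := a ∈ U ∧ b ∈ U ∧ G.Adj a b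

/-- The subgraph induced by the vertex set `U` is (nonempty and) connected. -/
def ConnectedWithin (U : Set G.V) : Prop :=
  U.Nonempty ∧ ∀ a ∈ U, ∀ b ∈ U, Relation.ReflTransGen (G.stepWithin U) a b

/-- Connectivity of the multigraph. -/
def Connected : Prop := G.ConnectedWithin Set.univ

/-- A multigraph is simple if it has no loops and no parallel edges. -/
def Simple : Prop := (∀ e : G.E, G.src e ≠ G.tgt e) ∧ Function.Injective G.ends

/-- 3-connectivity: at least 4 vertices, and removing fewer than 3 vertices
leaves a connected graph. -/
def ThreeConnected : Prop :=
  4 ≤ Fintype.card G.V ∧ ∀ S : Set G.V, S.ncard < 3 → G.ConnectedWithin Sᶜ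

/-- The spanning subgraph with edge set `T` is connected. -/
def ConnectedOn (T : Set G.E) : Prop := ∀ a b : G.V, G.reachOn T a b

/-- The degree of `v` in the spanning subgraph with edge set `T`
(loops count twice). -/
def degOn (T : Set G.E) (v : G.V) : ℕ :=
  ({e ∈ T | G.src e = v}).ncard + ({e ∈ T | G.tgt e = v}).ncard

/-- The degree of a vertex (loops count twice). -/
def degree (v : G.V) : ℕ := G.degOn Set.univ v

/-- An edge set is a forest (contains no cycle) iff every nonempty subset
has a vertex of degree exactly one. -/
def IsForest (T : Set G.E) : Prop :=
  ∀ T' ⊆ T, T'.Nonempty → ∃ v : G.V, G.degOn T' v = 1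

/-- `T` is the edge set of a spanning tree of `G`. -/
def IsSpanningTree (T : Set G.E) : Prop := G.IsForest T ∧ G.ConnectedOn T

/-- The rank of an edge set in the cycle matroid `M(G)`:
the size of a largest forest contained in it. -/
def rk (A : Set G.E) : ℕ := sSup {n | ∃ T ⊆ A, G.IsForest T ∧ T.ncard = n}

/-- The order of the separation `(A, Aᶜ)` in the cycle matroid `M(G)`,
namely `r(A) + r(Aᶜ) - r(E) + 1`. -/
def msepOrder (A : Set G.E) : ℕ := G.rk A + G.rk Aᶜ + 1 - G.rk Set.univ

/-- The number of connected components of `G_A`, the subgraph induced by the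
edge set `A`. -/
def ncompOn (A : Set G.E) : ℕ :=
  ({C : Set G.V | ∃ v ∈ G.edgeVerts A, C = {w | G.reachOn A v w}}).ncard

/-- `G` has an edge ordering of width at most `k`: every prefix/suffix
separation has order at most `k`. -/
def WidthLE (k : ℕ) : Prop :=
  ∃ f : Fin (Fintype.card G.E) ≃ G.E,
    ∀ ℓ : ℕ,
      G.sepOrder {e | ∃ i : Fin (Fintype.card G.E), f i = e ∧ (i : ℕ) < ℓ} ≤ k

/-- The width of `G`: the minimum width of an edge ordering. -/
def width : ℕ := sInf {k | G.WidthLE k}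

/-- The minor of `G` obtained by deleting the edges in `D` and contracting the
edges in `C`. -/
def minorDC (D C : Set G.E) : Multigraph :=
  let rel : G.V → G.V → Prop := fun a b => ∃ e ∈ C, G.src e = a ∧ G.tgt e = b
  { V := Quot rel
    E := {e : G.E // e ∉ D ∪ C}
    fintypeV := @Fintype.ofFinite _ (Finite.of_surjective (Quot.mk rel) fun q => Quot.exists_rep q)
    fintypeE := Fintype.ofFinite _
    src := fun e => Quot.mk rel (G.src e.1)
    tgt := fun e => Quot.mk rel (G.tgt e.1) }

/-- Deletion of a vertex (together with all incident edges). -/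
def deleteVertex (v : G.V) : Multigraph :=
  { V := {w : G.V // w ≠ v}
    E := {e : G.E // ¬ G.inc v e}
    fintypeV := Fintype.ofFinite _
    fintypeE := Fintype.ofFinite _
    src := fun e => ⟨G.src e.1, fun h => e.2 (Or.inl h.symm)⟩
    tgt := fun e => ⟨G.tgt e.1, fun h => e.2 (Or.inr h.symm)⟩ }

/-- The edges having one endpoint in `X` and the other in `Y`. -/
def crossEdges (X Y : Set G.V) : Set G.E :=
  {e | (G.src e ∈ X ∧ G.tgt e ∈ Y) ∨ (G.src e ∈ Y ∧ G.tgt e ∈ X)}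

/-- `G` has `R` as a minor, via branch sets. -/
def HasMinor (R : Multigraph) : Prop :=
  ∃ X : R.V → Set G.V,
    (∀ v : R.V, G.ConnectedWithin (X v)) ∧
    (Pairwise fun v w => Disjoint (X v) (X w)) ∧
    ∀ v w : R.V, v ≠ w →
      ({f : R.E | R.ends f = s(v, w)}).ncard ≤ (G.crossEdges (X v) (X w)).ncard

/-- `D` is the edge set of a cycle of `G`. -/
def IsCycleSet (D : Set G.E) : Prop :=
  D.Nonempty ∧ (∀ v ∈ G.edgeVerts D, G.degOn D v = 2) ∧
    ∀ a ∈ G.edgeVerts D, ∀ b ∈ G.edgeVerts D, G.reachOn D a b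

/-- The side `A` of a separation on `X` is rich: for every `x ∈ X` there is a
cycle `D` avoiding `x` with at most one edge outside `A`. -/
def Rich (A : Set G.E) (X : Set G.V) : Prop :=
  ∀ x ∈ X, ∃ D : Set G.E, G.IsCycleSet D ∧ x ∉ G.edgeVerts D ∧ (D \ A).ncard ≤ 1

/-- The entry of the (edge × vertex) incidence matrix, as a polynomial. -/
def incCol (e : G.E) (v : G.V) : MvPolynomial G.E ℤ :=
  (if G.src e = v then 1 else 0) - (if G.tgt e = v then 1 else 0)

/-- The expanded Kirchhoff matrix `M_G` (with the column of `v0` deleted). -/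
def bigMatrix (v0 : G.V) :
    Matrix (G.E ⊕ {v : G.V // v ≠ v0}) (G.E ⊕ {v : G.V // v ≠ v0}) (MvPolynomial G.E ℤ) :=
  Matrix.of fun r c =>
    match r, c with
    | Sum.inl e, Sum.inl f => if e = f then MvPolynomial.X e else 0
    | Sum.inl e, Sum.inr v => G.incCol e v.1
    | Sum.inr v, Sum.inl e => - G.incCol e v.1
    | Sum.inr _, Sum.inr _ => 0

/-- The Dodgson polynomial `Ψ^{I,J}_K`: delete the rows indexed by `I` and the
columns indexed by `J` from `M_G`, take the determinant, and set `x_e = 0`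
for `e ∈ K`.  (It is well defined up to an overall sign.) -/
def dodgson (v0 : G.V) (I J K : Set G.E) : MvPolynomial G.E ℤ :=
  if h : Nonempty ({e : G.E // e ∉ I} ≃ {e : G.E // e ∉ J}) then
    MvPolynomial.aeval (fun e => if e ∈ K then (0 : MvPolynomial G.E ℤ) else MvPolynomial.X e)
      (Matrix.det (Matrix.of fun r c =>
        G.bigMatrix v0 (Sum.map Subtype.val id r) (Sum.map (fun x => (h.some x).1) id c)))
  else 0

/-- `(I,J,K)` is one of the 30 Dodgson configurations associated with the
5-configuration `S`. -/
def DodgsonConfig (S I J K : Set G.E) : Prop :=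
  I ∪ J ∪ K = S ∧
    ((I.ncard = 2 ∧ J.ncard = 2 ∧ K.ncard = 1 ∧ I ∩ J = ∅ ∧ I ∩ K = ∅ ∧ J ∩ K = ∅) ∨
      (I.ncard = 3 ∧ J.ncard = 3 ∧ K = ∅ ∧ (I ∩ J).ncard = 1))

/-- The 5-configuration `S` splits: one of its 30 associated Dodgson
polynomials is identically zero. -/
def ConfigSplits (S : Set G.E) : Prop :=
  ∃ I J K : Set G.E, G.DodgsonConfig S I J K ∧ ∀ v0 : G.V, G.dodgson v0 I J K = 0

/-- `G` is Feynman 5-split: every 5-configuration splits. -/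
def FeynmanSplit : Prop := ∀ S : Set G.E, S.ncard = 5 → G.ConfigSplits S

/-- `(U, F)` is a subgraph of `G` (every edge of `F` has both ends in `U`). -/
def IsSubgraphPair (U : Set G.V) (F : Set G.E) : Prop :=
  ∀ e ∈ F, G.src e ∈ U ∧ G.tgt e ∈ U

/-- `G` decomposes into edge-disjoint subgraphs `G₁ ∪ G₂ = G` with
`|V(G₁) ∩ V(G₂)| ≤ 2` and `|E(G₁) ∩ S| = 2`, or with
`|V(G₁) ∩ V(G₂)| = 1` and `|E(G₁) ∩ S| = 1`. -/
def splitWitness (S : Set G.E) : Prop :=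
  ∃ (U1 U2 : Set G.V) (F1 F2 : Set G.E),
    G.IsSubgraphPair U1 F1 ∧ G.IsSubgraphPair U2 F2 ∧
    Disjoint F1 F2 ∧ U1 ∪ U2 = Set.univ ∧ F1 ∪ F2 = Set.univ ∧
    (((U1 ∩ U2).ncard ≤ 2 ∧ (F1 ∩ S).ncard = 2) ∨
      ((U1 ∩ U2).ncard = 1 ∧ (F1 ∩ S).ncard = 1))

/-- A separation of order at most 1 with edges of `S` on both sides, or a
("bad") 2-separation with `min{|A ∩ S|, |B ∩ S|} = 2`. -/
def badSplitSep (S : Set G.E) : Prop :=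
  ∃ A : Set G.E,
    (G.sepOrder A ≤ 1 ∧ (A ∩ S).Nonempty ∧ (Aᶜ ∩ S).Nonempty) ∨
      (G.sepOrder A = 2 ∧ min (A ∩ S).ncard (Aᶜ ∩ S).ncard = 2)

/-- Isomorphism of multigraphs. -/
def IsoTo (G' : Multigraph) : Prop :=
  ∃ (α : G.V ≃ G'.V) (β : G.E ≃ G'.E),
    ∀ e : G.E, G'.ends (β e) = Sym2.map α (G.ends e)

/-- `G` is a tree. -/
def IsTree : Prop := G.Connected ∧ G.IsForest Set.univ

/-- Every vertex has degree 1 or 3. -/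
def IsCubic : Prop := ∀ v : G.V, G.degree v = 1 ∨ G.degree v = 3

/-- A leaf. -/
def IsLeaf (v : G.V) : Prop := G.degree v = 1

/-- A cubic caterpillar: a cubic tree whose non-leaf vertices induce a path. -/
def IsCubicCaterpillar : Prop :=
  G.IsTree ∧ G.IsCubic ∧
    (∀ a ∈ {v : G.V | ¬ G.IsLeaf v}, ∀ b ∈ {v : G.V | ¬ G.IsLeaf v},
      Relation.ReflTransGen (G.stepWithin {v : G.V | ¬ G.IsLeaf v}) a b) ∧
    ∀ v : G.V, ¬ G.IsLeaf v →
      ({e : G.E | G.inc v e ∧ ∃ w : G.V, ¬ G.IsLeaf w ∧ G.inc w e ∧ w ≠ v}).ncard ≤ 2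

/-- The branch decomposition `(T, φ)` of the cycle matroid `M(G)` has width at
most `k`: removing any edge `f` of `T` gives a separation of the ground set
of matroid order at most `k`. -/
def branchWidthLE (T : Multigraph) (φ : G.E → T.V) (k : ℕ) : Prop :=
  ∀ f : T.E,
    G.msepOrder {e : G.E | φ e ∈ {x : T.V | T.reachOn {f}ᶜ (T.src f) x}} ≤ k

/-- `(T, φ)` is a branch decomposition of `M(G)` over a cubic caterpillar. -/
def IsCatDecomp (T : Multigraph) (φ : G.E → T.V) : Prop :=
  T.IsCubicCaterpillar ∧ Function.Injective φ ∧ ∀ e : G.E, T.IsLeaf (φ e)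

/-- The caterpillar width of the cycle matroid `M(G)`. -/
def catWidth : ℕ :=
  sInf {k | ∃ (T : Multigraph) (φ : G.E → T.V), G.IsCatDecomp T φ ∧ G.branchWidthLE T φ k}

end Multigraph

/-! ### Concrete graphs -/

/-- The complete graph `K₅`. -/
def K5m : Multigraph where
  V := Fin 5
  E := {p : Fin 5 × Fin 5 // p.1 < p.2}
  src := fun e => e.1.1
  tgt := fun e => e.1.2

/-- The complete bipartite graph `K₃,₃`. -/
def K33m : Multigraph where
  V := Fin 3 ⊕ Fin 3
  E := Fin 3 × Fin 3
  src := fun e => Sum.inl e.1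
  tgt := fun e => Sum.inr e.2

/-- The cube (3-dimensional hypercube) graph `C`. -/
def cubeM : Multigraph where
  V := Fin 2 × Fin 2 × Fin 2
  E := Fin 3 × Fin 2 × Fin 2
  src := fun e =>
    if e.1 = 0 then (0, e.2.1, e.2.2) else if e.1 = 1 then (e.2.1, 0, e.2.2)
      else (e.2.1, e.2.2, 0)
  tgt := fun e =>
    if e.1 = 0 then (1, e.2.1, e.2.2) else if e.1 = 1 then (e.2.1, 1, e.2.2)
      else (e.2.1, e.2.2, 1)

/-- The octahedron graph `O = K₂,₂,₂`. -/
def octaM : Multigraph where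
  V := Fin 3 × Fin 2
  E := {p : (Fin 3 × Fin 2) × (Fin 3 × Fin 2) // p.1.1 < p.2.1}
  src := fun e => e.1.1
  tgt := fun e => e.1.2

/-- The edges of the graph `H` (the cube after a Y–Δ transformation at one
vertex): vertices `0,1,2` form the new triangle, `6` is the antipodal vertex. -/
def hEdgeList : List (Fin 7 × Fin 7) :=
  [(0,1), (0,2), (1,2), (0,3), (0,4), (1,3), (1,5), (2,4), (2,5), (3,6), (4,6), (5,6)]

/-- The graph `H`, one Δ–Y away from each of the cube and the octahedron. -/
def Hm : Multigraph where
  V := Fin 7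
  E := {p : Fin 7 × Fin 7 // p ∈ hEdgeList}
  src := fun e => e.1.1
  tgt := fun e => e.1.2

/-- The complete graph `K₄`. -/
def K4m : Multigraph where
  V := Fin 4
  E := {p : Fin 4 × Fin 4 // p.1 < p.2}
  src := fun e => e.1.1
  tgt := fun e => e.1.2

/-- `K₅⁻`, the complete graph on 5 vertices minus the edge `{3,4}`. -/
def K5minusM : Multigraph where
  V := Fin 5
  E := {p : Fin 5 × Fin 5 // p.1 < p.2 ∧ ¬(p.1 = 3 ∧ p.2 = 4)}
  src := fun e => e.1.1
  tgt := fun e => e.1.2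

/-- The wheel `W_k`: centre `none`; rim edges `Sum.inl i` join `some i` to
`some (i+1)`, spoke edges `Sum.inr i` join the centre to `some i`. -/
def wheelM (k : ℕ) : Multigraph where
  V := Option (Fin k)
  E := Fin k ⊕ Fin k
  src := Sum.elim (fun i => some i) (fun _ => none)
  tgt := Sum.elim (fun i => some (finRotate k i)) (fun i => some i)

/-! ### Enhanced graphs -/

/-- An enhanced graph: a graph together with sets of contract-proof and
delete-proof edges. -/
structure EGraph : Type 1 where
  G : Multigraph
  Cp : Set G.E
  Dp : Set G.E

namespace EGraph

/-- The 5-configuration `S` of an enhanced graph splits. -/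
def Splits (H : EGraph) (S : Set H.G.E) : Prop :=
  H.G.badSplitSep S ∨
    (∃ f ∈ S \ H.Dp, (H.G.minorDC {f} ∅).badSplitSep {e | e.1 ∈ S}) ∨
    (∃ f ∈ S \ H.Cp, (H.G.minorDC ∅ {f}).badSplitSep {e | e.1 ∈ S})

/-- An enhanced graph is non-split if it has a non-split 5-configuration. -/
def NonSplit (H : EGraph) : Prop := ∃ S : Set H.G.E, S.ncard = 5 ∧ ¬ H.Splits S

/-- Deletion of an edge. -/
def delE (H : EGraph) (f : H.G.E) : EGraph :=
  ⟨H.G.minorDC {f} ∅, {e | e.1 ∈ H.Cp}, {e | e.1 ∈ H.Dp}⟩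

/-- Contraction of an edge. -/
def conE (H : EGraph) (f : H.G.E) : EGraph :=
  ⟨H.G.minorDC ∅ {f}, {e | e.1 ∈ H.Cp}, {e | e.1 ∈ H.Dp}⟩

/-- Deletion of a vertex. -/
def delV (H : EGraph) (v : H.G.V) : EGraph :=
  ⟨H.G.deleteVertex v, {e | e.1 ∈ H.Cp}, {e | e.1 ∈ H.Dp}⟩

/-- Remove an edge from the contract-proof set. -/
def unprotC (H : EGraph) (f : H.G.E) : EGraph := ⟨H.G, H.Cp \ {f}, H.Dp⟩

/-- Remove an edge from the delete-proof set. -/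
def unprotD (H : EGraph) (f : H.G.E) : EGraph := ⟨H.G, H.Cp, H.Dp \ {f}⟩

/-- Delete `f'` of a parallel pair `f, f'` and make `f` delete-proof. -/
def parallelReduce (H : EGraph) (f f' : H.G.E) : EGraph :=
  ⟨H.G.minorDC {f'} ∅, {e | e.1 ∈ H.Cp}, {e | e.1 ∈ H.Dp ∨ e.1 = f}⟩

/-- Contract `f'` of the two edges `f, f'` at a degree-two vertex and make
`f` contract-proof. -/
def seriesReduce (H : EGraph) (f f' : H.G.E) : EGraph :=
  ⟨H.G.minorDC ∅ {f'}, {e | e.1 ∈ H.Cp ∨ e.1 = f}, {e | e.1 ∈ H.Dp}⟩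

/-- One step of the enhanced-graph minor relation. -/
inductive MinorStep : EGraph → EGraph → Prop
  | delV (H : EGraph) (v : H.G.V) : MinorStep H (H.delV v)
  | delE (H : EGraph) (f : H.G.E) : MinorStep H (H.delE f)
  | conE (H : EGraph) (f : H.G.E) : MinorStep H (H.conE f)
  | unprotC (H : EGraph) (f : H.G.E) (hf : f ∈ H.Cp) : MinorStep H (H.unprotC f)
  | unprotD (H : EGraph) (f : H.G.E) (hf : f ∈ H.Dp) : MinorStep H (H.unprotD f)
  | parallel (H : EGraph) (f f' : H.G.E) (hne : f ≠ f')
      (hpar : H.G.ends f = H.G.ends f') : MinorStep H (H.parallelReduce f f')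
  | series (H : EGraph) (f f' : H.G.E) (v : H.G.V) (hne : f ≠ f')
      (hf : H.G.inc v f) (hf' : H.G.inc v f')
      (hdeg : ∀ e : H.G.E, H.G.inc v e → e = f ∨ e = f') :
      MinorStep H (H.seriesReduce f f')

/-- Minor-minimal non-split enhanced graph: non-split, but every proper
enhanced minor is split. -/
def MinorMinimalNonSplit (H : EGraph) : Prop :=
  H.NonSplit ∧ ∀ H' : EGraph, Relation.TransGen MinorStep H H' → ¬ H'.NonSplit

/-- Isomorphism of enhanced graphs. -/
def IsoTo (H H' : EGraph) : Prop :=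
  ∃ (α : H.G.V ≃ H'.G.V) (β : H.G.E ≃ H'.G.E),
    (∀ e : H.G.E, H'.G.ends (β e) = Sym2.map α (H.G.ends e)) ∧
    (∀ e : H.G.E, β e ∈ H'.Cp ↔ e ∈ H.Cp) ∧
    (∀ e : H.G.E, β e ∈ H'.Dp ↔ e ∈ H.Dp)

end EGraph

/-- The edge `01` of `K₄`. -/
def e01K4 : K4m.E := ⟨(0, 1), by decide⟩

/-- The enhanced graph `K₄(1)`: all edges of `K₄` except one are both
contract-proof and delete-proof. -/
def K4one : EGraph := ⟨K4m, {e | e ≠ e01K4}, {e | e ≠ e01K4}⟩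

/-! ### The statement -/

open Multigraph

/-! ### Connected vertex sets of a simple graph -/

namespace SimpleGraph

variable {V V' : Type} {H' : SimpleGraph V'} {H : SimpleGraph V}

/-- `U` is nonempty and every proper nonempty part of it has an edge to the rest of `U`. -/
def Cn (H : SimpleGraph V) (U : Set V) : Prop :=
  U.Nonempty ∧ ∀ W ⊆ U, W.Nonempty → (∃ u ∈ U, u ∉ W) → ∃ a ∈ W, ∃ b ∈ U, b ∉ W ∧ H.Adj a b

/-- Some edge joins `A` to `B`. -/
def Touch (H : SimpleGraph V) (A B : Set V) : Prop := ∃ a ∈ A, ∃ b ∈ B, H.Adj a b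

/-- `K` is a connected component of the subgraph induced by `U`. -/
def IsComp (H : SimpleGraph V) (U K : Set V) : Prop :=
  H.Cn K ∧ K ⊆ U ∧ ∀ a ∈ K, ∀ b ∈ U, H.Adj a b → b ∈ K

theorem Touch.symm {A B : Set V} (h : H.Touch A B) : H.Touch B A := by
  obtain ⟨a, ha, b, hb, hab⟩ := h
  exact ⟨b, hb, a, ha, hab.symm⟩

theorem Touch.mono {A B A' B' : Set V} (h : H.Touch A B) (hA : A ⊆ A') (hB : B ⊆ B') :
    H.Touch A' B' := by
  obtain ⟨a, ha, b, hb, hab⟩ := h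
  exact ⟨a, hA ha, b, hB hb, hab⟩

theorem Cn.nonempty {U : Set V} (h : H.Cn U) : U.Nonempty := h.1

theorem Cn.eq_of_closed {U K : Set V} (h : H.Cn U) (hK : K.Nonempty) (hKU : K ⊆ U)
    (hc : ∀ a ∈ K, ∀ b ∈ U, H.Adj a b → b ∈ K) : K = U := by
  by_contra hne
  have : ∃ u ∈ U, u ∉ K := by
    by_contra hcon
    push Not at hcon
    exact hne (Set.Subset.antisymm hKU hcon)
  obtain ⟨a, ha, b, hb, hbK, hab⟩ := h.2 K hKU hK this
  exact hbK (hc a ha b hb hab)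

theorem cn_singleton (v : V) : H.Cn {v} := by
  refine ⟨⟨v, rfl⟩, ?_⟩
  rintro W hW ⟨w, hw⟩ ⟨u, hu, huW⟩
  have h1 := hW hw
  rw [Set.mem_singleton_iff] at h1 hu
  subst h1 hu
  exact absurd hw huW

theorem cn_union_of_mem {A B : Set V} (hA : H.Cn A) (hB : H.Cn B) {v : V} (hvA : v ∈ A)
    (hvB : v ∈ B) : H.Cn (A ∪ B) := by
  refine ⟨⟨v, Or.inl hvA⟩, ?_⟩
  intro W hW hne hu
  by_contra hcon
  push Not at hcon
  have key : ∀ C : Set V, H.Cn C → C ⊆ A ∪ B → (∃ c ∈ C, c ∈ W) → C ⊆ W := by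
    intro C hC hCs hCW
    by_contra hns
    obtain ⟨u, huC, huW⟩ := Set.not_subset.1 hns
    obtain ⟨a, ha, b, hb, hbn, hab⟩ := hC.2 (C ∩ W) Set.inter_subset_left
      (by obtain ⟨c, hc, hcW⟩ := hCW; exact ⟨c, hc, hcW⟩) ⟨u, huC, fun h => huW h.2⟩
    exact hcon a ha.2 b (hCs hb) (fun h => hbn ⟨hb, h⟩) hab
  have hv : v ∈ W := by
    obtain ⟨w, hw⟩ := hne
    rcases hW hw with h | h
    · exact key A hA Set.subset_union_left ⟨w, h, hw⟩ hvA
    · exact key B hB Set.subset_union_right ⟨w, h, hw⟩ hvB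
  obtain ⟨u, hu, huW⟩ := hu
  rcases hu with h | h
  · exact huW (key A hA Set.subset_union_left ⟨v, hvA, hv⟩ h)
  · exact huW (key B hB Set.subset_union_right ⟨v, hvB, hv⟩ h)

theorem cn_pair {a b : V} (h : H.Adj a b) : H.Cn {a, b} := by
  refine ⟨⟨a, by simp⟩, ?_⟩
  intro W hW hne hu
  obtain ⟨w, hw⟩ := hne
  obtain ⟨u, hu, huW⟩ := hu
  have h1 := hW hw
  simp only [Set.mem_insert_iff, Set.mem_singleton_iff] at h1 hu
  rcases h1 with rfl | rfl <;> rcases hu with rfl | rfl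
  · exact absurd hw huW
  · exact ⟨_, hw, _, by simp, huW, h⟩
  · exact ⟨_, hw, _, by simp, huW, h.symm⟩
  · exact absurd hw huW

theorem Cn.union {A B : Set V} (hA : H.Cn A) (hB : H.Cn B) (h : H.Touch A B) :
    H.Cn (A ∪ B) := by
  obtain ⟨a, ha, b, hb, hab⟩ := h
  have h1 : H.Cn (A ∪ {a, b}) := cn_union_of_mem hA (cn_pair hab) ha (by simp)
  have h2 := cn_union_of_mem h1 hB (v := b) (by simp) hb
  convert h2 using 1
  ext x
  simp only [Set.mem_union, Set.mem_insert_iff, Set.mem_singleton_iff]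
  constructor
  · tauto
  · rintro ((h | rfl | rfl) | h) <;> tauto

theorem Cn.insert {A : Set V} (hA : H.Cn A) {v : V} (h : H.Touch {v} A) :
    H.Cn (Insert.insert v A) := by
  rw [Set.insert_eq]
  exact (cn_singleton v).union hA h

theorem exists_isComp [Finite V] {U : Set V} {v : V} (hv : v ∈ U) :
    ∃ K, v ∈ K ∧ H.IsComp U K := by
  obtain ⟨K, hK⟩ := (Set.toFinite {K : Set V | v ∈ K ∧ K ⊆ U ∧ H.Cn K}).exists_maximal
    ⟨{v}, rfl, by simpa using hv, cn_singleton v⟩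
  refine ⟨K, hK.1.1, hK.1.2.2, hK.1.2.1, fun a ha b hb hab => ?_⟩
  have h1 : H.Cn (K ∪ {b}) := hK.1.2.2.union (cn_singleton b) ⟨a, ha, b, rfl, hab⟩
  exact hK.2 (y := K ∪ {b}) ⟨Or.inl hK.1.1, Set.union_subset hK.1.2.1 (by simpa using hb), h1⟩
    Set.subset_union_left (Or.inr rfl)

theorem IsComp.cn {U K : Set V} (h : H.IsComp U K) : H.Cn K := h.1

theorem IsComp.subset {U K : Set V} (h : H.IsComp U K) : K ⊆ U := h.2.1

theorem IsComp.closed {U K : Set V} (h : H.IsComp U K) {a b : V} (ha : a ∈ K) (hb : b ∈ U)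
    (hab : H.Adj a b) : b ∈ K := h.2.2 a ha b hb hab

theorem IsComp.subset_of_mem {U K C : Set V} (h : H.IsComp U K) (hC : H.Cn C) (hCU : C ⊆ U)
    {v : V} (hv : v ∈ K) (hvC : v ∈ C) : C ⊆ K := by
  have : C ∩ K = C := hC.eq_of_closed ⟨v, hvC, hv⟩ Set.inter_subset_left
    fun a ha b hb hab => ⟨hb, h.closed ha.2 (hCU hb) hab⟩
  rw [← this]
  exact Set.inter_subset_right

theorem IsComp.eq_of_mem {U K K' : Set V} (h : H.IsComp U K) (h' : H.IsComp U K') {v : V}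
    (hv : v ∈ K) (hv' : v ∈ K') : K = K' :=
  Set.Subset.antisymm (h'.subset_of_mem h.cn h.subset hv' hv)
    (h.subset_of_mem h'.cn h'.subset hv hv')

theorem IsComp.disjoint {U K K' : Set V} (h : H.IsComp U K) (h' : H.IsComp U K') (hne : K ≠ K') :
    Disjoint K K' :=
  Set.disjoint_left.2 fun _ hv hv' => hne (h.eq_of_mem h' hv hv')

/-- A disconnected nonempty set has two components. -/
theorem exists_two_comps [Finite V] {U : Set V} (hne : U.Nonempty) (h : ¬ H.Cn U) :
    ∃ K K', H.IsComp U K ∧ H.IsComp U K' ∧ K ≠ K' := by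
  obtain ⟨v, hv⟩ := hne
  obtain ⟨K, hvK, hK⟩ := exists_isComp (H := H) hv
  by_cases hKU : K = U
  · exact absurd (hKU ▸ hK.cn) h
  · obtain ⟨w, hw, hwK⟩ : ∃ w ∈ U, w ∉ K := by
      by_contra hcon
      push Not at hcon
      exact hKU (Set.Subset.antisymm hK.subset hcon)
    obtain ⟨K', hwK', hK'⟩ := exists_isComp (H := H) hw
    exact ⟨K, K', hK, hK', fun h => hwK (h ▸ hwK')⟩

/-- Removing from a connected set a union of components of `U ∖ {q}` leaves a connected set. -/
theorem Cn.diff_closed {U K : Set V} (hU : H.Cn U) {q : V} (hq : q ∈ U) (hqK : q ∉ K)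
    (hc : ∀ a ∈ K, ∀ b ∈ U, b ≠ q → H.Adj a b → b ∈ K) : H.Cn (U \ K) := by
  refine ⟨⟨q, hq, hqK⟩, ?_⟩
  intro W hW hne hu
  by_cases hqW : q ∈ W
  · obtain ⟨u, hu, huW⟩ := hu
    obtain ⟨a, ha, b, hb, hbn, hab⟩ := hU.2 ((U \ K) \ W) (fun x hx => hx.1.1) ⟨u, hu, huW⟩
      ⟨q, hq, fun h => h.2 hqW⟩
    have hbK : b ∉ K := fun hbK =>
      ha.1.2 (hc b hbK a ha.1.1 (fun h => ha.2 (h ▸ hqW)) hab.symm)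
    have hbW : b ∈ W := by
      by_contra hbW
      exact hbn ⟨⟨hb, hbK⟩, hbW⟩
    exact ⟨b, hbW, a, ha.1, ha.2, hab.symm⟩
  · obtain ⟨a, ha, b, hb, hbn, hab⟩ := hU.2 W (fun x hx => (hW hx).1) hne ⟨q, hq, hqW⟩
    refine ⟨a, ha, b, ⟨hb, fun hbK => ?_⟩, hbn, hab⟩
    exact (hW ha).2 (hc b hbK a (hW ha).1 (fun h => hqW (h ▸ ha)) hab.symm)

theorem IsComp.cn_diff {U K : Set V} {q : V} (h : H.IsComp (U \ {q}) K) (hU : H.Cn U)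
    (hq : q ∈ U) : H.Cn (U \ K) :=
  hU.diff_closed hq (fun hqK => (h.subset hqK).2 rfl)
    fun _ ha _ hb hbq hab => h.closed ha ⟨hb, hbq⟩ hab

theorem IsComp.touch_cut {U K : Set V} {q : V} (h : H.IsComp (U \ {q}) K) (hU : H.Cn U)
    (hq : q ∈ U) : H.Touch K {q} := by
  obtain ⟨a, ha, b, hb, hbn, hab⟩ := hU.2 K (fun x hx => (h.subset hx).1) h.cn.nonempty
    ⟨q, hq, fun hqK => (h.subset hqK).2 rfl⟩
  by_cases hbq : b = q
  · exact ⟨a, ha, b, hbq, hab⟩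
  · exact absurd (h.closed ha ⟨hb, hbq⟩ hab) hbn

/-- Images of connected sets under maps that preserve or contract edges. -/
theorem Cn.image {f : V → V'} (hf : ∀ a b, H.Adj a b → f a = f b ∨ H'.Adj (f a) (f b))
    {P : Set V} (hP : H.Cn P) : H'.Cn (f '' P) := by
  refine ⟨hP.nonempty.image f, ?_⟩
  rintro W hW ⟨w, hw⟩ ⟨u, ⟨p, hp, rfl⟩, hu⟩
  obtain ⟨q, hq, rfl⟩ := hW hw
  obtain ⟨a, ha, b, hb, hbn, hab⟩ := hP.2 (P ∩ f ⁻¹' W) Set.inter_subset_left ⟨q, hq, hw⟩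
    ⟨p, hp, fun h => hu h.2⟩
  have hbW : f b ∉ W := fun h => hbn ⟨hb, h⟩
  rcases hf a b hab with h | h
  · exact absurd (h ▸ ha.2 : f b ∈ W) hbW
  · exact ⟨f a, ha.2, f b, ⟨b, hb, rfl⟩, hbW, h⟩

/-- Preimages of connected sets under maps with connected fibres. -/
theorem Cn.preimage {r : V → V'}
    (hr : ∀ a b, H'.Adj a b → ∃ a' b', r a' = a ∧ r b' = b ∧ H.Adj a' b')
    {P : Set V'} (hfib : ∀ p ∈ P, H.Cn (r ⁻¹' {p})) (hP : H'.Cn P) : H.Cn (r ⁻¹' P) := by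
  obtain ⟨p, hp⟩ := hP.nonempty
  obtain ⟨v, hv⟩ := (hfib p hp).nonempty
  refine ⟨⟨v, by rw [Set.mem_preimage, show r v = p from hv]; exact hp⟩, ?_⟩
  rintro W hW ⟨w, hw⟩ ⟨u, hu, huW⟩
  by_contra hcon
  push Not at hcon
  have key : ∀ p ∈ P, (∃ v ∈ W, r v = p) → r ⁻¹' {p} ⊆ W := by
    rintro p hp ⟨v, hvW, hv⟩
    by_contra hns
    obtain ⟨u, huC, huW⟩ := Set.not_subset.1 hns
    obtain ⟨a, ha, b, hb, hbn, hab⟩ := (hfib p hp).2 (r ⁻¹' {p} ∩ W) Set.inter_subset_left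
      ⟨v, hv, hvW⟩ ⟨u, huC, fun h => huW h.2⟩
    refine hcon a ha.2 b ?_ (fun h => hbn ⟨hb, h⟩) hab
    rw [Set.mem_preimage, show r b = p from hb]
    exact hp
  obtain ⟨a, ⟨v, hvW, hva⟩, b, hb, hbn, hab⟩ := hP.2 (r '' W)
    (by rintro _ ⟨w, hw, rfl⟩; exact hW hw) ⟨r w, w, hw, rfl⟩
    ⟨r u, hu, fun ⟨v, hv, hvu⟩ => huW (key (r u) hu ⟨v, hv, hvu⟩ rfl)⟩
  obtain ⟨a', b', rfl, rfl, hab'⟩ := hr a b hab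
  have ha' : a' ∈ W := key (r a') (hva ▸ hW hvW) ⟨v, hvW, hva⟩ rfl
  exact hcon a' ha' b' hb (fun h => hbn ⟨b', h, rfl⟩) hab'

/-- The simple graph obtained from `H` by identifying vertices along `r`. -/
def along (H : SimpleGraph V) (r : V → V') : SimpleGraph V' where
  Adj a b := a ≠ b ∧ ∃ a' b', r a' = a ∧ r b' = b ∧ H.Adj a' b'
  symm := ⟨by rintro a b ⟨h, a', b', ha, hb, hab⟩; exact ⟨h.symm, b', a', hb, ha, hab.symm⟩⟩
  loopless := ⟨fun _ h => h.1 rfl⟩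

theorem along_adj {r : V → V'} {a b : V'} :
    (H.along r).Adj a b ↔ a ≠ b ∧ ∃ a' b', r a' = a ∧ r b' = b ∧ H.Adj a' b' := Iff.rfl

theorem Cn.along_image {r : V → V'} {P : Set V} (hP : H.Cn P) : (H.along r).Cn (r '' P) := by
  refine hP.image fun a b hab => ?_
  by_cases h : r a = r b
  · exact Or.inl h
  · exact Or.inr ⟨h, a, b, rfl, rfl, hab⟩

theorem Cn.along_preimage {r : V → V'} {P : Set V'} (hfib : ∀ p, H.Cn (r ⁻¹' {p}))
    (hP : (H.along r).Cn P) : H.Cn (r ⁻¹' P) :=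
  Cn.preimage (fun _ _ h => (along_adj.1 h).2) (fun p _ => hfib p) hP

theorem Touch.along_preimage {r : V → V'} {P Q : Set V'} (h : (H.along r).Touch P Q) :
    H.Touch (r ⁻¹' P) (r ⁻¹' Q) := by
  obtain ⟨a, ha, b, hb, -, a', b', rfl, rfl, hab⟩ := h
  exact ⟨a', ha, b', hb, hab⟩

/-- The map contracting `D` onto its representative `d`. -/
def squash (D : Set V) (d : V) (v : V) : {w : V // w ∉ D ∨ w = d} :=
  if h : v ∈ D then ⟨d, Or.inr rfl⟩ else ⟨v, Or.inl h⟩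

theorem squash_of_mem {D : Set V} {d v : V} (h : v ∈ D) : (squash D d v).1 = d := by
  simp [squash, h]

theorem squash_of_notMem {D : Set V} {d v : V} (h : v ∉ D) : (squash D d v).1 = v := by
  simp [squash, h]

theorem squash_fibre {D : Set V} {d : V} (hd : d ∈ D) (hD : H.Cn D)
    (p : {w : V // w ∉ D ∨ w = d}) : H.Cn (squash D d ⁻¹' {p}) := by
  by_cases hp : p.1 = d
  · convert hD using 1
    ext v
    simp only [Set.mem_preimage, Set.mem_singleton_iff, Subtype.ext_iff, hp]
    by_cases hv : v ∈ D
    · simp [squash_of_mem hv, hv]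
    · simp only [squash_of_notMem hv, hv, iff_false]
      rintro rfl
      exact hv hd
  · convert cn_singleton (H := H) p.1 using 1
    have hpD : p.1 ∉ D := p.2.resolve_right hp
    ext v
    simp only [Set.mem_preimage, Set.mem_singleton_iff, Subtype.ext_iff]
    by_cases hv : v ∈ D
    · simp only [squash_of_mem hv]
      exact ⟨fun h => absurd h.symm hp, fun h => absurd (h ▸ hv) hpD⟩
    · simp only [squash_of_notMem hv]

theorem squash_card_lt [Finite V] {D : Set V} {d e : V} (he : e ∈ D) (hed : e ≠ d) :
    Nat.card {w : V // w ∉ D ∨ w = d} < Nat.card V := by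
  have : Fintype V := Fintype.ofFinite V
  rw [Nat.card_eq_fintype_card, Nat.card_eq_fintype_card]
  refine Fintype.card_subtype_lt (x := e) ?_
  rintro (h | h)
  · exact h he
  · exact hed h

end SimpleGraph

/-! ### Labelled connected graphs -/

namespace SimpleGraph

variable {W W' : Type}

/-- Two disjoint adjacent connected sets, each meeting all three labels. -/
def Gam (H : SimpleGraph W) (X Y Z : Set W) : Prop :=
  ∃ P Q, H.Cn P ∧ H.Cn Q ∧ Disjoint P Q ∧ H.Touch P Q ∧
    (P ∩ X).Nonempty ∧ (P ∩ Y).Nonempty ∧ (P ∩ Z).Nonempty ∧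
    (Q ∩ X).Nonempty ∧ (Q ∩ Y).Nonempty ∧ (Q ∩ Z).Nonempty

/-- Three disjoint pairwise adjacent connected sets, each meeting a different pair of labels. -/
def Alp (H : SimpleGraph W) (X Y Z : Set W) : Prop :=
  ∃ P Q R, H.Cn P ∧ H.Cn Q ∧ H.Cn R ∧ Disjoint P Q ∧ Disjoint P R ∧ Disjoint Q R ∧
    H.Touch P Q ∧ H.Touch P R ∧ H.Touch Q R ∧
    (P ∩ X).Nonempty ∧ (P ∩ Z).Nonempty ∧ (Q ∩ X).Nonempty ∧ (Q ∩ Y).Nonempty ∧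
    (R ∩ Y).Nonempty ∧ (R ∩ Z).Nonempty

theorem nonempty_preimage_inter {r : W → W'} {P : Set W'} {X : Set W}
    (h : (P ∩ r '' X).Nonempty) : (r ⁻¹' P ∩ X).Nonempty := by
  obtain ⟨_, hp, x, hx, rfl⟩ := h
  exact ⟨x, hp, hx⟩

theorem Gam.lift {H : SimpleGraph W} {r : W → W'} (hfib : ∀ p, H.Cn (r ⁻¹' {p})) {X Y Z : Set W}
    (h : (H.along r).Gam (r '' X) (r '' Y) (r '' Z)) : H.Gam X Y Z := by
  obtain ⟨P, Q, hP, hQ, hPQ, ht, h1, h2, h3, h4, h5, h6⟩ := h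
  exact ⟨r ⁻¹' P, r ⁻¹' Q, hP.along_preimage hfib, hQ.along_preimage hfib, hPQ.preimage r,
    ht.along_preimage, nonempty_preimage_inter h1, nonempty_preimage_inter h2,
    nonempty_preimage_inter h3, nonempty_preimage_inter h4, nonempty_preimage_inter h5,
    nonempty_preimage_inter h6⟩

theorem Alp.lift {H : SimpleGraph W} {r : W → W'} (hfib : ∀ p, H.Cn (r ⁻¹' {p})) {X Y Z : Set W}
    (h : (H.along r).Alp (r '' X) (r '' Y) (r '' Z)) : H.Alp X Y Z := by
  obtain ⟨P, Q, R, hP, hQ, hR, hPQ, hPR, hQR, ht1, ht2, ht3, h1, h2, h3, h4, h5, h6⟩ := h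
  exact ⟨r ⁻¹' P, r ⁻¹' Q, r ⁻¹' R, hP.along_preimage hfib, hQ.along_preimage hfib,
    hR.along_preimage hfib, hPQ.preimage r, hPR.preimage r, hQR.preimage r,
    ht1.along_preimage, ht2.along_preimage, ht3.along_preimage, nonempty_preimage_inter h1,
    nonempty_preimage_inter h2, nonempty_preimage_inter h3, nonempty_preimage_inter h4,
    nonempty_preimage_inter h5, nonempty_preimage_inter h6⟩

variable {H : SimpleGraph W}

theorem touch_compl_singleton (h2 : ∀ v, H.Cn {v}ᶜ) {p q : W} (hpq : p ≠ q)
    (hcard : ∃ s, s ≠ p ∧ s ≠ q) : H.Touch {p} {q}ᶜ := by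
  obtain ⟨s, hsp, hsq⟩ := hcard
  obtain ⟨a, ha, b, hb, hbn, hab⟩ := (h2 q).2 {p} (by rintro _ rfl; exact hpq) ⟨p, rfl⟩ ⟨s, hsq, hsp⟩
  exact ⟨a, ha, b, hb, hab⟩

/-- In a 2-connected graph every vertex `p` has a neighbour `q`, different from a prescribed vertex,
such that removing both keeps the graph connected. -/
theorem exists_contractible [Finite W] (h2 : ∀ v, H.Cn {v}ᶜ) {p q₁ : W} (hp : p ≠ q₁)
    (hcard : ∃ s, s ≠ p ∧ s ≠ q₁) : ∃ q, q ≠ q₁ ∧ H.Adj p q ∧ H.Cn {p, q}ᶜ := by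
  obtain ⟨a, rfl, b, hb, hab⟩ := touch_compl_singleton h2 hp hcard
  obtain ⟨C, hC⟩ := (Set.toFinite {C : Set W | q₁ ∈ C ∧ H.Cn C ∧
    ∃ q, q ≠ q₁ ∧ H.Adj a q ∧ C ⊆ {a, q}ᶜ}).exists_maximal
    ⟨{q₁}, rfl, cn_singleton _, b, hb, hab, by
      rintro _ rfl
      simp only [Set.mem_compl_iff, Set.mem_insert_iff, Set.mem_singleton_iff, not_or]
      exact ⟨hp.symm, fun h => hb h.symm⟩⟩
  obtain ⟨⟨hqC, hCn, q, hqq, haq, hCs⟩, hmax⟩ := hC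
  refine ⟨q, hqq, haq, ?_⟩
  by_cases hCe : C = {a, q}ᶜ
  · exact hCe ▸ hCn
  exfalso
  have hcomp : H.IsComp {a, q}ᶜ C := by
    refine ⟨hCn, hCs, fun u hu v hv huv => ?_⟩
    exact hmax (y := C ∪ {v}) ⟨Or.inl hqC, hCn.union (cn_singleton v) ⟨u, hu, v, rfl, huv⟩, q, hqq,
      haq, Set.union_subset hCs (by simpa using hv)⟩ Set.subset_union_left (Or.inr rfl)
  obtain ⟨v, hv, hvC⟩ : ∃ v ∈ ({a, q}ᶜ : Set W), v ∉ C := by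
    by_contra hcon
    push Not at hcon
    exact hCe (Set.Subset.antisymm hCs hcon)
  obtain ⟨K, hvK, hK⟩ := exists_isComp (H := H) hv
  have hKC : K ≠ C := fun h => hvC (h ▸ hvK)
  have hdis := hK.disjoint hcomp hKC
  have hqe : ({a, q}ᶜ : Set W) = {q}ᶜ \ {a} := by
    ext w
    simp only [Set.mem_compl_iff, Set.mem_insert_iff, Set.mem_singleton_iff, Set.mem_sdiff]
    tauto
  have hae : ({a, q}ᶜ : Set W) = {a}ᶜ \ {q} := by
    ext w
    simp only [Set.mem_compl_iff, Set.mem_insert_iff, Set.mem_singleton_iff, Set.mem_sdiff]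
    tauto
  have haqne : a ≠ q := haq.ne
  obtain ⟨k, hk, _, rfl, hka⟩ := IsComp.touch_cut (hqe ▸ hK) (h2 q) (q := a) haqne
  have hCq : H.Touch C {q} := IsComp.touch_cut (hae ▸ hcomp) (h2 _) haqne.symm
  have hkC : k ∉ C := Set.disjoint_left.1 hdis hk
  have hkq : k ≠ q := fun h => (hK.subset hk) (by simp [h])
  have := hmax (y := C ∪ {q}) ⟨Or.inl hqC, hCn.union (cn_singleton q) hCq, k,
    fun h => hkC (h ▸ hqC), hka.symm, ?_⟩ Set.subset_union_left (Or.inr rfl)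
  · exact (hCs this) (by simp)
  · rintro w (hw | rfl)
    · simp only [Set.mem_compl_iff, Set.mem_insert_iff, Set.mem_singleton_iff, not_or]
      refine ⟨fun h => hCs hw (by simp [h]), fun h => hkC (h ▸ hw)⟩
    · simp only [Set.mem_compl_iff, Set.mem_insert_iff, Set.mem_singleton_iff, not_or]
      exact ⟨haqne.symm, hkq.symm⟩

theorem gam_of_common {X Y Z : Set W} (hX : X.Nontrivial) (hY : Y.Nontrivial) (hZ : Z.Nontrivial)
    {p : W} (hU : H.Cn Set.univ) (hp : H.Cn {p}ᶜ) (hpX : p ∈ X) (hpY : p ∈ Y) (hpZ : p ∈ Z) :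
    H.Gam X Y Z := by
  have key : ∀ L : Set W, L.Nontrivial → (({p}ᶜ : Set W) ∩ L).Nonempty := by
    intro L hL
    obtain ⟨w, hw, hwp⟩ := hL.exists_ne p
    exact ⟨w, hwp, hw⟩
  refine ⟨{p}, {p}ᶜ, cn_singleton p, hp, disjoint_compl_right, ?_, ⟨p, rfl, hpX⟩, ⟨p, rfl, hpY⟩,
    ⟨p, rfl, hpZ⟩, key X hX, key Y hY, key Z hZ⟩
  obtain ⟨w, hw⟩ := hp.nonempty
  obtain ⟨a, ha, b, -, hb, hab⟩ := hU.2 {p} (Set.subset_univ _) ⟨p, rfl⟩ ⟨w, trivial, hw⟩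
  exact ⟨a, ha, b, hb, hab⟩

theorem nontrivial_image {r : W → W'} {X : Set W} {s t : W} (hs : s ∈ X) (ht : t ∈ X)
    (h : r s ≠ r t) : (r '' X).Nontrivial :=
  ⟨r s, ⟨s, hs, rfl⟩, r t, ⟨t, ht, rfl⟩, h⟩

theorem squash_ne {D : Set W} {d s t : W} (hd : d ∈ D) (hst : s ≠ t) (hs : s ∉ D) :
    squash D d s ≠ squash D d t := by
  intro h
  have h1 := congrArg Subtype.val h
  rw [squash_of_notMem hs] at h1
  by_cases ht : t ∈ D
  · rw [squash_of_mem ht] at h1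
    exact hs (h1 ▸ hd)
  · rw [squash_of_notMem ht] at h1
    exact hst h1

/-- A 2-connected graph has a contractible edge avoiding three prescribed pairs. -/
theorem exists_contractible_avoiding [Finite W] (h2 : ∀ v, H.Cn {v}ᶜ) (hc : 4 ≤ Nat.card W)
    (X Y Z : Set W) : ∃ p q, H.Adj p q ∧ H.Cn {p, q}ᶜ ∧ X ≠ {p, q} ∧ Y ≠ {p, q} ∧ Z ≠ {p, q} := by
  have hout : ∀ T : Finset W, T.card ≤ 3 → ∃ s, s ∉ T := by
    intro T hT
    by_contra hcon
    push Not at hcon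
    have : Fintype W := Fintype.ofFinite W
    have h1 : T = Finset.univ := Finset.eq_univ_iff_forall.2 hcon
    rw [Nat.card_eq_fintype_card, ← Finset.card_univ, ← h1] at hc
    omega
  have hout3 : ∀ a b c : W, ∃ s, s ≠ a ∧ s ≠ b ∧ s ≠ c := by
    intro a b c
    obtain ⟨s, hs⟩ := hout {a, b, c} Finset.card_le_three
    refine ⟨s, ?_⟩
    simpa using hs
  have htwo : ∀ p, ∃ q q', q ≠ q' ∧ H.Adj p q ∧ H.Cn {p, q}ᶜ ∧ H.Adj p q' ∧ H.Cn {p, q'}ᶜ := by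
    intro p
    obtain ⟨q₁, hq₁, -, -⟩ := hout3 p p p
    obtain ⟨s, hs⟩ := hout3 p q₁ q₁
    obtain ⟨q, -, hpq, hq⟩ := exists_contractible h2 hq₁.symm ⟨s, hs.1, hs.2.1⟩
    obtain ⟨s, hs⟩ := hout3 p q q
    obtain ⟨q', hne, hpq', hq'⟩ := exists_contractible h2 hpq.ne ⟨s, hs.1, hs.2.1⟩
    exact ⟨q', q, hne, hpq', hq', hpq, hq⟩
  by_contra hcon
  have hcon' : ∀ p q, H.Adj p q → H.Cn {p, q}ᶜ → X = {p, q} ∨ Y = {p, q} ∨ Z = {p, q} := by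
    intro p q h1 h2
    by_contra h3
    push Not at h3
    exact hcon ⟨p, q, h1, h2, h3⟩
  obtain ⟨p, -, -, -⟩ : ∃ p : W, True ∧ True ∧ True := by
    obtain ⟨s, -⟩ := hout ∅ (by simp)
    exact ⟨s, trivial, trivial, trivial⟩
  obtain ⟨q, q', hqq, a1, a2, a3, a4⟩ := htwo p
  obtain ⟨s, hsp, hsq, hsq'⟩ := hout3 p q q'
  obtain ⟨t, t', htt, b1, b2, b3, b4⟩ := htwo s
  have pairne : ∀ u v v' : W, H.Adj u v → v ≠ v' → ({u, v} : Set W) ≠ {u, v'} := by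
    intro u v v' huv hv h
    have h1 : v ∈ ({u, v'} : Set W) := h ▸ (by simp)
    rcases h1 with h1 | h1
    · exact huv.ne h1.symm
    · exact hv h1
  have sne : ∀ v w : W, s ≠ v → ∀ u, ({s, u} : Set W) = {p, v} → False := by
    intro v w hsv u h
    have h1 : s ∈ ({p, v} : Set W) := h ▸ (by simp)
    rcases h1 with h1 | h1
    · exact hsp h1
    · exact hsv h1
  have e1 := hcon' _ _ a1 a2
  have e2 := hcon' _ _ a3 a4
  have e3 := hcon' _ _ b1 b2
  have e4 := hcon' _ _ b3 b4
  have n12 := pairne _ _ _ a1 hqq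
  have n34 := pairne _ _ _ b1 htt
  have n13 := sne q q hsq t
  have n14 := sne q q hsq t'
  have n23 := sne q' q' hsq' t
  have n24 := sne q' q' hsq' t'
  grind

/-- A 2-connected graph with three labels of size at least two. -/
theorem gam_or_alp_of_two_connected (n : ℕ) : ∀ (W : Type) [Finite W] (H : SimpleGraph W)
    (X Y Z : Set W), Nat.card W = n → 3 ≤ n → (∀ v, H.Cn {v}ᶜ) → H.Cn Set.univ →
    X.Nontrivial → Y.Nontrivial → Z.Nontrivial → H.Gam X Y Z ∨ H.Alp X Y Z := by
  induction n using Nat.strong_induction_on with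
  | _ n ih =>
  intro W _ H X Y Z hn h3 h2 hU hX hY hZ
  by_cases hcom : ∃ p, p ∈ X ∧ p ∈ Y ∧ p ∈ Z
  · obtain ⟨p, h⟩ := hcom
    exact Or.inl (gam_of_common hX hY hZ hU (h2 p) h.1 h.2.1 h.2.2)
  push Not at hcom
  by_cases hn3 : n = 3
  · right
    have : Fintype W := Fintype.ofFinite W
    have hcard : (Finset.univ : Finset W).card = 3 := by
      rw [Finset.card_univ, ← Nat.card_eq_fintype_card, hn, hn3]
    obtain ⟨a, b, c, hab, hac, hbc, huniv⟩ := Finset.card_eq_three.1 hcard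
    have hall : ∀ w, w = a ∨ w = b ∨ w = c := by
      intro w
      have := Finset.mem_univ w
      rw [huniv] at this
      simpa using this
    have hadj : ∀ u v w : W, u ≠ v → u ≠ w → v ≠ w → H.Adj u v := by
      intro u v w huv huw hvw
      obtain ⟨s, rfl, t, ht, hst⟩ := touch_compl_singleton h2 huw ⟨v, huv.symm, hvw⟩
      have h1 := hall s
      have h2 := hall t
      have h3 := hall v
      have h4 := hall w
      have h5 := hst.ne
      have h6 : t ≠ w := ht
      have : t = v := by grind
      exact this ▸ hst
    have two : ∀ L : Set W, L.Nontrivial → ∀ u v, u ≠ v → u ∉ L → v ∈ L := by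
      intro L ⟨s, hs, t, ht, hst⟩ u v huv hu
      have h1 := hall s
      have h2 := hall t
      have h3 := hall u
      have h4 := hall v
      by_contra hv
      have : s ≠ u := fun h => hu (h ▸ hs)
      have : s ≠ v := fun h => hv (h ▸ hs)
      have : t ≠ u := fun h => hu (h ▸ ht)
      have : t ≠ v := fun h => hv (h ▸ ht)
      grind
    have miss : ∀ L M N : Set W, L.Nontrivial → M.Nontrivial → N.Nontrivial →
        (∀ p, p ∈ L → p ∈ M → p ∉ N) → ∃ p, p ∉ L := by
      intro L M N hL hM hN hcom
      by_contra hcon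
      push Not at hcon
      have ha := hcom a (hcon a)
      have hb := hcom b (hcon b)
      have hc := hcom c (hcon c)
      have tM := two M hM
      have tN := two N hN
      have := tM a b hab
      have := tM a c hac
      have := tM b c hbc
      have := tN a b hab
      have := tN a c hac
      have := tN b c hbc
      clear tM tN hcon hcom two hadj ih
      tauto
    obtain ⟨x, hx⟩ := miss X Y Z hX hY hZ hcom
    obtain ⟨y, hy⟩ := miss Y X Z hY hX hZ (fun p h1 h2 => hcom p h2 h1)
    obtain ⟨z, hz⟩ := miss Z X Y hZ hX hY (fun p h1 h2 h3 => hcom p h2 h3 h1)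
    have tX := fun v h => two X hX x v h hx
    have tY := fun v h => two Y hY y v h hy
    have tZ := fun v h => two Z hZ z v h hz
    have hxyz : x ≠ y ∧ x ≠ z ∧ y ≠ z := by
      by_contra hcon
      have : ∃ p, p ≠ x ∧ p ≠ y ∧ p ≠ z := by
        have h1 := hall x
        have h2 := hall y
        have h3 := hall z
        by_contra hcon2
        push Not at hcon2
        have e1 := hcon2 a
        have e2 := hcon2 b
        have e3 := hcon2 c
        grind
      obtain ⟨p, h1, h2, h3⟩ := this
      exact hcom p (tX p h1.symm) (tY p h2.symm) (tZ p h3.symm)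
    obtain ⟨hxy, hxz, hyz⟩ := hxyz
    refine ⟨{y}, {z}, {x}, cn_singleton y, cn_singleton z, cn_singleton x, ?_, ?_, ?_,
      ⟨y, rfl, z, rfl, hadj y z x hyz hxy.symm hxz.symm⟩,
      ⟨y, rfl, x, rfl, hadj y x z hxy.symm hyz hxz⟩,
      ⟨z, rfl, x, rfl, hadj z x y hxz.symm hyz.symm hxy⟩,
      ⟨y, rfl, tX y hxy⟩, ⟨y, rfl, tZ y hyz.symm⟩, ⟨z, rfl, tX z hxz⟩, ⟨z, rfl, tY z hyz⟩,
      ⟨x, rfl, tY x hxy.symm⟩, ⟨x, rfl, tZ x hxz.symm⟩⟩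
    · simpa using hyz
    · simpa using hxy.symm
    · simpa using hxz.symm
  obtain ⟨p, q, hpq, hcn, hX', hY', hZ'⟩ := exists_contractible_avoiding h2 (by omega) X Y Z
  have hfib := squash_fibre (H := H) (D := {p, q}) (d := p) (by simp) (cn_pair hpq)
  have hlt := squash_card_lt (D := {p, q}) (d := p) (e := q) (by simp) hpq.ne.symm
  have hge : Nat.card W ≤ Nat.card {w : W // w ∉ ({p, q} : Set W) ∨ w = p} + 1 := by
    have : Fintype W := Fintype.ofFinite W
    have h1 : (Finset.univ : Finset W).card ≤ ((Finset.univ.filter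
      fun w : W => w ∉ ({p, q} : Set W) ∨ w = p) ∪ {q}).card := by
      refine Finset.card_le_card fun w _ => ?_
      simp only [Finset.mem_union, Finset.mem_filter, Finset.mem_univ, true_and,
        Finset.mem_singleton, Set.mem_insert_iff, Set.mem_singleton_iff]
      tauto
    have h2 := h1.trans (Finset.card_union_le _ _)
    rw [Nat.card_eq_fintype_card, Nat.card_eq_fintype_card, Fintype.card_subtype]
    simpa using h2
  have lab : ∀ L : Set W, L.Nontrivial → L ≠ {p, q} → (squash {p, q} p '' L).Nontrivial := by
    intro L hL hLpq
    obtain ⟨s, hs, hsD⟩ : ∃ s ∈ L, s ∉ ({p, q} : Set W) := by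
      by_contra hcon
      push Not at hcon
      refine hLpq (Set.Subset.antisymm hcon ?_)
      obtain ⟨s, hs, t, ht, hst⟩ := hL
      have h1 := hcon s hs
      have h2 := hcon t ht
      simp only [Set.mem_insert_iff, Set.mem_singleton_iff] at h1 h2
      rintro w (rfl | hw)
      · grind
      · rw [Set.mem_singleton_iff] at hw
        grind
    obtain ⟨t, ht, hts⟩ := hL.exists_ne s
    exact nontrivial_image hs ht (squash_ne (by simp) hts.symm hsD)
  have := ih _ (by omega) _ (H.along (squash {p, q} p)) _ _ _ rfl (by omega) ?_ ?_
    (lab X hX hX') (lab Y hY hY') (lab Z hZ hZ')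
  · rcases this with h | h
    · exact Or.inl (h.lift hfib)
    · exact Or.inr (h.lift hfib)
  · intro v
    by_cases hv : v.1 = p
    · convert hcn.along_image (r := squash {p, q} p) using 1
      ext w
      simp only [Set.mem_compl_iff, Set.mem_singleton_iff, Set.mem_image, Subtype.ext_iff, hv]
      constructor
      · intro hw
        exact ⟨w.1, w.2.resolve_right hw, squash_of_notMem (w.2.resolve_right hw)⟩
      · rintro ⟨u, hu, huw⟩ hwp
        rw [squash_of_notMem hu, hwp] at huw
        exact hu (by simp [huw])
    · have hvD := v.2.resolve_right hv
      convert (h2 v.1).along_image (r := squash {p, q} p) using 1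
      ext w
      simp only [Set.mem_compl_iff, Set.mem_singleton_iff, Set.mem_image, Subtype.ext_iff]
      constructor
      · intro hw
        refine ⟨w.1, hw, ?_⟩
        rcases w.2 with h | h
        · exact squash_of_notMem h
        · rw [squash_of_mem (by simp [h]), h]
      · rintro ⟨u, hu, huw⟩ hwv
        by_cases huD : u ∈ ({p, q} : Set W)
        · rw [squash_of_mem huD, hwv] at huw
          exact hv huw.symm
        · rw [squash_of_notMem huD, hwv] at huw
          exact hu huw
  · convert hU.along_image (r := squash {p, q} p) using 1
    ext w
    simp only [Set.mem_univ, Set.image_univ, Set.mem_range, true_iff]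
    obtain ⟨v, hv⟩ := (hfib w).nonempty
    exact ⟨v, hv⟩

end SimpleGraph

namespace SimpleGraph

/-- A cut vertex `q` such that every connected set avoiding it misses one of the labels. -/
def Eps {W : Type} (H : SimpleGraph W) (X Y Z : Set W) : Prop :=
  ∃ q, ¬ H.Cn {q}ᶜ ∧ ∀ K, H.Cn K → q ∉ K → (K ∩ X = ∅ ∨ K ∩ Y = ∅ ∨ K ∩ Z = ∅)

/-- A connected graph with three labels of size at least two, in which every piece behind a cut
vertex meets two of the labels. -/
theorem gam_or_alp_or_eps (n : ℕ) : ∀ (W : Type) [Finite W] (H : SimpleGraph W)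
    (X Y Z : Set W), Nat.card W = n → H.Cn Set.univ →
    X.Nontrivial → Y.Nontrivial → Z.Nontrivial →
    (∀ q K, K.Nonempty → q ∉ K → (∃ v, v ≠ q ∧ v ∉ K) →
      (∀ a ∈ K, ∀ b, b ∉ K → H.Adj a b → b = q) →
      ((K ∩ X).Nonempty ∨ (K ∩ Y).Nonempty) ∧ ((K ∩ X).Nonempty ∨ (K ∩ Z).Nonempty) ∧
        ((K ∩ Y).Nonempty ∨ (K ∩ Z).Nonempty)) →
    H.Gam X Y Z ∨ H.Alp X Y Z ∨ H.Eps X Y Z := by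
  induction n using Nat.strong_induction_on with
  | _ n ih =>
  intro W _ H X Y Z hn hU hX hY hZ hstar
  by_cases h2 : ∀ v, H.Cn {v}ᶜ
  · by_cases h3 : 3 ≤ n
    · rcases gam_or_alp_of_two_connected n W H X Y Z hn h3 h2 hU hX hY hZ with h | h
      · exact Or.inl h
      · exact Or.inr (Or.inl h)
    · have full : ∀ L : Set W, L.Nontrivial → ∀ p, p ∈ L := by
        intro L ⟨s, hs, t, ht, hst⟩ p
        by_contra hp
        have : Fintype W := Fintype.ofFinite W
        have h1 : ({s, t, p} : Finset W).card = 3 := by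
          refine Finset.card_eq_three.2 ⟨s, t, p, hst, ?_, ?_, rfl⟩
          · exact fun h => hp (h ▸ hs)
          · exact fun h => hp (h ▸ ht)
        have h4 := Finset.card_le_univ ({s, t, p} : Finset W)
        rw [h1, ← Nat.card_eq_fintype_card, hn] at h4
        exact h3 h4
      obtain ⟨p, -⟩ := hX.nonempty
      exact Or.inl (gam_of_common hX hY hZ hU (h2 p) (full X hX p) (full Y hY p) (full Z hZ p))
  push Not at h2
  obtain ⟨q, hq⟩ := h2
  by_cases heps : ∀ K, H.Cn K → q ∉ K → (K ∩ X = ∅ ∨ K ∩ Y = ∅ ∨ K ∩ Z = ∅)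
  · exact Or.inr (Or.inr ⟨q, hq, heps⟩)
  push Not at heps
  obtain ⟨K₀, hK₀, hqK₀, hX₀, hY₀, hZ₀⟩ := heps
  obtain ⟨k, hk⟩ := hK₀.nonempty
  have hK₀s : K₀ ⊆ {q}ᶜ := fun w hw h => hqK₀ ((show w = q from h) ▸ hw)
  obtain ⟨K, hkK, hK⟩ := exists_isComp (H := H) (hK₀s hk)
  have hsub := hK.subset_of_mem hK₀ hK₀s hkK hk
  have hKX : (K ∩ X).Nonempty := hX₀.mono (Set.inter_subset_inter_left _ hsub)
  have hKY : (K ∩ Y).Nonempty := hY₀.mono (Set.inter_subset_inter_left _ hsub)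
  have hKZ : (K ∩ Z).Nonempty := hZ₀.mono (Set.inter_subset_inter_left _ hsub)
  have hK' : H.IsComp (Set.univ \ {q}) K := by rwa [← Set.compl_eq_univ_sdiff]
  have hqK : q ∉ K := fun h => hK.subset h rfl
  have hD : H.Cn Kᶜ := by
    rw [Set.compl_eq_univ_sdiff]
    exact hK'.cn_diff hU trivial
  by_cases hDall : (Kᶜ ∩ X).Nonempty ∧ (Kᶜ ∩ Y).Nonempty ∧ (Kᶜ ∩ Z).Nonempty
  · refine Or.inl ⟨K, Kᶜ, hK.cn, hD, disjoint_compl_right, ?_, hKX, hKY, hKZ, hDall.1, hDall.2.1,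
      hDall.2.2⟩
    exact (hK'.touch_cut hU trivial).mono le_rfl (by rintro _ rfl; exact hqK)
  obtain ⟨e, he, heK⟩ : ∃ e, e ≠ q ∧ e ∉ K := by
    by_contra hcon
    push Not at hcon
    refine hq ?_
    rw [← Set.Subset.antisymm hK.subset hcon]
    exact hK.cn
  have hfib := squash_fibre (H := H) (D := Kᶜ) (d := q) hqK hD
  have hlt := squash_card_lt (D := Kᶜ) (d := q) (e := e) heK he
  have lab : ∀ L : Set W, L.Nontrivial → (K ∩ L).Nonempty →
      (squash Kᶜ q '' L).Nontrivial := by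
    rintro L hL ⟨s, hsK, hs⟩
    obtain ⟨t, ht, hts⟩ := hL.exists_ne s
    exact nontrivial_image hs ht (squash_ne hqK hts.symm (not_not.2 hsK))
  have valK : ∀ {v}, v ∈ K → (squash Kᶜ q v).1 = v := fun hv => squash_of_notMem (not_not.2 hv)
  have valD : ∀ {v}, v ∉ K → (squash Kᶜ q v).1 = q := fun hv => squash_of_mem hv
  have hitlift : ∀ {P : Set {w : W // w ∉ Kᶜ ∨ w = q}} {L : Set W},
      (squash Kᶜ q ⁻¹' P ∩ L).Nonempty → (P ∩ squash Kᶜ q '' L).Nonempty := by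
    rintro P L ⟨v, hv, hvL⟩
    exact ⟨_, hv, v, hvL, rfl⟩
  have := ih _ (by omega) _ (H.along (squash Kᶜ q)) _ _ _ rfl ?_ (lab X hX hKX) (lab Y hY hKY)
    (lab Z hZ hKZ) ?_
  · rcases this with h | h | ⟨q', hq', h⟩
    · exact Or.inl (h.lift hfib)
    · exact Or.inr (Or.inl (h.lift hfib))
    · have hq'K : q'.1 ∈ K := by
        rcases q'.2 with h | h
        · exact not_not.1 h
        · exfalso
          refine hq' ?_
          convert hK.cn.along_image (r := squash Kᶜ q) using 1
          ext w
          simp only [Set.mem_compl_iff, Set.mem_singleton_iff, Set.mem_image, Subtype.ext_iff, h]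
          constructor
          · intro hw
            have := w.2.resolve_right hw
            exact ⟨w.1, not_not.1 this, squash_of_notMem this⟩
          · rintro ⟨v, hv, hvw⟩ hwq
            rw [valK hv, hwq] at hvw
            exact hqK (hvw ▸ hv)
      refine Or.inr (Or.inr ⟨q'.1, fun hcn => hq' ?_, fun C hC hqC => ?_⟩)
      · convert hcn.along_image (r := squash Kᶜ q) using 1
        ext w
        simp only [Set.mem_compl_iff, Set.mem_singleton_iff, Set.mem_image, Subtype.ext_iff]
        constructor
        · intro hw
          refine ⟨w.1, hw, ?_⟩
          rcases w.2 with h | h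
          · exact squash_of_notMem h
          · rw [h]; exact valD hqK
        · rintro ⟨u, hu, huw⟩ hwv
          by_cases huK : u ∈ K
          · rw [valK huK, hwv] at huw
            exact hu huw
          · rw [valD huK, hwv] at huw
            exact hqK (huw ▸ hq'K)
      · have hC' := h _ (hC.along_image (r := squash Kᶜ q)) ?_
        · have clr : ∀ L : Set W, squash Kᶜ q '' C ∩ squash Kᶜ q '' L = ∅ → C ∩ L = ∅ := by
            intro L hL
            by_contra hne
            obtain ⟨v, hv, hvL⟩ := Set.nonempty_iff_ne_empty.2 hne
            exact (hL ▸ ⟨⟨v, hv, rfl⟩, ⟨v, hvL, rfl⟩⟩ : squash Kᶜ q v ∈ (∅ : Set _))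
          rcases hC' with h | h | h
          · exact Or.inl (clr _ h)
          · exact Or.inr (Or.inl (clr _ h))
          · exact Or.inr (Or.inr (clr _ h))
        · rintro ⟨v, hv, hvq⟩
          by_cases hvK : v ∈ K
          · have := congrArg Subtype.val hvq
            rw [valK hvK] at this
            exact hqC (this ▸ hv)
          · have := congrArg Subtype.val hvq
            rw [valD hvK] at this
            exact hqK (this ▸ hq'K)
  · convert hU.along_image (r := squash Kᶜ q) using 1
    ext w
    simp only [Set.mem_univ, Set.image_univ, Set.mem_range, true_iff]
    obtain ⟨v, hv⟩ := (hfib w).nonempty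
    exact ⟨v, hv⟩
  · rintro q' C ⟨c, hc⟩ hqC ⟨v, hvq, hvC⟩ hN
    have sq : ∀ w : {w : W // w ∉ Kᶜ ∨ w = q}, squash Kᶜ q w.1 = w := by
      intro w
      rw [Subtype.ext_iff]
      rcases w.2 with h | h
      · exact squash_of_notMem h
      · rw [h]; exact valD hqK
    have := hstar q'.1 (squash Kᶜ q ⁻¹' C) ⟨c.1, by rw [Set.mem_preimage, sq]; exact hc⟩
      (by rw [Set.mem_preimage, sq]; exact hqC)
      ⟨v.1, fun h => hvq (Subtype.ext h), by rw [Set.mem_preimage, sq]; exact hvC⟩ ?_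
    · obtain ⟨h1, h2, h3⟩ := this
      exact ⟨h1.imp hitlift hitlift, h2.imp hitlift hitlift, h3.imp hitlift hitlift⟩
    · intro a ha b hb hab
      have hne : squash Kᶜ q a ≠ squash Kᶜ q b := fun h => hb (by rw [Set.mem_preimage, ← h]; exact ha)
      have hrb := hN _ ha _ hb (along_adj.2 ⟨hne, a, b, rfl, rfl, hab⟩)
      rw [← hrb]
      by_cases hbK : b ∈ K
      · rw [valK hbK]
      · rw [valD hbK]
        have haK : a ∈ K := by
          by_contra haK
          exact hne (Subtype.ext (by rw [valD haK, valD hbK]))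
        by_contra hbq
        exact hbK (hK.closed haK hbq hab)

end SimpleGraph

/-! ### Three-connected graphs -/

namespace SimpleGraph

variable {V : Type} {H : SimpleGraph V}

/-- No nonempty set is separated from the rest by two vertices. -/
def Thr (H : SimpleGraph V) : Prop :=
  ∀ (K : Set V) (a b : V), K.Nonempty →
    (∀ u ∈ K, ∀ v, v ∉ K → H.Adj u v → v = a ∨ v = b) → ∀ v, v ∈ K ∨ v = a ∨ v = b

/-- `x` has at least two neighbours in `Y`. -/
def TwoN (H : SimpleGraph V) (x : V) (Y : Set V) : Prop := ∀ w, ∃ n ∈ Y, n ≠ w ∧ H.Adj x n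

theorem Thr.exists_third {w x y : V} (h3 : H.Thr) {K : Set V} (hK : K.Nonempty) (hw : w ∉ K)
    (hx : x ∉ K) (hy : y ∉ K) (hwx : w ≠ x) (hwy : w ≠ y) (hxy : x ≠ y) (a b : V) :
    ∃ u ∈ K, ∃ v, v ∉ K ∧ H.Adj u v ∧ v ≠ a ∧ v ≠ b := by
  by_contra hcon
  push Not at hcon
  have h := h3 K a b hK fun u hu v hv huv => by
    by_contra h
    push Not at h
    exact h.2 (hcon u hu v hv huv h.1)
  have h1 := h w
  have h2 := h x
  have h3 := h y
  grind

/-- The rooted triangle lemma. -/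
theorem exists_rooted_triangle [Finite V] (h3 : H.Thr) {Q : Set V} {w x y : V} (hQ : Q.Nonempty)
    (hwx : w ≠ x) (hwy : w ≠ y) (hxy : x ≠ y) (hwQ : w ∉ Q) (hxQ : x ∉ Q) (hyQ : y ∉ Q)
    (hN : ∀ u ∈ Q, ∀ v, v ∉ Q → H.Adj u v → v = w ∨ v = x ∨ v = y)
    (htwo : H.TwoN w (insert x Q)) :
    ∃ Dw Dx D', w ∈ Dw ∧ Dw ⊆ insert w Q ∧ x ∈ Dx ∧ Dx ⊆ insert x Q ∧ D' ⊆ Q ∧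
      H.Cn Dw ∧ H.Cn Dx ∧ H.Cn D' ∧ Disjoint Dw Dx ∧ Disjoint Dw D' ∧ Disjoint Dx D' ∧
      H.Touch Dw Dx ∧ H.Touch Dw D' ∧ H.Touch Dx D' ∧ H.Touch D' {y} := by
  have key : ∀ K ⊆ Q, K.Nonempty → ∀ a b, ∃ u ∈ K, ∃ v, v ∉ K ∧ H.Adj u v ∧ v ≠ a ∧ v ≠ b :=
    fun K hK hne a b => h3.exists_third hne (fun h => hwQ (hK h)) (fun h => hxQ (hK h))
      (fun h => hyQ (hK h)) hwx hwy hxy a b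
  have compTouch : ∀ K, H.IsComp Q K → H.Touch K {w} ∧ H.Touch K {x} ∧ H.Touch K {y} := by
    intro K hK
    have aux : ∀ a b, ∃ u ∈ K, ∃ v, (v = w ∨ v = x ∨ v = y) ∧ H.Adj u v ∧ v ≠ a ∧ v ≠ b := by
      intro a b
      obtain ⟨u, hu, v, hv, huv, hva, hvb⟩ := key K hK.subset hK.cn.nonempty a b
      refine ⟨u, hu, v, hN u (hK.subset hu) v (fun h => hv (hK.closed hu h huv)) huv, huv, hva, hvb⟩
    refine ⟨?_, ?_, ?_⟩
    · obtain ⟨u, hu, v, hv, huv, h1, h2⟩ := aux x y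
      exact ⟨u, hu, v, by simpa [h1, h2] using hv, huv⟩
    · obtain ⟨u, hu, v, hv, huv, h1, h2⟩ := aux w y
      exact ⟨u, hu, v, by simpa [h1, h2] using hv, huv⟩
    · obtain ⟨u, hu, v, hv, huv, h1, h2⟩ := aux w x
      exact ⟨u, hu, v, by simpa [h1, h2] using hv, huv⟩
  by_cases hQc : H.Cn Q
  swap
  · obtain ⟨K, K', hK, hK', hne⟩ := exists_two_comps hQ hQc
    obtain ⟨a1, a2, a3⟩ := compTouch K hK
    obtain ⟨b1, b2, b3⟩ := compTouch K' hK'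
    have hd := hK.disjoint hK' hne
    refine ⟨{w}, insert x K', K, rfl, by simp, by simp, Set.insert_subset_insert hK'.subset,
      hK.subset, cn_singleton w, hK'.cn.insert b2.symm, hK.cn, ?_, ?_, ?_,
      b1.symm.mono le_rfl (Set.subset_insert _ _), a1.symm,
      a2.symm.mono (by simp) le_rfl, a3⟩
    · rw [Set.disjoint_singleton_left, Set.mem_insert_iff, not_or]
      exact ⟨hwx, fun h => hwQ (hK'.subset h)⟩
    · rw [Set.disjoint_singleton_left]
      exact fun h => hwQ (hK.subset h)
    · rw [Set.disjoint_insert_left]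
      exact ⟨fun h => hxQ (hK.subset h), hd.symm⟩
  obtain ⟨tw, tx, ty⟩ := compTouch Q ⟨hQc, le_rfl, fun _ _ _ hb _ => hb⟩
  by_cases hadj : H.Adj w x
  · refine ⟨{w}, {x}, Q, rfl, by simp, rfl, by simp, le_rfl, cn_singleton w, cn_singleton x, hQc,
      by simpa using hwx, by simpa using hwQ, by simpa using hxQ, ⟨w, rfl, x, rfl, hadj⟩,
      tw.symm, tx.symm, ty⟩
  have htwoQ : H.TwoN w Q := by
    intro v
    obtain ⟨n, hn, hnv, hwn⟩ := htwo v
    rcases hn with rfl | hn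
    · exact absurd hwn hadj
    · exact ⟨n, hn, hnv, hwn⟩
  obtain ⟨W, ⟨hwW, hWQ, hWc, hWt, hMc⟩, hmax⟩ := (Set.toFinite {W : Set V | w ∈ W ∧
    W ⊆ insert w Q ∧ H.Cn W ∧ (∀ u ∈ W, u ≠ w → ¬ H.Adj u x ∧ ¬ H.Adj u y) ∧
    H.Cn (Q \ W)}).exists_maximal ⟨{w}, rfl, by simp, cn_singleton w, by
      rintro u rfl h; exact absurd rfl h, by
      rw [Set.sdiff_singleton_eq_self hwQ]; exact hQc⟩
  have hmax' : ∀ T : Set V, T.Nonempty → T ⊆ Q \ W → H.Cn (W ∪ T) →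
      (∀ u ∈ T, ¬ H.Adj u x ∧ ¬ H.Adj u y) → H.Cn ((Q \ W) \ T) → False := by
    rintro T ⟨t, ht⟩ hTM hc hxy' hc'
    refine (hTM ht).2 (hmax (y := W ∪ T) ⟨Or.inl hwW, ?_, hc, ?_, ?_⟩ Set.subset_union_left
      (Or.inr ht))
    · exact Set.union_subset hWQ fun u hu => Or.inr (hTM hu).1
    · rintro u (hu | hu) hne
      · exact hWt u hu hne
      · exact hxy' u hu
    · rwa [← Set.sdiff_sdiff]
  set M := Q \ W with hM
  have hMQ : M ⊆ Q := Set.sdiff_subset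
  have hnx : ∀ {u}, u ∈ Q → u ∈ W → ¬ H.Adj u x ∧ ¬ H.Adj u y := fun hu hW =>
    hWt _ hW fun h => hwQ (h ▸ hu)
  obtain ⟨n, hnM, s, hsW, hsn⟩ : ∃ n ∈ M, ∃ s ∈ W, H.Adj s n := by
    have hc : H.Cn (insert w Q) := hQc.insert tw.symm
    obtain ⟨m, hm⟩ := hMc.nonempty
    obtain ⟨a, ha, b, hb, hbn, hab⟩ := hc.2 W hWQ hWc.nonempty ⟨m, Or.inr hm.1, hm.2⟩
    rcases hb with rfl | hb
    · exact absurd hwW hbn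
    · exact ⟨b, ⟨hb, hbn⟩, a, ha, hab⟩
  obtain ⟨n₂, hn₂M, hn₂n, s₂, hs₂W, hs₂n⟩ : ∃ n₂ ∈ M, n₂ ≠ n ∧ ∃ s ∈ W, H.Adj s n₂ := by
    by_cases hWw : (W \ {w}).Nonempty
    · have hsub : W \ {w} ⊆ Q := fun u hu => (hWQ hu.1).resolve_left hu.2
      obtain ⟨u, hu, v, hv, huv, hvw, hvn⟩ := key _ hsub hWw w n
      have hvW : v ∉ W := fun h => hv ⟨h, hvw⟩
      have hvQ : v ∈ Q := by
        by_contra hvQ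
        have := hnx (hsub hu) hu.1
        rcases hN u (hsub hu) v hvQ huv with rfl | rfl | rfl
        · exact hvw rfl
        · exact this.1 huv
        · exact this.2 huv
      exact ⟨v, ⟨hvQ, hvW⟩, hvn, u, hu.1, huv⟩
    · obtain ⟨v, hv, hvn, hwv⟩ := htwoQ n
      have hvW : v ∉ W := fun h => hWw ⟨v, h, fun h => hwQ ((show v = w from h) ▸ hv)⟩
      exact ⟨v, ⟨hv, hvW⟩, hvn, w, hwW, hwv⟩
  have hdWx : Disjoint W {x} := by
    rw [Set.disjoint_singleton_right]
    intro h
    rcases hWQ h with h | h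
    · exact hwx h.symm
    · exact hxQ h
  have hdWM : ∀ {T}, T ⊆ M → Disjoint W T := fun hT =>
    Set.disjoint_left.2 fun u hu hT' => (hT hT').2 hu
  have hxT : ∀ {T}, T ⊆ M → x ∉ T := fun hT h => hxQ (hT h).1
  have compFacts : ∀ K, H.IsComp (M \ {n}) K → K ⊆ M ∧ n ∉ K ∧ H.Touch K {n} ∧ H.Cn (M \ K) ∧
      ∀ a, (a = x ∨ a = y) → ((∃ u ∈ K, H.Adj u x) → x = a) → ((∃ u ∈ K, H.Adj u y) → y = a) →
        H.Touch K W := by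
    intro K hK
    have hKM : K ⊆ M := fun u hu => (hK.subset hu).1
    refine ⟨hKM, fun h => (hK.subset h).2 rfl, hK.touch_cut hMc hnM, hK.cn_diff hMc hnM, ?_⟩
    intro a _ h1 h2
    obtain ⟨u, hu, v, hv, huv, hva, hvn⟩ := key K (fun u hu => (hKM hu).1) hK.cn.nonempty a n
    have hvM : v ∉ M := fun h => hv (hK.closed hu ⟨h, hvn⟩ huv)
    by_cases hvQ : v ∈ Q
    · exact ⟨u, hu, v, by by_contra h; exact hvM ⟨hvQ, h⟩, huv⟩
    · rcases hN u (hKM hu).1 v hvQ huv with rfl | rfl | rfl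
      · exact ⟨u, hu, v, hwW, huv⟩
      · exact absurd (h1 ⟨u, hu, huv⟩) hva
      · exact absurd (h2 ⟨u, hu, huv⟩) hva
  by_cases hcy : ∃ K, H.IsComp (M \ {n}) K ∧ ¬ ∃ u ∈ K, H.Adj u y
  · obtain ⟨K, hK, hKy⟩ := hcy
    obtain ⟨hKM, hnK, hKn, hMK, hKW⟩ := compFacts K hK
    have hKW := hKW x (Or.inl rfl) (fun _ => rfl) (fun h => absurd h hKy)
    by_cases hKx : ∃ u ∈ K, H.Adj u x
    · obtain ⟨u, hu, hux⟩ := hKx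
      refine ⟨W, insert x K, M \ K, hwW, hWQ, by simp, Set.insert_subset_insert (hKM.trans hMQ),
        Set.sdiff_subset.trans hMQ, hWc, hK.cn.insert ⟨x, rfl, u, hu, hux.symm⟩, hMK, ?_,
        hdWM Set.sdiff_subset, ?_, hKW.symm.mono le_rfl (Set.subset_insert _ _),
        ⟨s, hsW, n, ⟨hnM, hnK⟩, hsn⟩, hKn.mono (Set.subset_insert _ _)
          (by rintro _ rfl; exact ⟨hnM, hnK⟩), ?_⟩
      · rw [Set.insert_eq]
        exact Disjoint.union_right hdWx (hdWM hKM)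
      · rw [Set.disjoint_insert_left]
        exact ⟨hxT Set.sdiff_subset, Set.disjoint_sdiff_right⟩
      · obtain ⟨v, hv, _, rfl, hvy⟩ := ty
        exact ⟨v, ⟨⟨hv, fun h => (hnx hv h).2 hvy⟩, fun h => hKy ⟨v, h, hvy⟩⟩, _, rfl, hvy⟩
    · refine (hmax' K hK.cn.nonempty hKM (hWc.union hK.cn hKW.symm) ?_ hMK).elim
      exact fun u hu => ⟨fun h => hKx ⟨u, hu, h⟩, fun h => hKy ⟨u, hu, h⟩⟩
  push Not at hcy
  by_cases hcx : ∃ K, H.IsComp (M \ {n}) K ∧ ¬ ∃ u ∈ K, H.Adj u x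
  · obtain ⟨K, hK, hKx⟩ := hcx
    obtain ⟨hKM, hnK, hKn, hMK, hKW⟩ := compFacts K hK
    have hKW := hKW y (Or.inr rfl) (fun h => absurd h hKx) (fun _ => rfl)
    have hxM : H.Touch {x} (M \ K) := by
      obtain ⟨v, hv, _, rfl, hvx⟩ := tx
      exact ⟨_, rfl, v, ⟨⟨hv, fun h => (hnx hv h).1 hvx⟩, fun h => hKx ⟨v, h, hvx⟩⟩, hvx.symm⟩
    obtain ⟨u, hu, huy⟩ := hcy K hK
    refine ⟨W, insert x (M \ K), K, hwW, hWQ, by simp,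
      Set.insert_subset_insert (Set.sdiff_subset.trans hMQ), hKM.trans hMQ, hWc, hMK.insert hxM,
      hK.cn, ?_, hdWM hKM, ?_, ⟨s, hsW, n, Or.inr ⟨hnM, hnK⟩, hsn⟩, hKW.symm,
      (hKn.mono le_rfl ?_).symm, ⟨u, hu, y, rfl, huy⟩⟩
    · rw [Set.insert_eq]
      exact Disjoint.union_right hdWx (hdWM Set.sdiff_subset)
    · rw [Set.disjoint_insert_left]
      exact ⟨hxT hKM, Set.disjoint_sdiff_left⟩
    · rintro _ rfl
      exact Or.inr ⟨hnM, hnK⟩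
  push Not at hcx
  obtain ⟨K, hn₂K, hK⟩ := exists_isComp (H := H) (U := M \ {n}) (v := n₂) ⟨hn₂M, hn₂n⟩
  obtain ⟨hKM, hnK, hKn, hMK, -⟩ := compFacts K hK
  obtain ⟨u, hu, huy⟩ := hcy K hK
  obtain ⟨v, hv, hvx⟩ := hcx K hK
  by_cases hrx : H.Touch {x} (M \ K)
  · refine ⟨W, insert x (M \ K), K, hwW, hWQ, by simp,
      Set.insert_subset_insert (Set.sdiff_subset.trans hMQ), hKM.trans hMQ, hWc, hMK.insert hrx,
      hK.cn, ?_, hdWM hKM, ?_, ⟨s, hsW, n, Or.inr ⟨hnM, hnK⟩, hsn⟩, ⟨s₂, hs₂W, n₂, hn₂K, hs₂n⟩,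
      (hKn.mono le_rfl ?_).symm, ⟨u, hu, y, rfl, huy⟩⟩
    · rw [Set.insert_eq]
      exact Disjoint.union_right hdWx (hdWM Set.sdiff_subset)
    · rw [Set.disjoint_insert_left]
      exact ⟨hxT hKM, Set.disjoint_sdiff_left⟩
    · rintro _ rfl
      exact Or.inr ⟨hnM, hnK⟩
  have hMKn : M \ {n} = K := by
    refine Set.Subset.antisymm (fun t ht => ?_) hK.subset
    by_contra htK
    obtain ⟨K₂, htK₂, hK₂⟩ := exists_isComp (H := H) ht
    obtain ⟨v', hv', hvx'⟩ := hcx K₂ hK₂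
    have hne : K₂ ≠ K := fun h => htK (h ▸ htK₂)
    exact hrx ⟨x, rfl, v', ⟨(hK₂.subset hv').1,
      fun h => Set.disjoint_left.1 (hK₂.disjoint hK hne) hv' h⟩, hvx'.symm⟩
  have hnx' : ¬ H.Adj n x := fun h => hrx ⟨x, rfl, n, ⟨hnM, hnK⟩, h.symm⟩
  by_cases hny : H.Adj n y
  · refine ⟨W, insert x K, {n}, hwW, hWQ, by simp, Set.insert_subset_insert (hKM.trans hMQ),
        by simpa using hMQ hnM, hWc, hK.cn.insert ⟨x, rfl, v, hv, hvx.symm⟩, cn_singleton n, ?_,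
        hdWM (by simpa using hnM), ?_, ⟨s₂, hs₂W, n₂, Or.inr hn₂K, hs₂n⟩, ⟨s, hsW, n, rfl, hsn⟩,
        hKn.mono (Set.subset_insert _ _) le_rfl, ⟨n, rfl, y, rfl, hny⟩⟩
    · rw [Set.insert_eq]
      exact Disjoint.union_right hdWx (hdWM hKM)
    · rw [Set.disjoint_singleton_right, Set.mem_insert_iff, not_or]
      exact ⟨fun h => hxQ (h ▸ hMQ hnM), hnK⟩
  · refine (hmax' {n} ⟨n, rfl⟩ (by simpa using hnM) (hWc.union (cn_singleton n)
      ⟨s, hsW, n, rfl, hsn⟩) ?_ (hMKn ▸ hK.cn)).elim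
    rintro _ rfl
    exact ⟨hnx', hny⟩

end SimpleGraph

/-! ### Models of the five minors -/

namespace SimpleGraph

variable {V V' : Type} {H : SimpleGraph V}

/-- Branch sets for the graph on `Fin n` with edge list `L`. -/
def Model (H : SimpleGraph V) (n : ℕ) (L : List (Fin n × Fin n)) : Prop :=
  ∃ X : Fin n → Set V, (∀ i, H.Cn (X i)) ∧ (Pairwise fun i j => Disjoint (X i) (X j)) ∧
    ∀ p ∈ L, H.Touch (X p.1) (X p.2)

/-- The edges of `K₃,₃`. -/
def k33L : List (Fin 6 × Fin 6) :=
  [(0, 3), (0, 4), (0, 5), (1, 3), (1, 4), (1, 5), (2, 3), (2, 4), (2, 5)]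

/-- The edges of `K₅`. -/
def k5L : List (Fin 5 × Fin 5) :=
  [(0, 1), (0, 2), (0, 3), (0, 4), (1, 2), (1, 3), (1, 4), (2, 3), (2, 4), (3, 4)]

/-- The edges of the cube, whose vertices are encoded in binary. -/
def cubeL : List (Fin 8 × Fin 8) :=
  [(0, 1), (0, 2), (0, 4), (1, 3), (1, 5), (2, 3), (2, 6), (3, 7), (4, 5), (4, 6), (5, 7), (6, 7)]

/-- The edges of the octahedron, in which `2 * i` and `2 * i + 1` are not adjacent. -/
def octL : List (Fin 6 × Fin 6) :=
  [(0, 2), (0, 3), (0, 4), (0, 5), (1, 2), (1, 3), (1, 4), (1, 5), (2, 4), (2, 5), (3, 4), (3, 5)]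

/-- `H` has one of the five excluded minors. -/
def HasF0 (H : SimpleGraph V) : Prop :=
  H.Model 6 k33L ∨ H.Model 5 k5L ∨ H.Model 8 cubeL ∨ H.Model 7 hEdgeList ∨ H.Model 6 octL

theorem Model.lift {r : V → V'} (hfib : ∀ p, H.Cn (r ⁻¹' {p})) {n : ℕ} {L : List (Fin n × Fin n)}
    (h : (H.along r).Model n L) : H.Model n L := by
  obtain ⟨X, hc, hd, ht⟩ := h
  exact ⟨fun i => r ⁻¹' X i, fun i => (hc i).along_preimage hfib,
    fun i j hij => (hd hij).preimage r, fun p hp => (ht p hp).along_preimage⟩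

theorem HasF0.lift {r : V → V'} (hfib : ∀ p, H.Cn (r ⁻¹' {p})) (h : (H.along r).HasF0) :
    H.HasF0 := by
  rcases h with h | h | h | h | h
  · exact Or.inl (h.lift hfib)
  · exact Or.inr (Or.inl (h.lift hfib))
  · exact Or.inr (Or.inr (Or.inl (h.lift hfib)))
  · exact Or.inr (Or.inr (Or.inr (Or.inl (h.lift hfib))))
  · exact Or.inr (Or.inr (Or.inr (Or.inr (h.lift hfib))))

theorem pairwise_get {l : List (Set V)} (hd : l.Pairwise Disjoint) :
    Pairwise fun i j => Disjoint (l.get i) (l.get j) := by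
  intro i j hij
  rcases lt_or_gt_of_ne hij with h | h
  · exact List.pairwise_iff_get.1 hd i j h
  · exact (List.pairwise_iff_get.1 hd j i h).symm

theorem hasF0_of_k33 {A B C P Q R : Set V} (hc : ∀ S ∈ [A, B, C, P, Q, R], H.Cn S)
    (hd : [A, B, C, P, Q, R].Pairwise Disjoint)
    (ht : ∀ S ∈ [A, B, C], ∀ T ∈ [P, Q, R], H.Touch S T) : H.HasF0 := by
  refine Or.inl ⟨[A, B, C, P, Q, R].get, fun i => hc _ (List.get_mem _ _), pairwise_get hd, ?_⟩
  simp only [k33L, List.forall_mem_cons, List.not_mem_nil, false_imp_iff, implies_true,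
    and_true] at ht ⊢
  obtain ⟨⟨h1, h2, h3⟩, ⟨h4, h5, h6⟩, h7, h8, h9⟩ := ht
  exact ⟨h1, h2, h3, h4, h5, h6, h7, h8, h9⟩

theorem hasF0_of_k5 {A B C P Q : Set V} (hc : ∀ S ∈ [A, B, C, P, Q], H.Cn S)
    (hd : [A, B, C, P, Q].Pairwise Disjoint)
    (ht : [A, B, C, P, Q].Pairwise H.Touch) : H.HasF0 := by
  refine Or.inr (Or.inl ⟨[A, B, C, P, Q].get, fun i => hc _ (List.get_mem _ _),
    pairwise_get hd, ?_⟩)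
  rintro ⟨i, j⟩ hp
  refine List.pairwise_iff_get.1 ht i j ?_
  revert i j
  change ∀ i j : Fin 5, (i, j) ∈ k5L → i < j
  rw [k5L]
  intro i j h
  simp only [List.mem_cons, Prod.mk.injEq, List.not_mem_nil, or_false] at h
  rcases h with h | h | h | h | h | h | h | h | h | h <;> obtain ⟨rfl, rfl⟩ := h <;> simp

theorem hasF0_of_cube {A B C D P Q R S : Set V}
    (hc : ∀ T ∈ [A, B, C, D, P, Q, R, S], H.Cn T)
    (hd : [A, B, C, D, P, Q, R, S].Pairwise Disjoint)
    (h1 : H.Touch A B ∧ H.Touch A C ∧ H.Touch A P) (h2 : H.Touch B D ∧ H.Touch B Q)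
    (h3 : H.Touch C D ∧ H.Touch C R) (h4 : H.Touch D S) (h5 : H.Touch P Q ∧ H.Touch P R)
    (h6 : H.Touch Q S) (h7 : H.Touch R S) : H.HasF0 := by
  refine Or.inr (Or.inr (Or.inl ⟨[A, B, C, D, P, Q, R, S].get, fun i => hc _ (List.get_mem _ _),
    pairwise_get hd, ?_⟩))
  simp only [cubeL, List.forall_mem_cons, List.not_mem_nil, false_imp_iff, implies_true, and_true]
  exact ⟨h1.1, h1.2.1, h1.2.2, h2.1, h2.2, h3.1, h3.2, h4, h5.1, h5.2, h6, h7⟩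

theorem hasF0_of_h {A B C P Q R S : Set V} (hc : ∀ T ∈ [A, B, C, P, Q, R, S], H.Cn T)
    (hd : [A, B, C, P, Q, R, S].Pairwise Disjoint)
    (h1 : H.Touch A B ∧ H.Touch A C ∧ H.Touch B C) (h2 : H.Touch A P ∧ H.Touch A Q)
    (h3 : H.Touch B P ∧ H.Touch B R) (h4 : H.Touch C Q ∧ H.Touch C R)
    (h5 : H.Touch P S ∧ H.Touch Q S ∧ H.Touch R S) : H.HasF0 := by
  refine Or.inr (Or.inr (Or.inr (Or.inl ⟨[A, B, C, P, Q, R, S].get,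
    fun i => hc _ (List.get_mem _ _), pairwise_get hd, ?_⟩)))
  simp only [hEdgeList, List.forall_mem_cons, List.not_mem_nil, false_imp_iff, implies_true,
    and_true]
  exact ⟨h1.1, h1.2.1, h1.2.2, h2.1, h2.2, h3.1, h3.2, h4.1, h4.2, h5⟩

theorem hasF0_of_oct {A A' B B' C C' : Set V} (hc : ∀ T ∈ [A, A', B, B', C, C'], H.Cn T)
    (hd : [A, A', B, B', C, C'].Pairwise Disjoint)
    (h1 : ∀ S ∈ [B, B', C, C'], H.Touch A S ∧ H.Touch A' S)
    (h2 : ∀ S ∈ [C, C'], H.Touch B S ∧ H.Touch B' S) : H.HasF0 := by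
  refine Or.inr (Or.inr (Or.inr (Or.inr ⟨[A, A', B, B', C, C'].get,
    fun i => hc _ (List.get_mem _ _), pairwise_get hd, ?_⟩)))
  simp only [octL, List.forall_mem_cons, List.not_mem_nil, false_imp_iff, implies_true,
    and_true] at h1 h2 ⊢
  obtain ⟨⟨a1, b1⟩, ⟨a2, b2⟩, ⟨a3, b3⟩, a4, b4⟩ := h1
  obtain ⟨⟨c1, d1⟩, c2, d2⟩ := h2
  exact ⟨a1, a2, a3, a4, b1, b2, b3, b4, c1, c2, d1, d2⟩

theorem cn_induce {Y : Set V} {P : Set Y} : (H.induce Y).Cn P ↔ H.Cn (Subtype.val '' P) := by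
  constructor
  · exact fun h => Cn.image (f := Subtype.val) (H' := H) (fun a b hab => Or.inr hab) h
  · intro h
    refine ⟨Set.image_nonempty.1 h.nonempty, ?_⟩
    rintro W hW hne ⟨u, hu, huW⟩
    obtain ⟨_, ⟨a, ha, rfl⟩, _, ⟨b, hb, rfl⟩, hbn, hab⟩ := h.2 (Subtype.val '' W)
      (Set.image_mono hW) (hne.image _)
      ⟨u, ⟨u, hu, rfl⟩, fun ⟨v, hv, hvu⟩ => huW (Subtype.ext hvu ▸ hv)⟩
    exact ⟨a, ha, b, hb, fun h => hbn ⟨b, h, rfl⟩, hab⟩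

theorem Touch.of_induce {Y : Set V} {P Q : Set Y} (h : (H.induce Y).Touch P Q) :
    H.Touch (Subtype.val '' P) (Subtype.val '' Q) := by
  obtain ⟨a, ha, b, hb, hab⟩ := h
  exact ⟨a, ⟨a, ha, rfl⟩, b, ⟨b, hb, rfl⟩, hab⟩

end SimpleGraph

/-! ### Three-separations -/

namespace SimpleGraph

variable {V : Type} {H : SimpleGraph V}

/-- `Y` consists of a vertex `q` and two connected pieces, one not adjacent to `z`, the other not
adjacent to `x`. -/
def TwoPieces (H : SimpleGraph V) (Y : Set V) (x z : V) : Prop :=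
  ∃ q P R, Y = insert q (P ∪ R) ∧ q ∉ P ∧ q ∉ R ∧ Disjoint P R ∧ H.Cn P ∧ H.Cn R ∧
    ¬ H.Touch P R ∧ ¬ H.Touch P {z} ∧ ¬ H.Touch R {x}

/-- `U` and `Y` are the two sides of the vertex cut `{x, y, z}`. -/
structure Sep (H : SimpleGraph V) (U Y : Set V) (x y z : V) : Prop where
  xy : x ≠ y
  xz : x ≠ z
  yz : y ≠ z
  xU : x ∉ U
  yU : y ∉ U
  zU : z ∉ U
  xY : x ∉ Y
  yY : y ∉ Y
  zY : z ∉ Y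
  cover : ∀ v, v ∈ U ∨ v ∈ Y ∨ v = x ∨ v = y ∨ v = z
  disj : Disjoint U Y
  sep : ¬ H.Touch U Y

theorem Sep.symm {U Y : Set V} {x y z : V} (h : H.Sep U Y x y z) : H.Sep Y U x y z :=
  ⟨h.xy, h.xz, h.yz, h.xY, h.yY, h.zY, h.xU, h.yU, h.zU, fun v => by have := h.cover v; tauto,
    h.disj.symm, fun ht => h.sep ht.symm⟩

theorem Sep.rotate {U Y : Set V} {x y z : V} (h : H.Sep U Y x y z) : H.Sep U Y y z x :=
  ⟨h.yz, h.xy.symm, h.xz.symm, h.yU, h.zU, h.xU, h.yY, h.zY, h.xY,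
    fun v => by have := h.cover v; tauto, h.disj, h.sep⟩

theorem Sep.swap {U Y : Set V} {x y z : V} (h : H.Sep U Y x y z) : H.Sep U Y y x z :=
  ⟨h.xy.symm, h.yz, h.xz, h.yU, h.xU, h.zU, h.yY, h.xY, h.zY,
    fun v => by have := h.cover v; tauto, h.disj, h.sep⟩

theorem Sep.nbr {U Y : Set V} {x y z : V} (h : H.Sep U Y x y z) {u v : V} (hu : u ∈ U)
    (hv : v ∉ U) (huv : H.Adj u v) : v = x ∨ v = y ∨ v = z :=
  ((h.cover v).resolve_left hv).resolve_left fun hY => h.sep ⟨u, hu, v, hY, huv⟩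

theorem Sep.comp_touch {U Y : Set V} {x y z : V} (h : H.Sep U Y x y z) (h3 : H.Thr) {K : Set V}
    (hK : H.IsComp U K) : H.Touch K {x} := by
  obtain ⟨u, hu, v, hv, huv, h1, h2⟩ := h3.exists_third hK.cn.nonempty (fun hh => h.xU (hK.subset hh))
    (fun hh => h.yU (hK.subset hh)) (fun hh => h.zU (hK.subset hh)) h.xy h.xz h.yz y z
  rcases h.nbr (hK.subset hu) (fun hh => hv (hK.closed hu hh huv)) huv with rfl | rfl | rfl
  · exact ⟨u, hu, _, rfl, huv⟩
  · exact absurd rfl h1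
  · exact absurd rfl h2

theorem Sep.comp_touch_all {U Y : Set V} {x y z : V} (h : H.Sep U Y x y z) (h3 : H.Thr) {K : Set V}
    (hK : H.IsComp U K) : H.Touch K {x} ∧ H.Touch K {y} ∧ H.Touch K {z} :=
  ⟨h.comp_touch h3 hK, h.rotate.comp_touch h3 hK, h.rotate.rotate.comp_touch h3 hK⟩

/-- A component of `Y ∖ {q}` not adjacent to `x` is adjacent to `y`. -/
theorem Sep.comp_touch_of_miss {U Y : Set V} {x y z q : V} (h : H.Sep U Y x y z) (h3 : H.Thr)
    {K : Set V} (hK : H.IsComp (Y \ {q}) K) (hx : ¬ H.Touch K {x}) : H.Touch K {y} := by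
  have hKY : K ⊆ Y := fun u hu => (hK.subset hu).1
  obtain ⟨u, hu, v, hv, huv, h1, h2⟩ := h3.exists_third hK.cn.nonempty (fun hh => h.xY (hKY hh))
    (fun hh => h.yY (hKY hh)) (fun hh => h.zY (hKY hh)) h.xy h.xz h.yz q z
  rcases h.symm.nbr (hKY hu) (fun hh => hv (hK.closed hu ⟨hh, h1⟩ huv)) huv with rfl | rfl | rfl
  · exact absurd ⟨u, hu, _, rfl, huv⟩ hx
  · exact ⟨u, hu, _, rfl, huv⟩
  · exact absurd rfl h2

/-- Two components of `Y ∖ {q}` missing the same label and a third component. -/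
theorem hasF0_of_same_miss [Finite V] {U Y U₀ : Set V} {a b c q : V} (h : H.Sep U Y a b c)
    (h3 : H.Thr) (hU₀ : H.IsComp U U₀) (hY : H.Cn Y) (hq : q ∈ Y) {K K' L : Set V}
    (hK : H.IsComp (Y \ {q}) K) (hK' : H.IsComp (Y \ {q}) K') (hL : H.IsComp (Y \ {q}) L)
    (hne : K ≠ K') (hKL : K ≠ L) (hKL' : K' ≠ L) (ha : ¬ H.Touch K {a}) (ha' : ¬ H.Touch K' {a}) :
    H.HasF0 := by
  have hsw : H.Sep U Y a c b := h.rotate.rotate.swap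
  have d1 := Set.disjoint_left.1 (hK.disjoint hK' hne)
  have d2 := Set.disjoint_left.1 (hK.disjoint hL hKL)
  have d3 := Set.disjoint_left.1 (hK'.disjoint hL hKL')
  have d4 := Set.disjoint_left.1 h.disj
  have hUa := h.comp_touch_all h3 hU₀
  have sK : ∀ v ∈ K, v ∈ Y ∧ v ≠ q := fun v hv => hK.subset hv
  have sK' : ∀ v ∈ K', v ∈ Y ∧ v ≠ q := fun v hv => hK'.subset hv
  have sL : ∀ v ∈ L, v ∈ Y ∧ v ≠ q := fun v hv => hL.subset hv
  have sU : ∀ v ∈ U₀, v ∈ U := fun v hv => hU₀.subset hv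
  obtain ⟨hab, hac, haY, hbY, hcY, haU, hbU, hcU⟩ : a ≠ b ∧ a ≠ c ∧ a ∉ Y ∧ b ∉ Y ∧ c ∉ Y ∧
    a ∉ U ∧ b ∉ U ∧ c ∉ U := ⟨h.xy, h.xz, h.xY, h.yY, h.zY, h.xU, h.yU, h.zU⟩
  have hbc := h.yz
  obtain ⟨L', hL'c, hL's, hL'q, hL'b, hL'c'⟩ : ∃ L', H.Cn L' ∧ (∀ v ∈ L', v ∈ L ∨ v = a ∨ v ∈ U₀) ∧
      H.Touch {q} L' ∧ H.Touch {b} L' ∧ H.Touch {c} L' := by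
    by_cases hLa : H.Touch L {a}
    · have h1 := (hL.cn.union (cn_singleton a) hLa).union hU₀.cn
        (hUa.1.symm.mono Set.subset_union_right subset_rfl)
      refine ⟨_, h1, ?_, ?_, ?_, ?_⟩
      · rintro v ((hv | hv) | hv)
        exacts [Or.inl hv, Or.inr (Or.inl hv), Or.inr (Or.inr hv)]
      · exact (hL.touch_cut hY hq).symm.mono subset_rfl fun v hv => Or.inl (Or.inl hv)
      · exact hUa.2.1.symm.mono subset_rfl Set.subset_union_right
      · exact hUa.2.2.symm.mono subset_rfl Set.subset_union_right
    · exact ⟨L, hL.cn, fun v hv => Or.inl hv, (hL.touch_cut hY hq).symm,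
        (h.comp_touch_of_miss h3 hL hLa).symm, (hsw.comp_touch_of_miss h3 hL hLa).symm⟩
  refine hasF0_of_k33 (A := {q}) (B := {b}) (C := {c}) (P := K) (Q := K') (R := L') ?_ ?_ ?_
  · simp [cn_singleton, hK.cn, hK'.cn, hL'c]
  · simp only [List.pairwise_cons, List.mem_cons, List.not_mem_nil, or_false, forall_eq_or_imp,
      forall_eq, Set.disjoint_left, Set.mem_singleton_iff]
    grind
  · simp only [List.mem_cons, List.not_mem_nil, or_false, forall_eq_or_imp, forall_eq]
    exact ⟨⟨(hK.touch_cut hY hq).symm, (hK'.touch_cut hY hq).symm, hL'q⟩,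
      ⟨(h.comp_touch_of_miss h3 hK ha).symm, (h.comp_touch_of_miss h3 hK' ha').symm, hL'b⟩,
      (hsw.comp_touch_of_miss h3 hK ha).symm, (hsw.comp_touch_of_miss h3 hK' ha').symm, hL'c'⟩

end SimpleGraph

namespace SimpleGraph

variable {V : Type} {H : SimpleGraph V}

/-- A piece behind a cut vertex of one side of a three-separation is adjacent to `x` or `y`. -/
theorem Sep.touch_or_of_behind {U Y : Set V} {x y z q : V} (h : H.Sep U Y x y z) (h3 : H.Thr)
    {K : Set V} (hKY : K ⊆ Y) (hK : K.Nonempty)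
    (hcl : ∀ a ∈ K, ∀ b ∈ Y, b ∉ K → H.Adj a b → b = q) : H.Touch K {x} ∨ H.Touch K {y} := by
  obtain ⟨u, hu, v, hv, huv, h1, h2⟩ := h3.exists_third hK (fun hh => h.xY (hKY hh))
    (fun hh => h.yY (hKY hh)) (fun hh => h.zY (hKY hh)) h.xy h.xz h.yz q z
  rcases h.symm.nbr (hKY hu) (fun hh => h1 (hcl u hu v hh hv huv)) huv with rfl | rfl | rfl
  · exact Or.inl ⟨u, hu, _, rfl, huv⟩
  · exact Or.inr ⟨u, hu, _, rfl, huv⟩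
  · exact absurd rfl h2

theorem TwoN.nontrivial {Y : Set V} {x : V} (h : H.TwoN x Y) :
    {v : Y | H.Adj x v}.Nontrivial := by
  obtain ⟨n, hn, -, hxn⟩ := h x
  obtain ⟨m, hm, hmn, hxm⟩ := h n
  exact ⟨⟨n, hn⟩, hxn, ⟨m, hm⟩, hxm, fun h => hmn (Subtype.ext_iff.1 h).symm⟩

theorem touch_of_label {Y : Set V} {x : V} {P : Set Y} (h : (P ∩ {v : Y | H.Adj x v}).Nonempty) :
    H.Touch (Subtype.val '' P) {x} := by
  obtain ⟨v, hv, hxv⟩ := h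
  exact ⟨v, ⟨v, hv, rfl⟩, x, rfl, hxv.symm⟩

/-- The three outcomes of `gam_or_alp_or_eps` for one side of a three-separation, labelled by the
neighbourhoods of the three cut vertices. -/
theorem Sep.outcomes [Finite V] {U Y : Set V} {x y z : V} (h : H.Sep U Y x y z) (h3 : H.Thr)
    (hY : H.Cn Y) (hx : H.TwoN x Y) (hy : H.TwoN y Y) (hz : H.TwoN z Y) :
    (∃ P Q, P ⊆ Y ∧ Q ⊆ Y ∧ H.Cn P ∧ H.Cn Q ∧ Disjoint P Q ∧ H.Touch P Q ∧
      (H.Touch P {x} ∧ H.Touch P {y} ∧ H.Touch P {z}) ∧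
      H.Touch Q {x} ∧ H.Touch Q {y} ∧ H.Touch Q {z}) ∨
    (∃ P Q R, P ⊆ Y ∧ Q ⊆ Y ∧ R ⊆ Y ∧ H.Cn P ∧ H.Cn Q ∧ H.Cn R ∧ Disjoint P Q ∧ Disjoint P R ∧
      Disjoint Q R ∧ H.Touch P Q ∧ H.Touch P R ∧ H.Touch Q R ∧ (H.Touch P {x} ∧ H.Touch P {z}) ∧
      (H.Touch Q {x} ∧ H.Touch Q {y}) ∧ H.Touch R {y} ∧ H.Touch R {z}) ∨
    ∃ q ∈ Y, ¬ H.Cn (Y \ {q}) ∧ ∀ K ⊆ Y \ {q}, H.Cn K →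
      (¬ H.Touch K {x} ∨ ¬ H.Touch K {y} ∨ ¬ H.Touch K {z}) := by
  have key := gam_or_alp_or_eps _ Y (H.induce Y) {v | H.Adj x v} {v | H.Adj y v} {v | H.Adj z v} rfl
    (cn_induce.2 (by simpa using hY)) hx.nontrivial hy.nontrivial hz.nontrivial ?_
  · have sub : ∀ P : Set Y, Subtype.val '' P ⊆ Y := by
      rintro P _ ⟨a, -, rfl⟩
      exact a.2
    have dj : ∀ {P Q : Set Y}, Disjoint P Q → Disjoint (Subtype.val '' P) (Subtype.val '' Q) :=
      fun hd => (Set.disjoint_image_iff Subtype.val_injective).2 hd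
    rcases key with hg | ha | he
    · obtain ⟨P, Q, hP, hQ, hd, ht, h1, h2, h3, h4, h5, h6⟩ := hg
      exact Or.inl ⟨_, _, sub P, sub Q, cn_induce.1 hP, cn_induce.1 hQ, dj hd, ht.of_induce,
        ⟨touch_of_label h1, touch_of_label h2, touch_of_label h3⟩, touch_of_label h4,
        touch_of_label h5, touch_of_label h6⟩
    · obtain ⟨P, Q, R, hP, hQ, hR, d1, d2, d3, t1, t2, t3, h1, h2, h3, h4, h5, h6⟩ := ha
      exact Or.inr (Or.inl ⟨_, _, _, sub P, sub Q, sub R, cn_induce.1 hP, cn_induce.1 hQ,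
        cn_induce.1 hR, dj d1, dj d2, dj d3, t1.of_induce, t2.of_induce, t3.of_induce,
        ⟨touch_of_label h1, touch_of_label h2⟩, ⟨touch_of_label h3, touch_of_label h4⟩,
        touch_of_label h5, touch_of_label h6⟩)
    · obtain ⟨⟨q, hqY⟩, hq, hK⟩ := he
      refine Or.inr (Or.inr ⟨q, hqY, ?_, ?_⟩)
      · intro hc
        refine hq (cn_induce.2 ?_)
        convert hc
        ext v
        simp
      · intro K hKs hKc
        have hKi : Subtype.val '' (Subtype.val ⁻¹' K : Set Y) = K := by
          rw [Subtype.image_preimage_coe, Set.inter_eq_right]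
          exact fun v hv => (hKs hv).1
        have := hK (Subtype.val ⁻¹' K) (cn_induce.2 (by rwa [hKi])) fun hqK => (hKs hqK).2 rfl
        have nt : ∀ w, ((Subtype.val ⁻¹' K : Set Y) ∩ {v | H.Adj w v} = ∅) → ¬ H.Touch K {w} := by
          rintro w hw ⟨a, ha, _, rfl, hab⟩
          exact Set.notMem_empty (⟨a, (hKs ha).1⟩ : Y) (hw ▸ ⟨ha, hab.symm⟩)
        exact this.imp (nt x) (Or.imp (nt y) (nt z))
  · intro q K hK hqK _ hcl
    have hcl' : ∀ a ∈ Subtype.val '' K, ∀ b ∈ Y, b ∉ Subtype.val '' K → H.Adj a b → b = q := by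
      rintro _ ⟨a, ha, rfl⟩ b hb hbK hab
      exact Subtype.ext_iff.1 (hcl a ha ⟨b, hb⟩ (fun hh => hbK ⟨_, hh, rfl⟩) hab)
    have hKY : Subtype.val '' K ⊆ Y := by
      rintro _ ⟨a, -, rfl⟩
      exact a.2
    have lab : ∀ w, H.Touch (Subtype.val '' K) {w} → (K ∩ {v | H.Adj w v}).Nonempty := by
      rintro w ⟨_, ⟨a, ha, rfl⟩, _, rfl, hab⟩
      exact ⟨a, ha, hab.symm⟩
    exact ⟨(h.touch_or_of_behind h3 hKY (hK.image _) hcl').imp (lab _) (lab _),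
      (h.rotate.rotate.swap.touch_or_of_behind h3 hKY (hK.image _) hcl').imp (lab _) (lab _),
      (h.rotate.touch_or_of_behind h3 hKY (hK.image _) hcl').imp (lab _) (lab _)⟩

end SimpleGraph

namespace SimpleGraph

variable {V : Type} {H : SimpleGraph V}

/-- Three components of `Y ∖ {q}` missing three different labels yield a cube. -/
theorem hasF0_of_distinct_miss [Finite V] {U Y U₀ : Set V} {x y z q : V} (h : H.Sep U Y x y z)
    (h3 : H.Thr) (hU₀ : H.IsComp U U₀) (hY : H.Cn Y) (hq : q ∈ Y) {A B C : Set V}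
    (hA : H.IsComp (Y \ {q}) A) (hB : H.IsComp (Y \ {q}) B) (hC : H.IsComp (Y \ {q}) C)
    (hAB : A ≠ B) (hAC : A ≠ C) (hBC : B ≠ C) (ha : ¬ H.Touch A {x}) (hb : ¬ H.Touch B {y})
    (hc : ¬ H.Touch C {z}) : H.HasF0 := by
  have d1 := Set.disjoint_left.1 (hA.disjoint hB hAB)
  have d2 := Set.disjoint_left.1 (hA.disjoint hC hAC)
  have d3 := Set.disjoint_left.1 (hB.disjoint hC hBC)
  have d4 := Set.disjoint_left.1 h.disj
  have sA : ∀ v ∈ A, v ∈ Y ∧ v ≠ q := fun v hv => hA.subset hv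
  have sB : ∀ v ∈ B, v ∈ Y ∧ v ≠ q := fun v hv => hB.subset hv
  have sC : ∀ v ∈ C, v ∈ Y ∧ v ≠ q := fun v hv => hC.subset hv
  have sU : ∀ v ∈ U₀, v ∈ U := fun v hv => hU₀.subset hv
  obtain ⟨hUx, hUy, hUz⟩ := h.comp_touch_all h3 hU₀
  obtain ⟨hxy, hxz, hyz, hxU, hyU, hzU, hxY, hyY, hzY, -, -, -⟩ := id h
  refine hasF0_of_cube (A := {q}) (B := C) (C := B) (D := {x}) (P := A) (Q := {y}) (R := {z})
    (S := U₀) ?_ ?_ ⟨(hC.touch_cut hY hq).symm, (hB.touch_cut hY hq).symm,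
      (hA.touch_cut hY hq).symm⟩
    ⟨h.rotate.rotate.comp_touch_of_miss h3 hC hc, h.rotate.swap.comp_touch_of_miss h3 hC hc⟩
    ⟨h.swap.comp_touch_of_miss h3 hB hb, h.rotate.comp_touch_of_miss h3 hB hb⟩ hUx.symm
    ⟨h.comp_touch_of_miss h3 hA ha, h.rotate.rotate.swap.comp_touch_of_miss h3 hA ha⟩
    hUy.symm hUz.symm
  · simp [cn_singleton, hA.cn, hB.cn, hC.cn, hU₀.cn]
  · simp only [List.pairwise_cons, List.mem_cons, List.not_mem_nil, or_false, forall_eq_or_imp,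
      forall_eq, Set.disjoint_left, Set.mem_singleton_iff]
    repeat' apply And.intro
    all_goals (intros; grind)

theorem TwoPieces.symm {Y : Set V} {x z : V} (h : H.TwoPieces Y x z) : H.TwoPieces Y z x := by
  obtain ⟨q, P, R, hY, hqP, hqR, hd, hP, hR, ht, hz, hx⟩ := h
  exact ⟨q, R, P, by rw [hY, Set.union_comm], hqR, hqP, hd.symm, hR, hP, fun h => ht h.symm, hx, hz⟩

/-- One side of a three-separation either yields one of the minors, or falls apart into two
pieces. -/
theorem Sep.hasF0_or_twoPieces [Finite V] {U Y : Set V} {x y z : V} (h : H.Sep U Y x y z)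
    (h3 : H.Thr) (hU : U.Nonempty) (hYne : Y.Nonempty) (hx : H.TwoN x Y) (hy : H.TwoN y Y)
    (hz : H.TwoN z Y) :
    H.HasF0 ∨ H.TwoPieces Y x z ∨ H.TwoPieces Y y z ∨ H.TwoPieces Y x y := by
  obtain ⟨u, hu⟩ := hU
  obtain ⟨U₀, -, hU₀⟩ := exists_isComp (H := H) hu
  have d4 := Set.disjoint_left.1 h.disj
  have sU : ∀ v ∈ U₀, v ∈ U := fun v hv => hU₀.subset hv
  obtain ⟨hUx, hUy, hUz⟩ := h.comp_touch_all h3 hU₀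
  obtain ⟨hxy, hxz, hyz, hxU, hyU, hzU, hxY, hyY, hzY, -, -, -⟩ := id h
  have k33 : ∀ P Q, P ⊆ Y → Q ⊆ Y → H.Cn P → H.Cn Q → Disjoint P Q →
      (H.Touch P {x} ∧ H.Touch P {y} ∧ H.Touch P {z}) →
      (H.Touch Q {x} ∧ H.Touch Q {y} ∧ H.Touch Q {z}) → H.HasF0 := by
    intro P Q hP hQ cP cQ hd tP tQ
    refine hasF0_of_k33 (A := {x}) (B := {y}) (C := {z}) (P := P) (Q := Q) (R := U₀) ?_ ?_ ?_
    · simp [cn_singleton, cP, cQ, hU₀.cn]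
    · simp only [List.pairwise_cons, List.mem_cons, List.not_mem_nil, or_false, forall_eq_or_imp,
        forall_eq, Set.disjoint_left, Set.mem_singleton_iff] at hd ⊢
      have := @hP
      have := @hQ
      repeat' apply And.intro
      all_goals (intros; grind)
    · simp only [List.mem_cons, List.not_mem_nil, or_false, forall_eq_or_imp, forall_eq]
      exact ⟨⟨tP.1.symm, tQ.1.symm, hUx.symm⟩, ⟨tP.2.1.symm, tQ.2.1.symm, hUy.symm⟩,
        tP.2.2.symm, tQ.2.2.symm, hUz.symm⟩
  by_cases hY : H.Cn Y
  swap
  · obtain ⟨K, K', hK, hK', hne⟩ := exists_two_comps hYne hY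
    exact Or.inl (k33 K K' hK.subset hK'.subset hK.cn hK'.cn (hK.disjoint hK' hne)
      (h.symm.comp_touch_all h3 hK) (h.symm.comp_touch_all h3 hK'))
  rcases h.outcomes h3 hY hx hy hz with ⟨P, Q, hP, hQ, cP, cQ, hd, -, tP, tQ⟩ |
    ⟨P, Q, R, hP, hQ, hR, cP, cQ, cR, d1, d2, d3, t1, t2, t3, tP, tQ, tR⟩ | ⟨q, hq, hqn, hmiss⟩
  · exact Or.inl (k33 P Q hP hQ cP cQ hd tP tQ)
  · refine Or.inl (hasF0_of_h (A := P) (B := Q) (C := R) (P := {x}) (Q := {z}) (R := {y}) (S := U₀)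
      ?_ ?_ ⟨t1, t2, t3⟩ tP tQ tR.symm ⟨hUx.symm, hUz.symm, hUy.symm⟩)
    · simp [cn_singleton, cP, cQ, cR, hU₀.cn]
    · simp only [List.pairwise_cons, List.mem_cons, List.not_mem_nil, or_false, forall_eq_or_imp,
        forall_eq, Set.disjoint_left, Set.mem_singleton_iff] at d1 d2 d3 ⊢
      have := @hP
      have := @hQ
      have := @hR
      repeat' apply And.intro
      all_goals (intros; grind)
  obtain ⟨n, hn, hnq, -⟩ := hx q
  obtain ⟨A, B, hA, hB, hAB⟩ := exists_two_comps (U := Y \ {q}) ⟨n, hn, hnq⟩ hqn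
  have mA := hmiss A hA.subset hA.cn
  have mB := hmiss B hB.subset hB.cn
  have hzx := h.rotate.rotate
  by_cases hthird : ∃ C, H.IsComp (Y \ {q}) C ∧ A ≠ C ∧ B ≠ C
  · obtain ⟨C, hC, hAC, hBC⟩ := hthird
    refine Or.inl ?_
    have mC := hmiss C hC.subset hC.cn
    have same : ∀ {A B C}, H.IsComp (Y \ {q}) A → H.IsComp (Y \ {q}) B → H.IsComp (Y \ {q}) C →
        A ≠ B → A ≠ C → B ≠ C → (¬ H.Touch A {x} ∧ ¬ H.Touch B {x}) ∨
        (¬ H.Touch A {y} ∧ ¬ H.Touch B {y}) ∨ (¬ H.Touch A {z} ∧ ¬ H.Touch B {z}) → H.HasF0 := by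
      rintro A B C hA hB hC hAB hAC hBC (⟨a, b⟩ | ⟨a, b⟩ | ⟨a, b⟩)
      · exact hasF0_of_same_miss h h3 hU₀ hY hq hA hB hC hAB hAC hBC a b
      · exact hasF0_of_same_miss h.rotate h3 hU₀ hY hq hA hB hC hAB hAC hBC a b
      · exact hasF0_of_same_miss hzx h3 hU₀ hY hq hA hB hC hAB hAC hBC a b
    have sAB := same hA hB hC hAB hAC hBC
    have sAC := same hA hC hB hAC hAB hBC.symm
    have sBC := same hB hC hA hBC hAB.symm hAC.symm
    have dist := fun {A B C : Set V} => hasF0_of_distinct_miss (A := A) (B := B) (C := C) h h3 hU₀ hY hq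
    have t1 := dist hA hB hC hAB hAC hBC
    have t2 := dist hA hC hB hAC hAB hBC.symm
    have t3 := dist hB hA hC hAB.symm hBC hAC
    have t4 := dist hB hC hA hBC hAB.symm hAC.symm
    have t5 := dist hC hA hB hAC.symm hBC.symm hAB
    have t6 := dist hC hB hA hBC.symm hAC.symm hAB.symm
    clear dist same
    rcases mA with a | a | a <;> rcases mB with b | b | b <;> rcases mC with c | c | c <;>
    first
    | exact t1 a b c
    | exact t2 a c b
    | exact t3 b a c
    | exact t4 b c a
    | exact t5 c a b
    | exact t6 c b a
    | exact sAB (Or.inl ⟨a, b⟩)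
    | exact sAB (Or.inr (Or.inl ⟨a, b⟩))
    | exact sAB (Or.inr (Or.inr ⟨a, b⟩))
    | exact sAC (Or.inl ⟨a, c⟩)
    | exact sAC (Or.inr (Or.inl ⟨a, c⟩))
    | exact sAC (Or.inr (Or.inr ⟨a, c⟩))
    | exact sBC (Or.inl ⟨b, c⟩)
    | exact sBC (Or.inr (Or.inl ⟨b, c⟩))
    | exact sBC (Or.inr (Or.inr ⟨b, c⟩))
  · push Not at hthird
    refine Or.inr ?_
    have hcov : ∀ v ∈ Y, v ≠ q → v ∈ A ∨ v ∈ B := by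
      intro v hv hvq
      obtain ⟨C, hvC, hC⟩ := exists_isComp (H := H) (U := Y \ {q}) ⟨hv, hvq⟩
      by_cases hAC : A = C
      · exact Or.inl (hAC ▸ hvC)
      · exact Or.inr (hthird C hC hAC ▸ hvC)
    have notsame : ∀ w, H.TwoN w Y → ¬ H.Touch A {w} → ¬ H.Touch B {w} → False := by
      intro w hw a b
      obtain ⟨n, hn, hnq, hwn⟩ := hw q
      rcases hcov n hn hnq with hnA | hnB
      exacts [a ⟨n, hnA, w, rfl, hwn.symm⟩, b ⟨n, hnB, w, rfl, hwn.symm⟩]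
    have hYeq : Y = insert q (A ∪ B) := by
      ext v
      refine ⟨fun hv => ?_, ?_⟩
      · by_cases hvq : v = q
        exacts [Or.inl hvq, Or.inr (hcov v hv hvq)]
      · rintro (rfl | hv | hv)
        exacts [hq, (hA.subset hv).1, (hB.subset hv).1]
    have two : ∀ s t, ¬ H.Touch A {t} → ¬ H.Touch B {s} → H.TwoPieces Y s t := by
      intro s t ht hs
      refine ⟨q, A, B, hYeq, fun hh => (hA.subset hh).2 rfl, fun hh => (hB.subset hh).2 rfl,
        hA.disjoint hB hAB, hA.cn, hB.cn, ?_, ht, hs⟩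
      rintro ⟨a, ha, b, hb, hab⟩
      exact Set.disjoint_left.1 (hA.disjoint hB hAB) (hA.closed ha (hB.subset hb) hab) hb
    rcases mA with a | a | a <;> rcases mB with b | b | b
    · exact (notsame _ hx a b).elim
    · exact Or.inr (Or.inr (two _ _ a b).symm)
    · exact Or.inl (two _ _ a b).symm
    · exact Or.inr (Or.inr (two _ _ a b))
    · exact (notsame _ hy a b).elim
    · exact Or.inr (Or.inl (two _ _ a b).symm)
    · exact Or.inl (two _ _ a b)
    · exact Or.inr (Or.inl (two _ _ a b))
    · exact (notsame _ hz a b).elim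

end SimpleGraph

namespace SimpleGraph

variable {V : Type} {H : SimpleGraph V}

theorem sep_of_nbr {K : Set V} {a b c : V} (hab : a ≠ b) (hac : a ≠ c) (hbc : b ≠ c) (ha : a ∉ K)
    (hb : b ∉ K) (hc : c ∉ K)
    (hN : ∀ u ∈ K, ∀ v, v ∉ K → H.Adj u v → v = a ∨ v = b ∨ v = c) :
    H.Sep K {v | v ∉ K ∧ v ≠ a ∧ v ≠ b ∧ v ≠ c} a b c where
  xy := hab
  xz := hac
  yz := hbc
  xU := ha
  yU := hb
  zU := hc
  xY h := h.2.1 rfl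
  yY h := h.2.2.1 rfl
  zY h := h.2.2.2 rfl
  cover v := by simp only [Set.mem_ofPred_eq]; tauto
  disj := Set.disjoint_left.2 fun _ h h' => h'.1 h
  sep := by
    rintro ⟨u, hu, v, ⟨hv, h1, h2, h3⟩, huv⟩
    have := hN u hu v hv huv
    tauto

/-- Moving a cut vertex with a single neighbour in `Y` to the other side. -/
theorem Sep.grow {U Y : Set V} {x y z w : V} (h : H.Sep U Y x y z) (hw : w ∈ Y)
    (hn : ∀ n ∈ Y, n ≠ w → ¬ H.Adj x n) : H.Sep (insert x U) (Y \ {w}) w y z where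
  xy e := h.yY (e ▸ hw)
  xz e := h.zY (e ▸ hw)
  yz := h.yz
  xU e := e.elim (fun e => h.xY (e ▸ hw)) fun e => Set.disjoint_left.1 h.disj e hw
  yU e := e.elim (fun e => h.xy e.symm) h.yU
  zU e := e.elim (fun e => h.xz e.symm) h.zU
  xY e := e.2 rfl
  yY e := h.yY e.1
  zY e := h.zY e.1
  cover v := by
    simp only [Set.mem_insert_iff, Set.mem_sdiff, Set.mem_singleton_iff]
    have := h.cover v
    tauto
  disj := by
    rw [Set.disjoint_left]
    rintro v (rfl | hv) ⟨hY, -⟩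
    exacts [h.xY hY, Set.disjoint_left.1 h.disj hv hY]
  sep := by
    rintro ⟨u, rfl | hu, v, ⟨hv, hvw⟩, huv⟩
    exacts [hn v hv hvw huv, h.sep ⟨u, hu, v, hv, huv⟩]

/-- Moving a piece and a cut vertex to the other side. -/
theorem Sep.absorb {U Y P R : Set V} {x y z q : V} (h : H.Sep U Y x y z)
    (hY : Y = insert q (P ∪ R)) (hqP : q ∉ P) (hqR : q ∉ R) (hd : Disjoint P R)
    (hPR : ¬ H.Touch P R) (hx : ¬ H.Touch R {x}) : H.Sep (insert x (U ∪ P)) R q y z := by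
  have hq : q ∈ Y := hY ▸ Or.inl rfl
  have hP : P ⊆ Y := hY ▸ fun v hv => Or.inr (Or.inl hv)
  have hR : R ⊆ Y := hY ▸ fun v hv => Or.inr (Or.inr hv)
  have dUY := Set.disjoint_left.1 h.disj
  refine ⟨fun e => h.yY (e ▸ hq), fun e => h.zY (e ▸ hq), h.yz, ?_, ?_, ?_, hqR,
    fun e => h.yY (hR e), fun e => h.zY (hR e), fun v => ?_, ?_, ?_⟩
  · rintro (e | e | e)
    exacts [h.xY (e ▸ hq), dUY e hq, hqP e]
  · rintro (e | e | e)
    exacts [h.xy e.symm, h.yU e, h.yY (hP e)]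
  · rintro (e | e | e)
    exacts [h.xz e.symm, h.zU e, h.zY (hP e)]
  · have := h.cover v
    rw [hY] at this
    simp only [Set.mem_insert_iff, Set.mem_union] at this ⊢
    tauto
  · rw [Set.disjoint_left]
    rintro v (rfl | hv | hv) hvR
    exacts [h.xY (hR hvR), dUY hv (hR hvR), Set.disjoint_left.1 hd hv hvR]
  · rintro ⟨u, rfl | hu | hu, v, hv, huv⟩
    exacts [hx ⟨v, hv, _, rfl, huv.symm⟩, h.sep ⟨u, hu, v, hR hv, huv⟩, hPR ⟨u, hu, v, hv, huv⟩]

theorem Sep.exists_unique_nbr [Finite V] {U Y : Set V} {x y z : V} (h : H.Sep U Y x y z)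
    (h3 : H.Thr) (hY : Y.Nonempty) (hx : ¬ H.TwoN x Y) :
    ∃ w ∈ Y, H.Adj x w ∧ ∀ n ∈ Y, n ≠ w → ¬ H.Adj x n := by
  obtain ⟨v, hv⟩ := hY
  obtain ⟨K, -, hK⟩ := exists_isComp (H := H) hv
  obtain ⟨u, hu, _, rfl, hux⟩ := h.symm.comp_touch h3 hK
  rw [TwoN] at hx
  push Not at hx
  obtain ⟨w, hw⟩ := hx
  have huw : u = w := by
    by_contra hne
    exact hw u (hK.subset hu) hne hux.symm
  exact ⟨u, hK.subset hu, hux.symm, fun n hn hnu => hw n hn (huw ▸ hnu)⟩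

theorem ncard_lt_of_mem [Finite V] {A B : Set V} (h : A ⊆ B) {x : V} (hx : x ∈ B) (hA : x ∉ A) :
    A.ncard < B.ncard :=
  Set.ncard_lt_ncard ⟨h, fun hB => hA (hB hx)⟩

/-- If no vertex has a degree at most three, a graph with a proper three-separation has one of the
minors. -/
theorem hasF0_of_sep [Finite V] (h3 : H.Thr)
    (h4 : ∀ v a b c, ∃ m, m ≠ a ∧ m ≠ b ∧ m ≠ c ∧ H.Adj v m) {U Y : Set V} {x y z : V}
    (h : H.Sep U Y x y z) (hU : U.Nonempty) (hY : Y.Nonempty) : H.HasF0 := by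
  obtain ⟨U, ⟨Y, x, y, z, h, hU, hY⟩, hmax⟩ := Set.exists_max_image
    {U : Set V | ∃ Y x y z, H.Sep U Y x y z ∧ U.Nonempty ∧ Y.Nonempty} Set.ncard
    (Set.toFinite _) ⟨U, Y, x, y, z, h, hU, hY⟩
  have hmax' : ∀ {U' Y' : Set V} {a b c v : V}, H.Sep U' Y' a b c → U ⊆ U' → v ∈ U' → v ∉ U →
      Y'.Nonempty → False := fun h' hs hv hvU hY' =>
    (ncard_lt_of_mem hs hv hvU).not_ge (hmax _ ⟨_, _, _, _, h', ⟨_, hv⟩, hY'⟩)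
  have two : ∀ {x y z}, H.Sep U Y x y z → H.TwoN x Y := by
    intro x y z h
    by_contra hx
    obtain ⟨w, hw, -, hn⟩ := h.exists_unique_nbr h3 hY hx
    refine hmax' (h.grow hw hn) (Set.subset_insert _ _) (Set.mem_insert _ _) h.xU ?_
    obtain ⟨m, h1, h2, h3, hwm⟩ := h4 w x y z
    refine ⟨m, ?_, fun e => hwm.ne e.symm⟩
    by_contra hm
    rcases h.symm.nbr hw hm hwm with e | e | e <;> contradiction
  have tp : ∀ {x y z}, H.Sep U Y x y z → H.TwoPieces Y x z → False := by
    rintro x y z h ⟨q, P, R, hYe, hqP, hqR, hd, hP, hR, ht, -, hx⟩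
    exact hmax' (h.absorb hYe hqP hqR hd ht hx) (fun v hv => Or.inr (Or.inl hv))
      (Set.mem_insert _ _) h.xU hR.nonempty
  rcases h.hasF0_or_twoPieces h3 hU hY (two h) (two h.rotate) (two h.rotate.rotate) with
    h' | h' | h' | h'
  · exact h'
  · exact (tp h h').elim
  · exact (tp h.swap h').elim
  · exact (tp h.rotate.rotate.swap h').elim

end SimpleGraph

namespace SimpleGraph

/-- No nonempty set is separated from the rest by three vertices. -/
def Four {V : Type} (H : SimpleGraph V) : Prop :=
  ∀ (K : Set V) (a b c : V), K.Nonempty →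
    (∀ u ∈ K, ∀ v, v ∉ K → H.Adj u v → v = a ∨ v = b ∨ v = c) →
    ∀ v, v ∈ K ∨ v = a ∨ v = b ∨ v = c

theorem four_of_no_sep {V : Type} {H : SimpleGraph V} (h3 : H.Thr)
    (hno : ∀ (U Y : Set V) (x y z : V), H.Sep U Y x y z → U.Nonempty → ¬ Y.Nonempty) :
    H.Four := by
  intro K a b c hK hN v
  by_cases ha : a ∈ K ∨ a = b ∨ a = c
  · have := h3 K b c hK (fun u hu v hv huv => by have := hN u hu v hv huv; grind) v
    tauto
  by_cases hb : b ∈ K ∨ b = c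
  · have := h3 K a c hK (fun u hu v hv huv => by have := hN u hu v hv huv; grind) v
    tauto
  by_cases hc : c ∈ K
  · have := h3 K a b hK (fun u hu v hv huv => by have := hN u hu v hv huv; grind) v
    tauto
  push Not at ha hb
  have := hno _ _ _ _ _ (sep_of_nbr ha.2.1 ha.2.2 hb.2 ha.1 hb.1 hc hN) hK
  by_contra hv
  push Not at hv
  exact this ⟨v, hv⟩

/-- A triangle in a graph without three-separations. -/
theorem hasF0_of_triangle {V : Type} [Finite V] {H : SimpleGraph V} (h3 : H.Thr) (hf : H.Four)
    (h4 : ∀ v a b c, ∃ m, m ≠ a ∧ m ≠ b ∧ m ≠ c ∧ H.Adj v m) {x y z : V} (hxy : H.Adj x y)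
    (hxz : H.Adj x z) (hyz : H.Adj y z) : H.HasF0 := by
  have hsep := sep_of_nbr (H := H) (K := ∅) hxy.ne hxz.ne hyz.ne (by simp) (by simp) (by simp)
    (by simp)
  set Y : Set V := {v | v ∉ (∅ : Set V) ∧ v ≠ x ∧ v ≠ y ∧ v ≠ z} with hYdef
  have mY : ∀ v, v ∈ Y ↔ v ≠ x ∧ v ≠ y ∧ v ≠ z := fun v => by simp [hYdef]
  have two : ∀ {a b c}, (∀ v, v ∈ Y ↔ v ≠ a ∧ v ≠ b ∧ v ≠ c) → H.TwoN a Y := by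
    intro a b c hY w
    obtain ⟨m, h1, h2, h3, ham⟩ := h4 a w b c
    exact ⟨m, (hY m).2 ⟨ham.ne', h2, h3⟩, h1, ham⟩
  have tx : H.TwoN x Y := two mY
  have ty : H.TwoN y Y := two (b := z) (c := x) fun v => by rw [mY]; tauto
  have tz : H.TwoN z Y := two (b := x) (c := y) fun v => by rw [mY]; tauto
  obtain ⟨n, hn, -⟩ := tx x
  have cY : H.Cn Y := by
    by_contra hc
    obtain ⟨K, K', hK, hK', hne⟩ := exists_two_comps ⟨n, hn⟩ hc
    obtain ⟨k, hk⟩ := hK'.cn.nonempty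
    have hkY := (mY k).1 (hK'.subset hk)
    have := hf K x y z hK.cn.nonempty (fun u hu v hv huv => by
      by_contra hvY
      push Not at hvY
      exact hv (hK.closed hu ((mY v).2 hvY) huv)) k
    have hkK := Set.disjoint_left.1 (hK.disjoint hK' hne).symm hk
    tauto
  have xY := hsep.xY
  have yY := hsep.yY
  have zY := hsep.zY
  have nxy := hxy.ne
  have nxz := hxz.ne
  have nyz := hyz.ne
  have tt : ∀ {a b : V}, H.Adj a b → H.Touch {a} {b} := fun h => ⟨_, rfl, _, rfl, h⟩
  rcases hsep.outcomes h3 cY tx ty tz with ⟨P, Q, hP, hQ, cP, cQ, hd, tPQ, tP, tQ⟩ |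
    ⟨P, Q, R, hP, hQ, hR, cP, cQ, cR, d1, d2, d3, t1, t2, t3, tP, tQ, tR⟩ | ⟨q, hq, hqn, hmiss⟩
  · refine hasF0_of_k5 (A := {x}) (B := {y}) (C := {z}) (P := P) (Q := Q) ?_ ?_ ?_
    · simp [cn_singleton, cP, cQ]
    · simp only [List.pairwise_cons, List.mem_cons, List.not_mem_nil, or_false, forall_eq_or_imp,
        forall_eq, Set.disjoint_left, Set.mem_singleton_iff] at hd ⊢
      have := @hP
      have := @hQ
      repeat' apply And.intro
      all_goals (intros; grind)
    · simp [tt hxy, tt hxz, tt hyz, tP.1.symm, tP.2.1.symm, tP.2.2.symm, tQ.1.symm, tQ.2.1.symm,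
        tQ.2.2.symm, tPQ]
  · refine hasF0_of_oct (A := P) (A' := {y}) (B := Q) (B' := {z}) (C := R) (C' := {x}) ?_ ?_ ?_ ?_
    · simp [cn_singleton, cP, cQ, cR]
    · simp only [List.pairwise_cons, List.mem_cons, List.not_mem_nil, or_false, forall_eq_or_imp,
        forall_eq, Set.disjoint_left, Set.mem_singleton_iff] at d1 d2 d3 ⊢
      have := @hP
      have := @hQ
      have := @hR
      repeat' apply And.intro
      all_goals (intros; grind)
    · simp [tt hxy.symm, tt hyz, t1, t2, tP.1, tP.2, tQ.2.symm, tR.1.symm]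
    · simp [tt hxz.symm, t3, tQ.1, tR.2.symm]
  · exfalso
    obtain ⟨n, hn, hnq, -⟩ := tx q
    obtain ⟨A, -, hA, -, -⟩ := exists_two_comps (U := Y \ {q}) ⟨n, hn, hnq⟩ hqn
    have clash : ∀ {a b c}, (∀ v, v ∈ Y ↔ v ≠ a ∧ v ≠ b ∧ v ≠ c) → a ≠ b → a ≠ c →
        H.Touch A {a} := by
      intro a b c hY hab hac
      by_contra ht
      have haY : a ∉ Y := fun h => ((hY a).1 h).1 rfl
      have hN : ∀ u ∈ A, ∀ v, v ∉ A → H.Adj u v → v = q ∨ v = b ∨ v = c := by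
        intro u hu v hv huv
        by_contra hcon
        push Not at hcon
        by_cases hva : v = a
        · exact ht ⟨u, hu, v, hva, huv⟩
        · exact hv (hA.closed hu ⟨(hY v).2 ⟨hva, hcon.2⟩, hcon.1⟩ huv)
      rcases hf A q b c hA.cn.nonempty hN a with h | h | h | h
      exacts [haY (hA.subset h).1, haY (h ▸ hq), hab h, hac h]
    rcases hmiss A hA.subset hA.cn with h | h | h
    · exact h (clash mY nxy nxz)
    · exact h (clash (b := z) (c := x) (fun v => by rw [mY]; tauto) nyz nxy.symm)
    · exact h (clash (b := x) (c := y) (fun v => by rw [mY]; tauto) nxz.symm nyz.symm)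

/-- A graph that is three-connected with minimum degree at least four has one of the minors. -/
theorem hasF0_of_minDegree (n : ℕ) : ∀ (V : Type) [Finite V] [Nonempty V] (H : SimpleGraph V),
    Nat.card V = n → H.Thr → (∀ v a b c, ∃ m, m ≠ a ∧ m ≠ b ∧ m ≠ c ∧ H.Adj v m) → H.HasF0 := by
  induction n using Nat.strong_induction_on with
  | _ n ih =>
  intro V _ _ H hn h3 h4
  by_cases hno : ∀ (U Y : Set V) (x y z : V), H.Sep U Y x y z → U.Nonempty → ¬ Y.Nonempty
  swap
  · push Not at hno
    obtain ⟨U, Y, x, y, z, h, hU, hY⟩ := hno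
    exact hasF0_of_sep h3 h4 h hU hY
  have hf := four_of_no_sep h3 hno
  by_cases htri : ∃ x y z, H.Adj x y ∧ H.Adj x z ∧ H.Adj y z
  · obtain ⟨x, y, z, h1, h2, h3'⟩ := htri
    exact hasF0_of_triangle h3 hf h4 h1 h2 h3'
  push Not at htri
  obtain ⟨x⟩ := ‹Nonempty V›
  obtain ⟨y, -, -, -, hxy⟩ := h4 x x x x
  have hyD : y ∈ ({x, y} : Set V) := by simp
  have hxD : x ∈ ({x, y} : Set V) := by simp
  set r := squash ({x, y} : Set V) x with hr
  have hfib : ∀ p, H.Cn (r ⁻¹' {p}) := squash_fibre hxD (cn_pair hxy)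
  have hval : ∀ v p, r v = p → v = p.1 ∨ (v = y ∧ p.1 = x) := by
    rintro v _ rfl
    by_cases hv : v ∈ ({x, y} : Set V)
    · rw [hr, squash_of_mem hv]
      rcases hv with rfl | rfl <;> simp
    · rw [hr, squash_of_notMem hv]
      exact Or.inl rfl
  have hself : ∀ p, r p.1 = p := by
    intro p
    apply Subtype.ext
    rcases p.2 with h | h
    · exact squash_of_notMem h
    · rw [h]
      exact squash_of_mem hxD
  have hry : ∀ p : {w : V // w ∉ ({x, y} : Set V) ∨ w = x}, p.1 ≠ y := by
    intro p e
    rcases p.2 with h | h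
    exacts [h (e.symm ▸ hyD), hxy.ne (h.symm.trans e)]
  have hryx : (r y).1 = x := squash_of_mem hyD
  refine HasF0.lift hfib (@ih _ (hn ▸ squash_card_lt hyD hxy.ne') _ inferInstance ⟨r x⟩
    (H.along r) rfl ?_ ?_)
  · intro K a b hK hN p
    have := hf (r ⁻¹' K) a.1 b.1 y (by obtain ⟨k, hk⟩ := hK; exact ⟨k.1, by simpa [hself] using hk⟩)
      (fun u hu v hv huv => by
        have hne : r u ≠ r v := fun e => hv (by rw [Set.mem_preimage, ← e]; exact hu)
        rcases hN (r u) hu (r v) hv ⟨hne, u, v, rfl, rfl, huv⟩ with e | e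
        · rcases hval v a e with h | h <;> tauto
        · rcases hval v b e with h | h <;> tauto) p.1
    rw [Set.mem_preimage, hself, ← Subtype.ext_iff, ← Subtype.ext_iff] at this
    have := hry p
    tauto
  · intro p a b c
    by_cases hp : p.1 = x
    · have good : ∀ m u, u = x ∨ u = y → H.Adj u m → m ≠ x → m ≠ y → m ≠ a.1 → m ≠ b.1 →
          m ≠ c.1 → ∃ m, m ≠ a ∧ m ≠ b ∧ m ≠ c ∧ (H.along r).Adj p m := by
        intro m u hu hum hmx hmy ha hb hc
        have hne : ∀ t, m ≠ t.1 → r m ≠ t := fun t ht e => (hval m t e).elim ht fun h => hmy h.1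
        refine ⟨r m, hne a ha, hne b hb, hne c hc, (hne p fun e => hmx (e.trans hp)).symm,
          u, m, ?_, rfl, hum⟩
        apply Subtype.ext
        rcases hu with rfl | rfl
        · rw [hp]
          exact squash_of_mem hxD
        · rw [hryx, hp]
      obtain ⟨m, h1, h2, h3, hxm⟩ := h4 x y a.1 b.1
      by_cases hmc : m = c.1
      · obtain ⟨m', h1', h2', h3', hym⟩ := h4 y x a.1 b.1
        exact good m' y (Or.inr rfl) hym h1' hym.ne' h2' h3' fun e =>
          htri x y m hxy hxm ((hmc.trans e.symm) ▸ hym)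
      · exact good m x (Or.inl rfl) hxm hxm.ne' h1 h2 h3 hmc
    · obtain ⟨f, hfdef⟩ : ∃ f : V → V, ∀ t, (H.Adj p.1 y → t = x → f t = y) ∧
          (¬ (H.Adj p.1 y ∧ t = x) → f t = t) :=
        ⟨fun t => if H.Adj p.1 y ∧ t = x then y else t, fun t => by
          constructor
          · intro h1 h2; simp [h1, h2]
          · intro h; simp [h]⟩
      obtain ⟨m, h1, h2, h3, hpm⟩ := h4 p.1 (f a.1) (f b.1) (f c.1)
      have hmx : H.Adj p.1 y → m ≠ x := by
        rintro h rfl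
        exact htri _ _ _ hpm h hxy
      have hne : ∀ t, m ≠ f t.1 → r m ≠ t := by
        intro t ht e
        have := hfdef t.1
        have h5 := hval m t e
        have h6 : m = y → H.Adj p.1 y := fun e => e ▸ hpm
        by_cases h : H.Adj p.1 y ∧ t.1 = x
        · rw [this.1 h.1 h.2] at ht
          have := hmx h.1
          grind
        · rw [this.2 h] at ht
          grind
      refine ⟨r m, hne a h1, hne b h2, hne c h3, ?_, p.1, m, hself p, rfl, hpm⟩
      intro e
      rcases hval m p e.symm with h | h
      · exact hpm.ne h.symm
      · exact hp h.2

end SimpleGraph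

/-! ### Small sets -/

namespace SimpleGraph

variable {V : Type} {H : SimpleGraph V}

/-- An abstract notion of small vertex sets: every three-separation has exactly one small side, and
a small side can be enlarged by a cut vertex with only one neighbour on the other side. -/
structure Smallness (H : SimpleGraph V) (small : Set V → Prop) : Prop where
  empty : small ∅
  not_both : ∀ {A B : Set V} {a b c : V}, H.Sep A B a b c → small A → ¬ small B
  one : ∀ {A B : Set V} {a b c : V}, H.Sep A B a b c → small A ∨ small B
  insert : ∀ {A B : Set V} {x b c w : V}, H.Sep A B x b c → w ∈ B → H.Adj x w →
    (∀ n ∈ B, n ≠ w → ¬ H.Adj x n) → small A → small (insert x A)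

/-- `U` has the largest cardinality among small sides of three-separations. -/
def MaxSmall (H : SimpleGraph V) (small : Set V → Prop) (U : Set V) : Prop :=
  ∀ {A B : Set V} {a b c : V}, H.Sep A B a b c → small A → A.ncard ≤ U.ncard

/-- A triangle of branch sets in `U ∪ {x, z}`, two of which contain `x` and `z`, and the third of
which is adjacent to `y`. -/
def Tri (H : SimpleGraph V) (U : Set V) (z x y : V) : Prop :=
  ∃ Dz Dx D', z ∈ Dz ∧ Dz ⊆ insert z U ∧ x ∈ Dx ∧ Dx ⊆ insert x U ∧ D' ⊆ U ∧ H.Cn Dz ∧ H.Cn Dx ∧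
    H.Cn D' ∧ Disjoint Dz Dx ∧ Disjoint Dz D' ∧ Disjoint Dx D' ∧ H.Touch Dz Dx ∧ H.Touch Dz D' ∧
    H.Touch Dx D' ∧ H.Touch D' {y}

theorem tri_of_growth [Finite V] (h3 : H.Thr) {small : Set V → Prop} (hs : H.Smallness small)
    {U Y P : Set V} {x y z q : V} (h : H.Sep U Y x y z) (hmax : H.MaxSmall small U)
    (hP : P ⊆ Y) (hq : q ∈ Y) (n : ℕ) : ∀ (Q A' W : Set V) (w : V), Q.ncard = n → small A' →
      H.Sep A' (insert x (Q ∪ P)) w y q → Q ⊆ U → ¬ H.Touch P {w} → H.Cn W → z ∈ W → w ∈ W →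
      W ⊆ insert z (U \ Q) → insert z U ⊆ insert w (A' ∪ Q) → H.Tri U z x y := by
  induction n with
  | zero => ?_
  | succ n ih => ?_
  all_goals
    intro Q A' W w hn hA' hsep hQU hPw hW hzW hwW hWs hinv
    have dUY := Set.disjoint_left.1 h.disj
    have hxQ : x ∉ Q := fun e => h.xU (hQU e)
    have hyQ : y ∉ Q := fun e => h.yU (hQU e)
    have hzQ : z ∉ Q := fun e => h.zU (hQU e)
    have hwx : w ≠ x := fun e => hsep.xY (e ▸ Set.mem_insert _ _)
    have hwQ : w ∉ Q := fun e => hsep.xY (Or.inr (Or.inl e))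
    have hN : ∀ u ∈ Q, ∀ v, v ∉ Q → H.Adj u v → v = w ∨ v = x ∨ v = y := by
      intro u hu v hv huv
      have huB : u ∈ insert x (Q ∪ P) := Or.inr (Or.inl hu)
      by_cases hvB : v ∈ insert x (Q ∪ P)
      · rcases hvB with hvx | hvQ | hvP
        · exact Or.inr (Or.inl hvx)
        · exact absurd hvQ hv
        · exact absurd ⟨u, hQU hu, v, hP hvP, huv⟩ h.sep
      · rcases hsep.symm.nbr huB hvB huv with e | e | e
        · exact Or.inl e
        · exact Or.inr (Or.inr e)
        · exact absurd ⟨u, hQU hu, v, e ▸ hq, huv⟩ h.sep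
    by_cases htwo : H.TwoN w (insert x Q)
    · have hQ : Q.Nonempty := by
        obtain ⟨m, hm, hmx, -⟩ := htwo x
        exact ⟨m, hm.resolve_left hmx⟩
      obtain ⟨Dw, Dx, D', hwD, hDw, hxD, hDx, hD', c1, c2, c3, d1, d2, d3, t1, t2, t3, t4⟩ :=
        exists_rooted_triangle h3 hQ hwx hsep.xy h.xy hwQ hxQ hyQ hN htwo
      refine ⟨Dw ∪ W, Dx, D', Or.inr hzW, ?_, hxD, hDx.trans (Set.insert_subset_insert hQU),
        hD'.trans hQU, cn_union_of_mem c1 hW hwD hwW, c2, c3, ?_, ?_, d3,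
        t1.mono Set.subset_union_left subset_rfl, t2.mono Set.subset_union_left subset_rfl, t3, t4⟩
      · refine Set.union_subset (hDw.trans ?_) (hWs.trans ?_)
        · rintro v (rfl | hv)
          · exact Set.insert_subset_insert Set.sdiff_subset (hWs hwW)
          · exact Or.inr (hQU hv)
        · exact Set.insert_subset_insert Set.sdiff_subset
      · refine Set.disjoint_union_left.2 ⟨d1, Set.disjoint_left.2 fun v hv hvD => ?_⟩
        rcases hDx hvD with rfl | hvQ <;> rcases hWs hv with e | e
        exacts [h.xz e, h.xU e.1, hzQ (e ▸ hvQ), e.2 hvQ]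
      · refine Set.disjoint_union_left.2 ⟨d2, Set.disjoint_left.2 fun v hv hvD => ?_⟩
        have hvQ := hD' hvD
        rcases hWs hv with e | e
        exacts [hzQ (e ▸ hvQ), e.2 hvQ]
    have htwo' : ¬ H.TwoN w (insert x (Q ∪ P)) := by
      intro ht
      refine htwo fun t => ?_
      obtain ⟨m, hm, hmt, hwm⟩ := ht t
      refine ⟨m, ?_, hmt, hwm⟩
      rcases hm with e | e | e
      · exact Or.inl e
      · exact Or.inr e
      · exact absurd ⟨m, e, w, rfl, hwm.symm⟩ hPw
    obtain ⟨u, hu, hwu, huniq⟩ := hsep.exists_unique_nbr h3 ⟨x, Set.mem_insert _ _⟩ htwo'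
    have hsm := hs.insert hsep hu hwu huniq hA'
    have hgrow := hsep.grow hu huniq
    rcases hu with rfl | hu | hu
    · exfalso
      have hQ : Q = ∅ := by
        by_contra hne
        rcases h3 Q u y (Set.nonempty_iff_ne_empty.2 hne) (fun s hs v hv hsv => by
          rcases hN s hs v hv hsv with rfl | e
          · exact absurd hsv.symm (huniq s (Or.inr (Or.inl hs)) fun e => hxQ (e ▸ hs))
          · exact e) z with e | e | e
        exacts [hzQ e, h.xz e.symm, h.yz e.symm]
      have h1 := hmax hgrow hsm
      have h2 : insert z U ⊆ insert w A' := by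
        intro v hv
        have := hinv hv
        simpa [hQ] using this
      have h4 := Set.ncard_le_ncard h2
      have h5 := ncard_lt_of_mem (Set.subset_insert z U) (Set.mem_insert z U) h.zU
      omega
    swap
    · exact absurd ⟨u, hu, w, rfl, hwu.symm⟩ hPw
  · exact absurd hu (by rw [(Set.ncard_eq_zero).1 hn]; exact Set.notMem_empty u)
  · have hux : u ≠ x := fun e => hxQ (e ▸ hu)
    have huP : u ∉ P := fun e => dUY (hQU hu) (hP e)
    refine ih (Q \ {u}) (insert w A') (insert u W) u ?_ hsm ?_ (Set.sdiff_subset.trans hQU) ?_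
      (hW.insert ⟨u, rfl, w, hwW, hwu.symm⟩) (Or.inr hzW) (Set.mem_insert _ _) ?_ ?_
    · rw [Set.ncard_sdiff_singleton_of_mem hu, hn]
      rfl
    · convert hgrow using 1
      ext v
      simp only [Set.mem_insert_iff, Set.mem_union, Set.mem_sdiff, Set.mem_singleton_iff]
      constructor
      · rintro (rfl | hv | hv)
        · exact ⟨Or.inl rfl, hux.symm⟩
        · exact ⟨Or.inr (Or.inl hv.1), hv.2⟩
        · exact ⟨Or.inr (Or.inr hv), fun e => huP (e ▸ hv)⟩
      · tauto
    · rintro ⟨p, hp, _, rfl, hpu⟩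
      exact h.sep ⟨_, hQU hu, p, hP hp, hpu.symm⟩
    · rintro v (rfl | hv)
      · exact Or.inr ⟨hQU hu, fun e => e.2 rfl⟩
      · exact (hWs hv).imp_right fun e => ⟨e.1, fun e' => e.2 e'.1⟩
    · intro v hv
      have := hinv hv
      simp only [Set.mem_insert_iff, Set.mem_union, Set.mem_sdiff, Set.mem_singleton_iff] at this ⊢
      tauto

end SimpleGraph

namespace SimpleGraph

variable {V : Type} {H : SimpleGraph V}

/-- A piece of `Y` bounded by `x`, `y` and `q` contains a rooted triangle. -/
theorem Sep.tri_of_piece [Finite V] {U Y P R : Set V} {x y z q : V} (h : H.Sep U Y x y z)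
    (h3 : H.Thr) (hx : H.TwoN x Y) (hY : Y = insert q (P ∪ R)) (hqP : q ∉ P) (hP : H.Cn P)
    (hPR : ¬ H.Touch P R) (hPz : ¬ H.Touch P {z}) (hRx : ¬ H.Touch R {x}) : H.Tri P x q y := by
  have hq : q ∈ Y := hY ▸ Or.inl rfl
  have hPY : P ⊆ Y := hY ▸ fun v hv => Or.inr (Or.inl hv)
  have hxq : x ≠ q := fun e => h.xY (e ▸ hq)
  have hqy : q ≠ y := fun e => h.yY (e ▸ hq)
  refine exists_rooted_triangle h3 hP.nonempty hxq h.xy hqy (fun e => h.xY (hPY e)) hqP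
    (fun e => h.yY (hPY e)) (fun u hu v hv huv => ?_) fun w => ?_
  · by_cases hvY : v ∈ Y
    · rw [hY] at hvY
      rcases hvY with e | e | e
      exacts [Or.inr (Or.inl e), absurd e hv, absurd ⟨u, hu, v, e, huv⟩ hPR]
    · rcases h.symm.nbr (hPY hu) hvY huv with e | e | e
      exacts [Or.inl e, Or.inr (Or.inr e), absurd ⟨u, hu, v, e, huv⟩ hPz]
  · obtain ⟨m, hm, hmw, hxm⟩ := hx w
    refine ⟨m, ?_, hmw, hxm⟩
    rw [hY] at hm
    rcases hm with e | e | e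
    exacts [Or.inl e, Or.inr e, absurd ⟨m, e, x, rfl, hxm.symm⟩ hRx]

/-- Three rooted triangles form the minor `H`. -/
theorem hasF0_of_tri {U P R : Set V} {x y z q : V} (hU : H.Tri U z x y) (hP : H.Tri P x q y)
    (hR : H.Tri R z q y) (hxz : x ≠ z) (hxq : x ≠ q) (hzq : z ≠ q) (hyx : y ≠ x) (hyz : y ≠ z)
    (hyq : y ≠ q) (yU : y ∉ U) (qU : q ∉ U) (yP : y ∉ P) (zP : z ∉ P) (xR : x ∉ R) (yR : y ∉ R)
    (dUP : Disjoint U P) (dUR : Disjoint U R) (dPR : Disjoint P R) : H.HasF0 := by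
  obtain ⟨Uz, Ux, U', zUz, sUz, xUx, sUx, sU', cUz, cUx, cU', dU1, dU2, dU3, tU1, tU2, tU3, tU4⟩ := hU
  obtain ⟨Px, Pq, P', xPx, sPx, qPq, sPq, sP', cPx, cPq, cP', dP1, dP2, dP3, tP1, tP2, tP3, tP4⟩ := hP
  obtain ⟨Rz, Rq, R', zRz, sRz, qRq, sRq, sR', cRz, cRq, cR', dR1, dR2, dR3, tR1, tR2, tR3, tR4⟩ := hR
  have sl := fun A B : Set V => Set.subset_union_left (s := A) (t := B)
  have sr := fun A B : Set V => Set.subset_union_right (s := A) (t := B)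
  refine hasF0_of_h (A := Px ∪ Ux) (B := Rz ∪ Uz) (C := Pq ∪ Rq) (P := U') (Q := P') (R := R')
    (S := {y}) ?_ ?_
    ⟨tU1.symm.mono (sr _ _) (sr _ _), tP1.mono (sl _ _) (sl _ _), tR1.mono (sl _ _) (sr _ _)⟩
    ⟨tU3.mono (sr _ _) subset_rfl, tP2.mono (sl _ _) subset_rfl⟩
    ⟨tU2.mono (sr _ _) subset_rfl, tR2.mono (sl _ _) subset_rfl⟩
    ⟨tP3.mono (sl _ _) subset_rfl, tR3.mono (sr _ _) subset_rfl⟩ ⟨tU4, tP4, tR4⟩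
  · simp [cn_singleton, cU', cP', cR', cn_union_of_mem cPx cUx xPx xUx,
      cn_union_of_mem cRz cUz zRz zUz, cn_union_of_mem cPq cRq qPq qRq]
  · have := @sUz
    have := @sUx
    have := @sU'
    have := @sPx
    have := @sPq
    have := @sP'
    have := @sRz
    have := @sRq
    have := @sR'
    simp only [List.pairwise_cons, List.mem_cons, List.not_mem_nil, or_false, forall_eq_or_imp,
      forall_eq, Set.disjoint_left, Set.mem_singleton_iff, Set.mem_union] at *
    repeat' apply And.intro
    all_goals (intros; grind)

theorem hasF0_of_maxSmall_twoPieces [Finite V] (h3 : H.Thr) {small : Set V → Prop}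
    (hs : H.Smallness small) {U Y : Set V} {x y z : V} (h : H.Sep U Y x y z)
    (hmax : H.MaxSmall small U) (hx : H.TwoN x Y) (hz : H.TwoN z Y) (ht : H.TwoPieces Y x z) :
    H.HasF0 := by
  obtain ⟨q, P, R, hY, hqP, hqR, hd, hP, hR, hPR, hPz, hRx⟩ := ht
  have hq : q ∈ Y := hY ▸ Or.inl rfl
  have hPY : P ⊆ Y := hY ▸ fun v hv => Or.inr (Or.inl hv)
  have hRY : R ⊆ Y := hY ▸ fun v hv => Or.inr (Or.inr hv)
  have hY' : Y = insert q (R ∪ P) := by rw [hY, Set.union_comm]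
  have hRP : ¬ H.Touch R P := fun e => hPR e.symm
  have hzx : H.Sep U Y z y x := h.rotate.swap
  have hsepR := h.absorb hY hqP hqR hd hPR hRx
  have hsR : small R := by
    refine (hs.one hsepR).resolve_left fun hsm => ?_
    have h1 := hmax hsepR hsm
    have h2 := ncard_lt_of_mem (A := U) (B := insert x (U ∪ P)) (fun v hv => Or.inr (Or.inl hv))
      (Set.mem_insert x _) h.xU
    omega
  have dUY := h.disj
  refine hasF0_of_tri (q := q) (P := P) (R := R)
    (tri_of_growth h3 hs h hmax hPY hq _ U R {z} z rfl hsR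
      hsepR.symm.rotate.swap subset_rfl hPz (cn_singleton z) rfl rfl
      (Set.singleton_subset_iff.2 (Set.mem_insert _ _))
      (Set.insert_subset_insert Set.subset_union_right))
    (h.tri_of_piece h3 hx hY hqP hP hPR hPz hRx) (hzx.tri_of_piece h3 hz hY' hqR hR hRP hRx hPz)
    h.xz (fun e => h.xY (e ▸ hq)) (fun e => h.zY (e ▸ hq)) h.xy.symm h.yz (fun e => h.yY (e ▸ hq))
    h.yU (fun e => Set.disjoint_left.1 dUY e hq) (fun e => h.yY (hPY e)) (fun e => h.zY (hPY e))
    (fun e => h.xY (hRY e)) (fun e => h.yY (hRY e)) (dUY.mono_right hPY) (dUY.mono_right hRY) hd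

theorem exists_ne_four {x y z m m' : V} (h1 : x ≠ y) (h2 : x ≠ z) (h3 : y ≠ z)
    (hm : m ≠ x ∧ m ≠ y ∧ m ≠ z) (hm' : m' ≠ x ∧ m' ≠ y ∧ m' ≠ z) (hmm' : m' ≠ m) (v a b c : V) :
    ∃ u, u ≠ v ∧ u ≠ a ∧ u ≠ b ∧ u ≠ c := by
  by_contra hall
  push Not at hall
  have hcard : ({x, y, z, m, m'} : Finset V).card ≤ ({v, a, b, c} : Finset V).card :=
    Finset.card_le_card fun u _ => by
      have := hall u
      simp only [Finset.mem_insert, Finset.mem_singleton]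
      tauto
  have hle : ({v, a, b, c} : Finset V).card ≤ 4 := Finset.card_le_four
  have h5 : ({x, y, z, m, m'} : Finset V).card = 5 := by
    rw [Finset.card_insert_of_notMem, Finset.card_insert_of_notMem, Finset.card_insert_of_notMem,
      Finset.card_insert_of_notMem, Finset.card_singleton]
    all_goals
      simp only [Finset.mem_insert, Finset.mem_singleton]
      grind
  omega

/-- A three-connected graph with a notion of smallness has one of the minors. -/
theorem hasF0_of_smallness [Finite V] (h3 : H.Thr) {small : Set V → Prop}
    (hs : H.Smallness small) {a b c : V} (hab : a ≠ b) (hac : a ≠ c) (hbc : b ≠ c) : H.HasF0 := by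
  obtain ⟨U, ⟨Y, x, y, z, h, hU⟩, hmax⟩ := Set.exists_max_image
    {U : Set V | ∃ Y x y z, H.Sep U Y x y z ∧ small U} Set.ncard (Set.toFinite _)
    ⟨∅, _, a, b, c, sep_of_nbr hab hac hbc (by simp) (by simp) (by simp) (by simp), hs.empty⟩
  have hmax' : H.MaxSmall small U := fun h hA => hmax _ ⟨_, _, _, _, h, hA⟩
  have hYne : Y.Nonempty := by
    rw [Set.nonempty_iff_ne_empty]
    rintro rfl
    exact hs.not_both h hU hs.empty
  have two : ∀ {x y z}, H.Sep U Y x y z → H.TwoN x Y := by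
    intro x y z h
    by_contra hx
    obtain ⟨w, hw, hxw, hn⟩ := h.exists_unique_nbr h3 hYne hx
    exact (ncard_lt_of_mem (Set.subset_insert x U) (Set.mem_insert x U) h.xU).not_ge
      (hmax' (h.grow hw hn) (hs.insert h hw hxw hn hU))
  have hx := two h
  have hy := two h.rotate
  have hz := two h.rotate.rotate
  by_contra hcon
  have hUne : U.Nonempty := by
    by_contra hUe
    rw [Set.not_nonempty_iff_eq_empty] at hUe
    have hno : ∀ {A B : Set V} {a b c : V}, H.Sep A B a b c → A.Nonempty → ¬ small A := by
      intro A B a b c hAB hA hsA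
      have := hmax' hAB hsA
      rw [hUe, Set.ncard_empty, Nat.le_zero, Set.ncard_eq_zero] at this
      exact hA.ne_empty this
    have : Nonempty V := ⟨x⟩
    have h4 : ¬ ∀ v a b c, ∃ m, m ≠ a ∧ m ≠ b ∧ m ≠ c ∧ H.Adj v m := fun h4 =>
      hcon (hasF0_of_minDegree _ V H rfl h3 h4)
    push Not at h4
    obtain ⟨v, a, b, c, hv⟩ := h4
    obtain ⟨m, hm, -⟩ := hx x
    obtain ⟨m', hm', hmm', -⟩ := hx m
    have hfour : ∃ r s t, r ≠ v ∧ s ≠ v ∧ t ≠ v ∧ r ≠ s ∧ r ≠ t ∧ s ≠ t := by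
      have h1 := h.xy
      have h2 := h.xz
      have h3 := h.yz
      have h5 : m ≠ x := fun e => h.xY (e ▸ hm)
      have h6 : m ≠ y := fun e => h.yY (e ▸ hm)
      have h7 : m ≠ z := fun e => h.zY (e ▸ hm)
      by_cases hvx : v = x
      · exact ⟨y, z, m, by grind⟩
      by_cases hvy : v = y
      · exact ⟨x, z, m, by grind⟩
      by_cases hvz : v = z
      · exact ⟨x, y, m, by grind⟩
      exact ⟨x, y, z, by grind⟩
    obtain ⟨r, s, t, hr, hs', ht, hrs, hrt, hst⟩ := hfour
    have third : ∀ p p', ∃ m, H.Adj v m ∧ m ≠ p ∧ m ≠ p' := by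
      intro p p'
      obtain ⟨u, rfl, m, -, hum, h1, h2⟩ := h3.exists_third (K := {v}) ⟨v, rfl⟩ (by simpa using hr)
        (by simpa using hs') (by simpa using ht) hrs hrt hst p p'
      exact ⟨m, hum, h1, h2⟩
    have hv' : ∀ m, H.Adj v m → m = a ∨ m = b ∨ m = c := by
      intro m hvm
      by_contra hm
      push Not at hm
      exact hv m hm.1 hm.2.1 hm.2.2 hvm
    have ha : H.Adj v a ∧ a ≠ b ∧ a ≠ c := by
      obtain ⟨m, hvm, h1, h2⟩ := third b c
      have := hv' m hvm
      grind
    have hb : H.Adj v b ∧ b ≠ c := by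
      obtain ⟨m, hvm, h1, h2⟩ := third a c
      have := hv' m hvm
      grind
    have hc : H.Adj v c := by
      obtain ⟨m, hvm, h1, h2⟩ := third a b
      have := hv' m hvm
      grind
    have hsep := sep_of_nbr (H := H) (K := {v}) ha.2.1 ha.2.2 hb.2 ha.1.ne' hb.1.ne' hc.ne'
      (by rintro _ rfl m - hvm; exact hv' m hvm)
    rcases hs.one hsep with h1 | h1
    · exact hno hsep ⟨v, rfl⟩ h1
    · refine hno hsep.symm ?_ h1
      have hY : ∀ {m}, m ∈ Y → m ≠ x ∧ m ≠ y ∧ m ≠ z := fun hm =>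
        ⟨fun e => h.xY (e ▸ hm), fun e => h.yY (e ▸ hm), fun e => h.zY (e ▸ hm)⟩
      exact exists_ne_four h.xy h.xz h.yz (hY hm) (hY hm') hmm' v a b c
  rcases h.hasF0_or_twoPieces h3 hUne hYne hx hy hz with h' | h' | h' | h'
  · exact hcon h'
  · exact hcon (hasF0_of_maxSmall_twoPieces h3 hs h hmax' hx hz h')
  · exact hcon (hasF0_of_maxSmall_twoPieces h3 hs h.swap hmax' hy hz h')
  · exact hcon (hasF0_of_maxSmall_twoPieces h3 hs h.rotate.rotate.swap hmax' hx hy h')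

end SimpleGraph

/-! ### Dodgson polynomials and left kernels -/

namespace Multigraph

variable {G : Multigraph} {A : Type*} [CommRing A]

/-- The coboundary `ψ(src e) - ψ(tgt e)` of a vertex function. -/
def cobd (G : Multigraph) (ψ : G.V → A) (e : G.E) : A := ψ (G.src e) - ψ (G.tgt e)

/-- The net flow out of the vertex `v`. -/
def netOut (G : Multigraph) (g : G.E → A) (v : G.V) : A :=
  ∑ e, g e * ((if G.src e = v then 1 else 0) - (if G.tgt e = v then 1 else 0))

theorem sum_netOut (g : G.E → A) (C : Set G.V) :
    ∑ v, (if v ∈ C then G.netOut g v else 0) =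
      ∑ e, g e * ((if G.src e ∈ C then 1 else 0) - (if G.tgt e ∈ C then 1 else 0)) := by
  have h : ∀ v, (if v ∈ C then G.netOut g v else 0) = ∑ e, g e *
      ((if G.src e = v then (if v ∈ C then 1 else 0) else 0) -
        (if G.tgt e = v then (if v ∈ C then 1 else 0) else 0)) := by
    intro v
    by_cases hv : v ∈ C <;> simp [hv, netOut]
  simp_rw [h]
  rw [Finset.sum_comm]
  refine Finset.sum_congr rfl fun e _ => ?_
  rw [← Finset.mul_sum, Finset.sum_sub_distrib]
  simp

theorem netOut_eq_zero_of_ne {g : G.E → A} {v₀ : G.V} (h : ∀ v, v ≠ v₀ → G.netOut g v = 0)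
    (v : G.V) : G.netOut g v = 0 := by
  by_cases hv : v = v₀
  · subst hv
    have := sum_netOut g Set.univ
    simp only [Set.mem_univ, if_true, sub_self, mul_zero, Finset.sum_const_zero] at this
    rwa [Finset.sum_eq_single v (fun w _ hw => h w hw) (by simp)] at this
  · exact h v hv

/-- The matrix whose determinant is the Dodgson polynomial, with the edge variables replaced by
elements `y e` of a ring. -/
def kmat (G : Multigraph) (y : G.E → A) (v₀ : G.V) {I J : Set G.E}
    (σ : {e : G.E // e ∉ I} ≃ {e : G.E // e ∉ J}) :
    Matrix ({e : G.E // e ∉ I} ⊕ {v : G.V // v ≠ v₀}) ({e : G.E // e ∉ I} ⊕ {v : G.V // v ≠ v₀}) A :=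
  Matrix.fromBlocks
    (Matrix.of fun e f => if e.1 = (σ f).1 then y e.1 else 0)
    (Matrix.of fun e v =>
      (if G.src e.1 = v.1 then 1 else 0) - (if G.tgt e.1 = v.1 then 1 else 0))
    (Matrix.of fun v f =>
      -((if G.src (σ f).1 = v.1 then 1 else 0) - (if G.tgt (σ f).1 = v.1 then 1 else 0)))
    0

theorem aeval_det_bigMatrix [Algebra ℤ A] (y : G.E → A) (v₀ : G.V) {I J : Set G.E}
    (σ : {e : G.E // e ∉ I} ≃ {e : G.E // e ∉ J}) :
    MvPolynomial.aeval y (Matrix.det (Matrix.of fun r c =>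
        G.bigMatrix v₀ (Sum.map Subtype.val id r) (Sum.map (fun x => (σ x).1) id c))) =
      (G.kmat y v₀ σ).det := by
  rw [AlgHom.map_det]
  congr 1
  ext r c
  rcases r with e | v <;> rcases c with f | w <;>
    simp only [kmat, bigMatrix, incCol, AlgHom.mapMatrix_apply, Matrix.map_apply, Matrix.of_apply,
      Sum.map_inl, Sum.map_inr, id, Matrix.fromBlocks_apply₁₁, Matrix.fromBlocks_apply₁₂,
      Matrix.fromBlocks_apply₂₁, Matrix.fromBlocks_apply₂₂, Matrix.zero_apply, map_neg, map_sub,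
      map_zero, apply_ite (MvPolynomial.aeval y), map_one, MvPolynomial.aeval_X]

/-- The pairs `(g, ψ)` in the left kernel of the matrix defining a Dodgson polynomial. -/
structure IsKer (G : Multigraph) (y : G.E → A) (v₀ : G.V) (I J : Set G.E) (g : G.E → A)
    (ψ : G.V → A) : Prop where
  supp : ∀ e ∈ I, g e = 0
  base : ψ v₀ = 0
  grad : ∀ e, e ∉ J → y e * g e = G.cobd ψ e
  flow : ∀ v, G.netOut g v = 0

theorem sum_ext_ne {ψ : G.V → A} {v₀ : G.V} (h : ψ v₀ = 0) (w : G.V) :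
    ∑ v : {v : G.V // v ≠ v₀}, (if w = v.1 then ψ v.1 else 0) = ψ w := by
  rw [← Finset.sum_subtype (Finset.univ.filter fun v => v ≠ v₀) (by simp)
    (fun v => if w = v then ψ v else 0), Finset.sum_filter, Finset.sum_eq_single w]
  · by_cases hw : w = v₀ <;> simp [hw, h]
  · intro b _ hb
    simp [Ne.symm hb]
  · simp

theorem sum_ext_notMem {I : Set G.E} {g : G.E → A} (h : ∀ e ∈ I, g e = 0) (c : G.E → A) :
    ∑ e : {e : G.E // e ∉ I}, g e.1 * c e.1 = ∑ e, g e * c e := by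
  rw [← Finset.sum_subtype (Finset.univ.filter fun e => e ∉ I) (by simp) (fun e => g e * c e),
    Finset.sum_filter]
  refine Finset.sum_congr rfl fun e _ => ?_
  by_cases he : e ∈ I <;> simp [he, h]

theorem vecMul_kmat_inl (y : G.E → A) {v₀ : G.V} {I J : Set G.E}
    (σ : {e : G.E // e ∉ I} ≃ {e : G.E // e ∉ J}) {g : G.E → A} {ψ : G.V → A}
    (hg : ∀ e ∈ I, g e = 0) (hψ : ψ v₀ = 0) (f : {e : G.E // e ∉ I}) :
    Matrix.vecMul (Sum.elim (fun e : {e : G.E // e ∉ I} => g e.1)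
      fun v : {v : G.V // v ≠ v₀} => ψ v.1) (G.kmat y v₀ σ) (Sum.inl f) =
      y (σ f).1 * g (σ f).1 - G.cobd ψ (σ f).1 := by
  simp only [Matrix.vecMul, dotProduct, Fintype.sum_sum_type, Sum.elim_inl, Sum.elim_inr, kmat,
    Matrix.fromBlocks_apply₁₁, Matrix.fromBlocks_apply₂₁, Matrix.of_apply]
  rw [sum_ext_notMem hg (fun e => if e = (σ f).1 then y e else 0)]
  simp only [mul_ite, mul_zero, Finset.sum_ite_eq', Finset.mem_univ, if_true, mul_neg,
    Finset.sum_neg_distrib, mul_sub, mul_one, Finset.sum_sub_distrib, sum_ext_ne hψ, cobd]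
  ring

theorem vecMul_kmat_inr (y : G.E → A) {v₀ : G.V} {I J : Set G.E}
    (σ : {e : G.E // e ∉ I} ≃ {e : G.E // e ∉ J}) {g : G.E → A} {ψ : G.V → A}
    (hg : ∀ e ∈ I, g e = 0) (v : {v : G.V // v ≠ v₀}) :
    Matrix.vecMul (Sum.elim (fun e : {e : G.E // e ∉ I} => g e.1)
      fun v : {v : G.V // v ≠ v₀} => ψ v.1) (G.kmat y v₀ σ) (Sum.inr v) = G.netOut g v.1 := by
  simp only [Matrix.vecMul, dotProduct, Fintype.sum_sum_type, Sum.elim_inl, Sum.elim_inr, kmat,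
    Matrix.fromBlocks_apply₁₂, Matrix.fromBlocks_apply₂₂, Matrix.of_apply, Matrix.zero_apply,
    mul_zero, Finset.sum_const_zero, add_zero]
  rw [sum_ext_notMem hg (fun e => (if G.src e = v.1 then 1 else 0) -
    (if G.tgt e = v.1 then 1 else 0))]
  rfl

theorem det_kmat_eq_zero_iff [IsDomain A] (y : G.E → A) (v₀ : G.V) {I J : Set G.E}
    (σ : {e : G.E // e ∉ I} ≃ {e : G.E // e ∉ J}) :
    (G.kmat y v₀ σ).det = 0 ↔ ∃ g ψ, G.IsKer y v₀ I J g ψ ∧ (g ≠ 0 ∨ ψ ≠ 0) := by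
  rw [← Matrix.exists_vecMul_eq_zero_iff]
  constructor
  · rintro ⟨w, hw, h⟩
    let g : G.E → A := fun e => if h : e ∉ I then w (Sum.inl ⟨e, h⟩) else 0
    let ψ : G.V → A := fun v => if h : v ≠ v₀ then w (Sum.inr ⟨v, h⟩) else 0
    have hg : ∀ e ∈ I, g e = 0 := fun e he => by simp [g, he]
    have hψ : ψ v₀ = 0 := by simp [ψ]
    have hwe : w = Sum.elim (fun e : {e : G.E // e ∉ I} => g e.1)
        fun v : {v : G.V // v ≠ v₀} => ψ v.1 := by
      ext (e | v)
      · simp [g, e.2]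
      · simp [ψ, v.2]
    refine ⟨g, ψ, ⟨hg, hψ, ?_, ?_⟩, ?_⟩
    · intro e he
      have h1 := congrFun h (Sum.inl (σ.symm ⟨e, he⟩))
      rw [hwe, vecMul_kmat_inl y σ hg hψ] at h1
      simpa [sub_eq_zero] using h1
    · refine netOut_eq_zero_of_ne (v₀ := v₀) fun v hv => ?_
      have h1 := congrFun h (Sum.inr ⟨v, hv⟩)
      rwa [hwe, vecMul_kmat_inr y σ hg] at h1
    · by_contra hcon
      push Not at hcon
      apply hw
      rw [hwe, hcon.1, hcon.2]
      ext (e | v) <;> rfl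
  · rintro ⟨g, ψ, h, hne⟩
    refine ⟨Sum.elim (fun e : {e : G.E // e ∉ I} => g e.1)
        fun v : {v : G.V // v ≠ v₀} => ψ v.1, ?_, ?_⟩
    · intro h0
      rcases hne with hne | hne
      · apply hne
        ext e
        by_cases he : e ∈ I
        · exact h.supp e he
        · exact congrFun h0 (Sum.inl ⟨e, he⟩)
      · apply hne
        ext v
        by_cases hv : v = v₀
        · rw [hv]
          exact h.base
        · exact congrFun h0 (Sum.inr ⟨v, hv⟩)
    · ext (f | v)
      · rw [vecMul_kmat_inl y σ h.supp h.base, h.grad _ (σ f).2]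
        simp
      · rw [vecMul_kmat_inr y σ h.supp, h.flow]
        rfl

/-- A Dodgson polynomial vanishes if its matrix has a nonzero left kernel. -/
theorem dodgson_eq_zero {v₀ : G.V} {I J K : Set G.E} {g : G.E → MvPolynomial G.E ℤ}
    {ψ : G.V → MvPolynomial G.E ℤ}
    (h : G.IsKer (fun e => if e ∈ K then 0 else MvPolynomial.X e) v₀ I J g ψ)
    (hne : g ≠ 0 ∨ ψ ≠ 0) : G.dodgson v₀ I J K = 0 := by
  unfold dodgson
  split_ifs with hσ
  · rw [aeval_det_bigMatrix, det_kmat_eq_zero_iff]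
    exact ⟨g, ψ, h, hne⟩
  · rfl

/-- A Dodgson polynomial does not vanish if some specialization of its matrix has trivial left
kernel. -/
theorem dodgson_ne_zero {v₀ : G.V} {I J K : Set G.E} (hIJ : I.ncard = J.ncard) (y : G.E → ℤ)
    (hy : ∀ e ∈ K, y e = 0) (h : ∀ g ψ, G.IsKer y v₀ I J g ψ → g = 0 ∧ ψ = 0) :
    G.dodgson v₀ I J K ≠ 0 := by
  have hσ : Nonempty ({e : G.E // e ∉ I} ≃ {e : G.E // e ∉ J}) := by
    have : (Iᶜ : Set G.E).ncard = (Jᶜ : Set G.E).ncard := by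
      rw [Set.ncard_compl, Set.ncard_compl, hIJ]
    rw [← Nat.card_coe_set_eq, ← Nat.card_coe_set_eq] at this
    exact Finite.card_eq.1 this
  intro h0
  unfold dodgson at h0
  rw [dif_pos hσ] at h0
  have h1 := congrArg (MvPolynomial.aeval y) h0
  rw [map_zero] at h1
  have hcomp : (MvPolynomial.aeval y).comp (MvPolynomial.aeval
      (fun e => if e ∈ K then (0 : MvPolynomial G.E ℤ) else MvPolynomial.X e)) =
      MvPolynomial.aeval y := by
    apply MvPolynomial.algHom_ext
    intro e
    by_cases he : e ∈ K <;> simp [he, hy]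
  have h2 := DFunLike.congr_fun hcomp (Matrix.det (Matrix.of fun r c =>
        G.bigMatrix v₀ (Sum.map Subtype.val id r) (Sum.map (fun x => (hσ.some x).1) id c)))
  rw [AlgHom.comp_apply] at h2
  rw [h2, aeval_det_bigMatrix, det_kmat_eq_zero_iff] at h1
  obtain ⟨g, ψ, hk, hne⟩ := h1
  have := h g ψ hk
  tauto

end Multigraph

/-! ### Criteria for the vanishing of Dodgson polynomials -/

namespace Multigraph

variable {G : Multigraph} {A : Type*} [CommRing A]

theorem netOut_eq_zero_of_forall_ends {g : G.E → A} {v : G.V}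
    (h : ∀ e, g e ≠ 0 → G.src e ≠ v ∧ G.tgt e ≠ v) : G.netOut g v = 0 := by
  refine Finset.sum_eq_zero fun e _ => ?_
  by_cases he : g e = 0
  · simp [he]
  · simp [h e he]

/-- More unknowns than equations: there is a nonzero pair `(g, ψ)` with `g` supported on `R`
and `ψ` supported on `U` satisfying all the constraints needed for a left kernel vector. -/
theorem exists_supported_ker [Nontrivial A] (y : G.E → A) (R L : Set G.E) (U X : Set G.V)
    (hX : X.Nonempty) (hends : ∀ e ∈ R, G.src e ∈ U ∪ X ∧ G.tgt e ∈ U ∪ X)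
    (hcard : X.ncard ≤ (R ∩ L).ncard) :
    ∃ (g : G.E → A) (ψ : G.V → A), (g ≠ 0 ∨ ψ ≠ 0) ∧ (∀ e, e ∉ R → g e = 0) ∧
      (∀ v, v ∉ U → ψ v = 0) ∧ (∀ e ∈ R, e ∉ L → y e * g e = G.cobd ψ e) ∧
      ∀ v, G.netOut g v = 0 := by
  obtain ⟨x, hx⟩ := hX
  let gx : (R ⊕ U → A) →ₗ[A] (G.E → A) :=
    LinearMap.pi fun e => if h : e ∈ R then LinearMap.proj (Sum.inl ⟨e, h⟩) else 0
  let px : (R ⊕ U → A) →ₗ[A] (G.V → A) :=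
    LinearMap.pi fun v => if h : v ∈ U then LinearMap.proj (Sum.inr ⟨v, h⟩) else 0
  let F : (R ⊕ U → A) →ₗ[A] (((R \ L : Set G.E) ⊕ (U ∪ X \ {x} : Set G.V)) → A) :=
    LinearMap.pi (Sum.elim
      (fun e => y e.1 • (LinearMap.proj e.1).comp gx -
        ((LinearMap.proj (G.src e.1)).comp px - (LinearMap.proj (G.tgt e.1)).comp px))
      (fun v => ∑ e, ((if G.src e = v.1 then (1 : A) else 0) - (if G.tgt e = v.1 then 1 else 0)) •
        (LinearMap.proj e).comp gx))
  have hnot : ¬ Function.Injective F := by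
    intro hinj
    have h1 := card_le_of_injective A F hinj
    rw [← Nat.card_eq_fintype_card, ← Nat.card_eq_fintype_card, Nat.card_sum, Nat.card_sum] at h1
    simp only [Nat.card_coe_set_eq] at h1
    have h2 : (R ∩ L).ncard + (R \ L).ncard = R.ncard := Set.ncard_inter_add_ncard_sdiff_eq_ncard R L
    have h3 : (U ∪ X \ {x}).ncard ≤ U.ncard + (X \ {x}).ncard := Set.ncard_union_le _ _
    have h4 : (X \ {x}).ncard + 1 = X.ncard := Set.ncard_sdiff_singleton_add_one hx
    omega
  rw [← LinearMap.ker_eq_bot, LinearMap.ker_eq_bot'] at hnot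
  push Not at hnot
  obtain ⟨w, hw, hw0⟩ := hnot
  have hgx : ∀ e (h : e ∈ R), gx w e = w (Sum.inl ⟨e, h⟩) := fun e h => by
    simp [gx, LinearMap.pi_apply, h]
  have hgx0 : ∀ e, e ∉ R → gx w e = 0 := fun e h => by simp [gx, LinearMap.pi_apply, h]
  have hpx : ∀ v (h : v ∈ U), px w v = w (Sum.inr ⟨v, h⟩) := fun v h => by
    simp [px, LinearMap.pi_apply, h]
  have hpx0 : ∀ v, v ∉ U → px w v = 0 := fun v h => by simp [px, LinearMap.pi_apply, h]
  refine ⟨gx w, px w, ?_, hgx0, hpx0, ?_, ?_⟩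
  · by_contra hcon
    push Not at hcon
    apply hw0
    ext (e | v)
    · rw [← hgx e.1 e.2, hcon.1]
      rfl
    · rw [← hpx v.1 v.2, hcon.2]
      rfl
  · intro e heR heL
    have h1 := congrFun hw (Sum.inl ⟨e, heR, heL⟩)
    simpa [F, sub_eq_zero, cobd] using h1
  · refine netOut_eq_zero_of_ne (v₀ := x) fun v hv => ?_
    by_cases hvU : v ∈ U ∪ X \ {x}
    · have h1 := congrFun hw (Sum.inr ⟨v, hvU⟩)
      simp only [F, LinearMap.pi_apply, Sum.elim_inr, LinearMap.sum_apply, LinearMap.smul_apply,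
        LinearMap.comp_apply, LinearMap.proj_apply, smul_eq_mul, Pi.zero_apply] at h1
      rw [← h1, netOut]
      exact Finset.sum_congr rfl fun e _ => mul_comm _ _
    · refine netOut_eq_zero_of_forall_ends fun e he => ?_
      have heR : e ∈ R := by
        by_contra h
        exact he (hgx0 e h)
      have := hends e heR
      constructor
      · rintro rfl
        exact hvU (this.1.imp id fun h => ⟨h, hv⟩)
      · rintro rfl
        exact hvU (this.2.imp id fun h => ⟨h, hv⟩)

/-- A separation with few attachment vertices makes a Dodgson polynomial vanish. -/
theorem dodgson_eq_zero_of_sep (v₀ : G.V) {I J K R : Set G.E} {U X : Set G.V}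
    (hUX : Disjoint U X) (hX : X.Nonempty) (hRI : Disjoint R I)
    (hends : ∀ e ∈ R, G.src e ∈ U ∪ X ∧ G.tgt e ∈ U ∪ X)
    (htouch : ∀ e, e ∉ J → (G.src e ∈ U ∨ G.tgt e ∈ U) → e ∈ R ∧ e ∉ K)
    (hcard : X.ncard ≤ (R ∩ (J ∪ K)).ncard) : G.dodgson v₀ I J K = 0 := by
  obtain ⟨g, ψ, hne, hg, hψ, hgrad, hflow⟩ := exists_supported_ker
    (fun e => if e ∈ K then (0 : MvPolynomial G.E ℤ) else MvPolynomial.X e) R (J ∪ K) U X hX hends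
    hcard
  have hcobd : ∀ e, G.cobd (fun v => ψ v - ψ v₀) e = G.cobd ψ e := fun e => by
    simp [cobd]
  refine dodgson_eq_zero (g := g) (ψ := fun v => ψ v - ψ v₀) ⟨?_, sub_self _, ?_, hflow⟩ ?_
  · intro e he
    exact hg e fun h => Set.disjoint_left.1 hRI h he
  · intro e heJ
    rw [hcobd]
    by_cases ht : G.src e ∈ U ∨ G.tgt e ∈ U
    · obtain ⟨h1, h2⟩ := htouch e heJ ht
      exact hgrad e h1 (by simp [heJ, h2])
    · push Not at ht
      have h0 : G.cobd ψ e = 0 := by simp [cobd, hψ _ ht.1, hψ _ ht.2]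
      rw [h0]
      by_cases heK : e ∈ K
      · simp [heK]
      · by_cases heR : e ∈ R
        · rw [hgrad e heR (by simp [heJ, heK]), h0]
        · rw [hg e heR, mul_zero]
  · refine hne.imp id fun h h0 => h ?_
    obtain ⟨x, hx⟩ := hX
    have h1 : ∀ v, ψ v = ψ v₀ := fun v => sub_eq_zero.1 (congrFun h0 v)
    have h2 : ψ x = 0 := hψ x fun hU => Set.disjoint_left.1 hUX hU hx
    ext1 v
    rw [h1 v, ← h1 x, h2]
    rfl

/-- A connected and a flow-free edge set certify that a Dodgson polynomial does not vanish. -/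
theorem dodgson_ne_zero_of_tree {v₀ : G.V} {I J K : Set G.E} (hIJ : I.ncard = J.ncard)
    (T : Set G.E) (hTJ : Disjoint T J) (hK : K ⊆ T)
    (hconn : ∀ C : Set G.V, C.Nonempty → (∀ e ∈ T ∪ I \ J, G.src e ∈ C ↔ G.tgt e ∈ C) →
      ∀ v, v ∈ C)
    (hflow : ∀ g : G.E → ℤ, (∀ e, e ∉ T ∪ J \ I → g e = 0) → (∀ v, G.netOut g v = 0) →
      ∀ e, g e = 0) : G.dodgson v₀ I J K ≠ 0 := by
  refine dodgson_ne_zero hIJ (fun e => if e ∈ T then 0 else 1) (fun e he => by simp [hK he]) ?_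
  intro g ψ h
  have hψ : ∀ v, v ∈ {v | ψ v = 0} := by
    refine hconn _ ⟨v₀, h.base⟩ ?_
    intro e he
    have h1 : G.cobd ψ e = 0 := by
      rcases he with he | he
      · rw [← h.grad e fun hJ => Set.disjoint_left.1 hTJ he hJ]
        simp [he]
      · rw [← h.grad e he.2, h.supp e he.1, mul_zero]
    rw [cobd, sub_eq_zero] at h1
    rw [Set.mem_ofPred_eq, Set.mem_ofPred_eq, h1]
  have hψ0 : ∀ v, ψ v = 0 := hψ
  refine ⟨funext (hflow g ?_ h.flow), funext hψ0⟩
  intro e he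
  simp only [Set.mem_union, Set.mem_sdiff, not_or, not_and, not_not] at he
  by_cases heJ : e ∈ J
  · exact h.supp e (he.2 heJ)
  · have := h.grad e heJ
    simpa [he.1, cobd, hψ0] using this

/-- A flow vanishes on an edge that is the only edge of its support across a cut. -/
theorem flow_eq_zero_of_cut {g : G.E → ℤ} (hflow : ∀ v, G.netOut g v = 0) {e : G.E} (C : Set G.V)
    (he : ¬ (G.src e ∈ C ↔ G.tgt e ∈ C))
    (hother : ∀ f, f ≠ e → g f ≠ 0 → (G.src f ∈ C ↔ G.tgt f ∈ C)) : g e = 0 := by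
  have h1 := sum_netOut g C
  simp only [hflow, ite_self, Finset.sum_const_zero] at h1
  rw [Finset.sum_eq_single e] at h1
  · by_cases h2 : G.src e ∈ C <;> by_cases h3 : G.tgt e ∈ C <;>
      simp only [h2, h3, not_true, iff_self, iff_true, iff_false, if_true, if_false] at he h1 <;>
      omega
  · intro f _ hf
    by_cases h2 : g f = 0
    · simp [h2]
    · simp [hother f hf h2]
  · simp

end Multigraph

/-! ### Small sides of separations with respect to a non-split configuration -/

namespace Multigraph

variable {G : Multigraph}

/-- The simple graph underlying a multigraph. -/
def skel (G : Multigraph) : SimpleGraph G.V where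
  Adj a b := a ≠ b ∧ G.Adj a b
  symm := ⟨fun _ _ ⟨hne, e, he, h⟩ => ⟨hne.symm, e, he, h.symm⟩⟩
  loopless := ⟨fun _ h => h.1 rfl⟩

/-- The edges with at least one end in `A`. -/
def touching (G : Multigraph) (A : Set G.V) : Set G.E := {e | G.src e ∈ A ∨ G.tgt e ∈ A}

theorem mem_touching {A : Set G.V} {e : G.E} :
    e ∈ G.touching A ↔ G.src e ∈ A ∨ G.tgt e ∈ A := Iff.rfl

theorem skel_adj_of_ne {e : G.E} (h : G.src e ≠ G.tgt e) : G.skel.Adj (G.src e) (G.tgt e) :=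
  ⟨h, e, trivial, Or.inl ⟨rfl, rfl⟩⟩

theorem _root_.SimpleGraph.Sep.disjoint_touching {A B : Set G.V} {a b c : G.V}
    (h : G.skel.Sep A B a b c) : Disjoint (G.touching A) (G.touching B) := by
  rw [Set.disjoint_left]
  have h1 : ∀ {v}, v ∈ A → v ∈ B → False := fun ha hb => Set.disjoint_left.1 h.disj ha hb
  rintro e (hA | hA) (hB | hB)
  · exact h1 hA hB
  · exact h.sep ⟨_, hA, _, hB, skel_adj_of_ne fun e => h1 hA (e ▸ hB)⟩
  · exact h.sep ⟨_, hA, _, hB, (skel_adj_of_ne fun e => h1 hA (e ▸ hB)).symm⟩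
  · exact h1 hA hB

theorem _root_.SimpleGraph.Sep.configSplits {A B : Set G.V} {a b c : G.V}
    (h : G.skel.Sep A B a b c) {S : Set G.E} (hS : S.ncard = 5)
    (hA : (S ∩ G.touching A).ncard ≤ 2) (hB : (S ∩ G.touching B).ncard ≤ 2) :
    G.ConfigSplits S := by
  have hd := h.disjoint_touching
  obtain ⟨k, hkS, hk⟩ : ∃ k ∈ S, k ∉ S ∩ G.touching A ∪ S ∩ G.touching B := by
    by_contra hcon
    push Not at hcon
    have h1 := Set.ncard_le_ncard (show S ⊆ _ from hcon)
    have h2 := Set.ncard_union_le (S ∩ G.touching A) (S ∩ G.touching B)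
    omega
  have hkA : k ∉ G.touching A := fun h => hk (Or.inl ⟨hkS, h⟩)
  have hkB : k ∉ G.touching B := fun h => hk (Or.inr ⟨hkS, h⟩)
  obtain ⟨I, hAI, hI, hIc⟩ := Set.exists_subsuperset_card_eq
    (s := S ∩ G.touching A) (t := (S \ {k}) \ (S ∩ G.touching B)) (n := 2) (by
      rintro e ⟨heS, heA⟩
      refine ⟨⟨heS, ?_⟩, fun he => Set.disjoint_left.1 hd heA he.2⟩
      rintro rfl
      exact hkA heA) hA (by
      have h1 := Set.ncard_sdiff_singleton_add_one hkS
      have h2 := Set.le_ncard_sdiff (S ∩ G.touching B) (S \ {k})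
      omega)
  have hIS : I ⊆ S := fun e he => (hI he).1.1
  have hkI : k ∉ I := fun he => (hI he).1.2 rfl
  have hJc : ((S \ I) \ {k}).ncard = 2 := by
    have h1 := Set.ncard_sdiff_singleton_add_one (show k ∈ S \ I from ⟨hkS, hkI⟩)
    have h2 := Set.ncard_sdiff_add_ncard_of_subset hIS
    omega
  refine ⟨I, (S \ I) \ {k}, {k}, ⟨?_, Or.inl ⟨hIc, hJc, Set.ncard_singleton k, ?_, ?_, ?_⟩⟩, ?_⟩
  · ext e
    simp only [Set.mem_union, Set.mem_sdiff, Set.mem_singleton_iff]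
    constructor
    · rintro ((he | he) | rfl)
      · exact hIS he
      · exact he.1.1
      · exact hkS
    · tauto
  · ext e
    simp only [Set.mem_inter_iff, Set.mem_sdiff, Set.mem_empty_iff_false]
    tauto
  · ext e
    simp only [Set.mem_inter_iff, Set.mem_singleton_iff, Set.mem_empty_iff_false, iff_false]
    rintro ⟨h1, rfl⟩
    exact hkI h1
  · ext e
    simp only [Set.mem_inter_iff, Set.mem_sdiff, Set.mem_singleton_iff, Set.mem_empty_iff_false]
    tauto
  · intro v₀
    refine dodgson_eq_zero_of_sep v₀ (R := {e | e ∉ I ∧ e ∉ G.touching A}) (U := B)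
      (X := {a, b, c}) ?_ ⟨a, by simp⟩ ?_ ?_ ?_ ?_
    · rw [Set.disjoint_left]
      rintro v hv (rfl | rfl | rfl)
      · exact h.xY hv
      · exact h.yY hv
      · exact h.zY hv
    · rw [Set.disjoint_left]
      exact fun e he => he.1
    · rintro e ⟨-, he⟩
      rw [mem_touching, not_or] at he
      have h1 := h.cover (G.src e)
      have h2 := h.cover (G.tgt e)
      simp only [Set.mem_union, Set.mem_insert_iff, Set.mem_singleton_iff]
      tauto
    · intro e heJ heB
      refine ⟨⟨fun heI => (hI heI).2 ⟨hIS heI, heB⟩, fun heA => Set.disjoint_left.1 hd heA heB⟩, ?_⟩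
      rintro rfl
      exact hkB heB
    · have h1 : (S \ I) \ {k} ∪ {k} ⊆ {e | e ∉ I ∧ e ∉ G.touching A} ∩ ((S \ I) \ {k} ∪ {k}) := by
        intro e he
        refine ⟨?_, he⟩
        rcases he with he | rfl
        · exact ⟨he.1.2, fun heA => he.1.2 (hAI ⟨he.1.1, heA⟩)⟩
        · exact ⟨hkI, hkA⟩
      refine le_trans ?_ (Set.ncard_le_ncard h1)
      rw [Set.ncard_union_eq (by simp), hJc, Set.ncard_singleton]
      have h2 := Set.ncard_insert_le a {b, c}
      have h3 := Set.ncard_insert_le b {c}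
      rw [Set.ncard_singleton] at h3
      omega

theorem _root_.SimpleGraph.Sep.configSplits_of_unique_nbr (hs : G.Simple) {A B : Set G.V}
    {x b c w : G.V} (h : G.skel.Sep A B x b c) (hw : w ∈ B) (hxw : G.skel.Adj x w)
    (hu : ∀ n ∈ B, n ≠ w → ¬ G.skel.Adj x n) {S : Set G.E} (hS : S.ncard = 5)
    (hA : 3 ≤ (S ∩ G.touching (insert x A)).ncard) (hB : 3 ≤ (S ∩ G.touching B).ncard) :
    G.ConfigSplits S := by
  obtain ⟨-, k, -, hk⟩ := hxw
  have hkends : G.ends k = s(x, w) := by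
    rcases hk with ⟨h1, h2⟩ | ⟨h1, h2⟩
    · rw [ends, h1, h2]
    · rw [ends, h1, h2, Sym2.eq_swap]
  have hkA : k ∈ G.touching (insert x A) := by
    rcases hk with ⟨h1, h2⟩ | ⟨h1, h2⟩
    · exact Or.inl (h1 ▸ Set.mem_insert _ _)
    · exact Or.inr (h2 ▸ Set.mem_insert _ _)
  have hkB : k ∈ G.touching B := by
    rcases hk with ⟨h1, h2⟩ | ⟨h1, h2⟩
    · exact Or.inr (h2 ▸ hw)
    · exact Or.inl (h1 ▸ hw)
  have hdisj : ∀ {v}, v ∈ insert x A → v ∈ B → False := by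
    rintro v (rfl | hv) hvB
    · exact h.xY hvB
    · exact Set.disjoint_left.1 h.disj hv hvB
  have honly : ∀ {u v}, u ∈ insert x A → v ∈ B → G.skel.Adj u v → u = x ∧ v = w := by
    rintro u v (rfl | hv) hvB huv
    · refine ⟨rfl, ?_⟩
      by_contra hne
      exact hu v hvB hne huv
    · exact absurd ⟨u, hv, v, hvB, huv⟩ h.sep
  have huniq : ∀ e, e ∈ G.touching (insert x A) → e ∈ G.touching B → e = k := by
    intro e heA heB
    apply hs.2
    rw [hkends]
    have hadj := skel_adj_of_ne (hs.1 e)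
    rcases heA with heA | heA <;> rcases heB with heB | heB
    · exact (hdisj heA heB).elim
    · obtain ⟨h1, h2⟩ := honly heA heB hadj
      rw [ends, h1, h2]
    · obtain ⟨h1, h2⟩ := honly heA heB hadj.symm
      rw [ends, h1, h2, Sym2.eq_swap]
    · exact (hdisj heA heB).elim
  set I := S ∩ G.touching (insert x A) with hI
  set J := S ∩ G.touching B with hJ
  have hIJ : I ∩ J ⊆ {k} := fun e he => huniq e he.1.2 he.2.2
  have hsub : I ∪ J ⊆ S := Set.union_subset Set.inter_subset_left Set.inter_subset_left
  have hc1 := Set.ncard_union_add_ncard_inter I J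
  have hc2 := Set.ncard_le_ncard hsub
  have hc3 := Set.ncard_le_ncard hIJ
  rw [Set.ncard_singleton] at hc3
  have hIJS : I ∪ J = S := Set.eq_of_subset_of_ncard_le hsub (by omega)
  refine ⟨I, J, ∅, ⟨by rw [Set.union_empty, hIJS], Or.inr ⟨?_, ?_, rfl, ?_⟩⟩, fun v₀ => ?_⟩
  · omega
  · omega
  · omega
  refine dodgson_eq_zero_of_sep v₀ (R := {e | e ∉ I ∧ e ∉ G.touching (insert x A)}) (U := B)
    (X := {b, c}) ?_ ⟨b, by simp⟩ ?_ ?_ ?_ ?_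
  · rw [Set.disjoint_left]
    rintro v hv (rfl | rfl)
    · exact h.yY hv
    · exact h.zY hv
  · rw [Set.disjoint_left]
    exact fun e he => he.1
  · rintro e ⟨-, he⟩
    rw [mem_touching, not_or, Set.mem_insert_iff, Set.mem_insert_iff] at he
    have h1 := h.cover (G.src e)
    have h2 := h.cover (G.tgt e)
    simp only [Set.mem_union, Set.mem_insert_iff, Set.mem_singleton_iff]
    tauto
  · intro e heJ heB
    have heA : e ∉ G.touching (insert x A) := by
      intro heA
      have hek := huniq e heA heB
      have hkIJ : k ∈ I ∩ J := by
        have hne : (I ∩ J).Nonempty := by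
          rw [← Set.ncard_pos]
          omega
        obtain ⟨f, hf⟩ := hne
        rwa [hIJ hf] at hf
      exact heJ (hek ▸ hkIJ.2)
    exact ⟨⟨fun heI => heA heI.2, heA⟩, Set.notMem_empty e⟩
  · have h1 : J \ {k} ⊆ {e | e ∉ I ∧ e ∉ G.touching (insert x A)} ∩ (J ∪ ∅) := by
      intro e he
      have heA : e ∉ G.touching (insert x A) := fun heA => he.2 (huniq e heA he.1.2)
      exact ⟨⟨fun heI => heA heI.2, heA⟩, Or.inl he.1⟩
    have h2 := Set.ncard_le_ncard h1
    have h3 := Set.pred_ncard_le_ncard_sdiff_singleton J k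
    have h4 := Set.ncard_insert_le b {c}
    rw [Set.ncard_singleton] at h4
    omega

/-- For a non-split configuration `S`, call a vertex set small if it meets at most two edges
of `S`. -/
theorem smallness_of_not_configSplits (hs : G.Simple) {S : Set G.E} (hS : S.ncard = 5)
    (hns : ¬ G.ConfigSplits S) :
    G.skel.Smallness fun A => (S ∩ G.touching A).ncard ≤ 2 where
  empty := by simp [touching]
  not_both h hA hB := hns (h.configSplits hS hA hB)
  one {A B a b c} h := by
    by_contra hcon
    push Not at hcon
    have h1 : Disjoint (S ∩ G.touching A) (S ∩ G.touching B) :=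
      h.disjoint_touching.mono Set.inter_subset_right Set.inter_subset_right
    have h2 := Set.ncard_union_eq h1
    have h3 := Set.ncard_le_ncard (Set.union_subset
      (Set.inter_subset_left : S ∩ G.touching A ⊆ S) (Set.inter_subset_left : S ∩ G.touching B ⊆ S))
    omega
  insert {A B x b c w} h hw hxw hu hA := by
    by_contra hcon
    push Not at hcon
    refine hns (h.configSplits_of_unique_nbr hs hw hxw hu hS hcon ?_)
    by_contra hB
    exact hns (h.configSplits hS hA (by omega))

end Multigraph

/-! ### Minors and models -/

namespace Multigraph

variable {G : Multigraph}

theorem skel_cn_iff {U : Set G.V} : G.skel.Cn U ↔ G.ConnectedWithin U := by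
  constructor
  · rintro ⟨hne, h⟩
    refine ⟨hne, fun a ha b hb => ?_⟩
    by_contra hcon
    obtain ⟨u, ⟨hu, hau⟩, v, hv, hvW, huv⟩ := h
      {w | w ∈ U ∧ Relation.ReflTransGen (G.stepWithin U) a w} (fun w hw => hw.1)
      ⟨a, ha, Relation.ReflTransGen.refl⟩ ⟨b, hb, fun h => hcon h.2⟩
    exact hvW ⟨hv, hau.tail ⟨hu, hv, huv.2⟩⟩
  · rintro ⟨hne, h⟩
    refine ⟨hne, ?_⟩
    rintro W hWU ⟨a, ha⟩ ⟨b, hb, hbW⟩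
    by_contra hcon
    push Not at hcon
    refine hbW ?_
    have : ∀ w, Relation.ReflTransGen (G.stepWithin U) a w → w ∈ W := by
      intro w hw
      induction hw with
      | refl => exact ha
      | @tail x y _ hxy ih =>
        by_contra hy
        refine hcon x ih y hxy.2.1 hy ⟨?_, hxy.2.2⟩
        rintro rfl
        exact hy ih
    exact this b (h a (hWU ha) b hb)

theorem skel_thr (h3 : G.ThreeConnected) : G.skel.Thr := by
  intro K a b hK hN v
  have hcn : G.skel.Cn ({a, b} \ K : Set G.V)ᶜ := by
    rw [skel_cn_iff]
    refine h3.2 _ ?_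
    have h0 := Set.ncard_le_ncard (Set.sdiff_subset : ({a, b} : Set G.V) \ K ⊆ {a, b})
    have h1 := Set.ncard_insert_le a {b}
    rw [Set.ncard_singleton] at h1
    omega
  have h1 := hcn.eq_of_closed hK (fun u hu h => h.2 hu) fun u hu w hw huw => by
    by_contra hwK
    exact hw ⟨hN u hu w hwK huw, hwK⟩
  by_cases hv : v ∈ ({a, b} : Set G.V) \ K
  · exact Or.inr hv.1
  · exact Or.inl (h1 ▸ hv)

theorem touch_iff_crossEdges {A B : Set G.V} (hAB : Disjoint A B) :
    G.skel.Touch A B ↔ (G.crossEdges A B).Nonempty := by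
  constructor
  · rintro ⟨a, ha, b, hb, -, e, -, h | h⟩
    · exact ⟨e, Or.inl ⟨h.1 ▸ ha, h.2 ▸ hb⟩⟩
    · exact ⟨e, Or.inr ⟨h.1 ▸ hb, h.2 ▸ ha⟩⟩
  · rintro ⟨e, ⟨h1, h2⟩ | ⟨h1, h2⟩⟩
    · exact ⟨_, h1, _, h2, skel_adj_of_ne (hAB.ne_of_mem h1 h2)⟩
    · exact ⟨_, h2, _, h1, (skel_adj_of_ne (hAB.ne_of_mem h2 h1).symm).symm⟩

theorem hasMinor_of_model {n : ℕ} {L : List (Fin n × Fin n)} (h : G.skel.Model n L)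
    {R : Multigraph} (hR : Function.Injective R.ends) (φ : R.V → Fin n)
    (hφ : Function.Injective φ)
    (hL : ∀ f : R.E, (φ (R.src f), φ (R.tgt f)) ∈ L ∨ (φ (R.tgt f), φ (R.src f)) ∈ L) :
    G.HasMinor R := by
  obtain ⟨X, hc, hd, ht⟩ := h
  refine ⟨fun v => X (φ v), fun v => skel_cn_iff.1 (hc _), fun v w hvw => hd (hφ.ne hvw), ?_⟩
  intro v w hvw
  have h1 : ({f : R.E | R.ends f = s(v, w)}).ncard ≤ 1 := by
    rw [Set.ncard_le_one]
    intro e he f hf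
    exact hR (he.trans hf.symm)
  rcases Set.eq_empty_or_nonempty {f : R.E | R.ends f = s(v, w)} with h0 | ⟨f, hf⟩
  · simp [h0]
  · refine h1.trans ?_
    rw [Nat.succ_le_iff, Set.ncard_pos, ← touch_iff_crossEdges (hd (hφ.ne hvw))]
    have hf' : s(R.src f, R.tgt f) = s(v, w) := hf
    rw [Sym2.eq_iff] at hf'
    have h2 := hL f
    rcases hf' with ⟨h3, h4⟩ | ⟨h3, h4⟩ <;> rw [h3, h4] at h2 <;> rcases h2 with h2 | h2
    · exact ht _ h2
    · exact (ht _ h2).symm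
    · exact (ht _ h2).symm
    · exact ht _ h2

theorem model_of_hasMinor {R : Multigraph} (h : G.HasMinor R) {n : ℕ} {L : List (Fin n × Fin n)}
    (ψ : Fin n → R.V) (hψ : Function.Injective ψ)
    (hL : ∀ p ∈ L, p.1 ≠ p.2 ∧ ∃ f, R.ends f = s(ψ p.1, ψ p.2)) : G.skel.Model n L := by
  obtain ⟨X, hc, hd, ht⟩ := h
  refine ⟨fun i => X (ψ i), fun i => skel_cn_iff.2 (hc _), fun i j hij => hd (hψ.ne hij), ?_⟩
  intro p hp
  obtain ⟨hne, f, hf⟩ := hL p hp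
  rw [touch_iff_crossEdges (hd (hψ.ne hne)), ← Set.ncard_pos]
  refine lt_of_lt_of_le ?_ (ht _ _ (hψ.ne hne))
  rw [Set.ncard_pos]
  exact ⟨f, hf⟩

theorem hasMinor_of_hasF0 (h : G.skel.HasF0) :
    G.HasMinor K33m ∨ G.HasMinor K5m ∨ G.HasMinor cubeM ∨ G.HasMinor Hm ∨ G.HasMinor octaM := by
  rcases h with h | h | h | h | h
  · refine Or.inl (hasMinor_of_model h ?_ (Sum.elim (![0, 1, 2]) (![3, 4, 5])) ?_ ?_)
    · unfold Function.Injective ends K33m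
      decide
    · unfold Function.Injective K33m
      decide
    · unfold K33m
      decide
  · refine Or.inr (Or.inl (hasMinor_of_model h ?_ (id : Fin 5 → Fin 5) ?_ ?_))
    · unfold Function.Injective ends K5m
      decide
    · exact Function.injective_id
    · unfold K5m
      decide
  · refine Or.inr (Or.inr (Or.inl (hasMinor_of_model h ?_
      (fun v : Fin 2 × Fin 2 × Fin 2 => (![![![0, 4], ![2, 6]], ![![1, 5], ![3, 7]]] v.1 v.2.1 v.2.2))
        ?_ ?_)))
    · unfold Function.Injective ends cubeM
      decide
    · unfold Function.Injective cubeM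
      decide
    · unfold cubeM
      decide
  · refine Or.inr (Or.inr (Or.inr (Or.inl (hasMinor_of_model h ?_ (id : Fin 7 → Fin 7) ?_ ?_))))
    · unfold Function.Injective ends Hm
      decide
    · exact Function.injective_id
    · unfold Hm
      decide
  · refine Or.inr (Or.inr (Or.inr (Or.inr (hasMinor_of_model h ?_
      (fun v : Fin 3 × Fin 2 => (![![0, 1], ![2, 3], ![4, 5]] v.1 v.2)) ?_ ?_))))
    · unfold Function.Injective ends octaM
      decide
    · unfold Function.Injective octaM
      decide
    · unfold octaM
      decide

end Multigraph

namespace Multigraph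

variable {G : Multigraph}

theorem hasF0_of_hasMinor (h : G.HasMinor K33m ∨ G.HasMinor K5m ∨ G.HasMinor cubeM ∨
    G.HasMinor Hm ∨ G.HasMinor octaM) : G.skel.HasF0 := by
  rcases h with h | h | h | h | h
  · refine Or.inl (model_of_hasMinor h
      (![Sum.inl 0, Sum.inl 1, Sum.inl 2, Sum.inr 0, Sum.inr 1, Sum.inr 2] :
        Fin 6 → Fin 3 ⊕ Fin 3) ?_ ?_)
    · unfold Function.Injective K33m
      decide
    · unfold ends K33m
      decide
  · refine Or.inr (Or.inl (model_of_hasMinor h (id : Fin 5 → Fin 5) Function.injective_id ?_))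
    unfold ends K5m
    decide
  · refine Or.inr (Or.inr (Or.inl (model_of_hasMinor h
      (![(0, 0, 0), (1, 0, 0), (0, 1, 0), (1, 1, 0), (0, 0, 1), (1, 0, 1), (0, 1, 1), (1, 1, 1)] :
        Fin 8 → Fin 2 × Fin 2 × Fin 2) ?_ ?_)))
    · unfold Function.Injective cubeM
      decide
    · unfold ends cubeM
      decide
  · refine Or.inr (Or.inr (Or.inr (Or.inl (model_of_hasMinor h (id : Fin 7 → Fin 7)
      Function.injective_id ?_))))
    unfold ends Hm
    decide
  · refine Or.inr (Or.inr (Or.inr (Or.inr (model_of_hasMinor h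
      (![(0, 0), (0, 1), (1, 0), (1, 1), (2, 0), (2, 1)] : Fin 6 → Fin 3 × Fin 2) ?_ ?_))))
    · unfold Function.Injective octaM
      decide
    · unfold ends octaM
      decide

theorem feynmanSplit_of_not_hasF0 (hs : G.Simple) (h3 : G.ThreeConnected) (h : ¬ G.skel.HasF0) :
    G.FeynmanSplit := by
  intro S hS
  by_contra hns
  obtain ⟨a, b, c, hab, hac, hbc⟩ : ∃ a b c : G.V, a ≠ b ∧ a ≠ c ∧ b ≠ c := by
    have h2 : 2 < Fintype.card G.V := by
      have := h3.1
      omega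
    exact Fintype.two_lt_card_iff.1 h2
  exact h (SimpleGraph.hasF0_of_smallness (skel_thr h3) (smallness_of_not_configSplits hs hS hns)
    hab hac hbc)

end Multigraph

/-! ### Lifting spanning trees of a minor -/

namespace Multigraph

variable {G : Multigraph} {n : ℕ}

/-- The vertices `0, …, n - 1` of a minor, with branch sets the fibres of `r`; the edge set `F`
consists of spanning trees of the branch sets. -/
structure Frame (G : Multigraph) (n : ℕ) (r : G.V → ℕ) (F : Set G.E) : Prop where
  lt : ∀ v, r v < n
  internal : ∀ e ∈ F, r (G.src e) = r (G.tgt e)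
  fibre : ∀ C : Set G.V, (∀ e ∈ F, G.src e ∈ C ↔ G.tgt e ∈ C) → ∀ u v, r u = r v → u ∈ C → v ∈ C
  bridge : ∀ f ∈ F, ∃ C : Set G.V, ¬ (G.src f ∈ C ↔ G.tgt f ∈ C) ∧
    ∀ e ∈ F, e ≠ f → (G.src e ∈ C ↔ G.tgt e ∈ C)

/-- `P ∪ T` connects the vertices `0, …, n - 1` and `Q ∪ T` is a forest. -/
structure Good (n : ℕ) (P Q T : Set (ℕ × ℕ)) : Prop where
  conn : ∀ C : Set ℕ, (∃ i ∈ C, i < n) → (∀ e ∈ P ∪ T, e.1 ∈ C ↔ e.2 ∈ C) → ∀ i < n, i ∈ C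
  bridge : ∀ e ∈ Q ∪ T, ∃ C : Set ℕ, ¬ (e.1 ∈ C ↔ e.2 ∈ C) ∧
    ∀ f ∈ Q ∪ T, f ≠ e → (f.1 ∈ C ↔ f.2 ∈ C)

/-- `γ e` is an edge of `G` over the edge `e` of the minor. -/
def Over (G : Multigraph) (r : G.V → ℕ) (γ : ℕ × ℕ → G.E) (e : ℕ × ℕ) : Prop :=
  e.1 ≠ e.2 ∧ ((r (G.src (γ e)) = e.1 ∧ r (G.tgt (γ e)) = e.2) ∨
    (r (G.src (γ e)) = e.2 ∧ r (G.tgt (γ e)) = e.1))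

theorem Frame.dodgson_ne_zero {r : G.V → ℕ} {F : Set G.E} (hF : G.Frame n r F)
    {γ : ℕ × ℕ → G.E} {M P Q T : Set (ℕ × ℕ)} (hγ : ∀ e ∈ M, G.Over r γ e) (hP : P ⊆ M)
    (hQ : Q ⊆ M) (hT : T ⊆ M) (hgood : Good n P Q T) {I J K : Set G.E}
    (hIJ : I.ncard = J.ncard) (hJ : J ⊆ γ '' M) (hPe : γ '' P ⊆ I \ J) (hQe : J \ I ⊆ γ '' Q)
    (hK : K ⊆ γ '' T) (hTJ : Disjoint (γ '' T) J) (v₀ : G.V) : G.dodgson v₀ I J K ≠ 0 := by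
  have hMF : ∀ e ∈ M, γ e ∉ F := by
    intro e he heF
    have h1 := hF.internal _ heF
    obtain ⟨h2, h3⟩ := hγ e he
    grind
  refine dodgson_ne_zero_of_tree hIJ (γ '' T ∪ F) ?_ (hK.trans Set.subset_union_left) ?_ ?_
  · rw [Set.disjoint_union_left]
    refine ⟨hTJ, Set.disjoint_left.2 fun f hfF hfJ => ?_⟩
    obtain ⟨e, he, rfl⟩ := hJ hfJ
    exact hMF e he hfF
  · rintro C ⟨u, hu⟩ hC v
    have hfib := hF.fibre C fun e he => hC e (Or.inl (Or.inr he))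
    have h1 : r v ∈ r '' C := by
      refine hgood.conn (r '' C) ⟨r u, ⟨u, hu, rfl⟩, hF.lt u⟩ ?_ _ (hF.lt v)
      intro e he
      have h2 : G.src (γ e) ∈ C ↔ G.tgt (γ e) ∈ C := by
        refine hC _ ?_
        rcases he with he | he
        · exact Or.inr (hPe ⟨e, he, rfl⟩)
        · exact Or.inl (Or.inl ⟨e, he, rfl⟩)
      have h3 : ∀ w, r w ∈ r '' C ↔ w ∈ C := by
        intro w
        constructor
        · rintro ⟨x, hx, hxw⟩
          exact hfib x w hxw hx
        · exact fun hw => ⟨w, hw, rfl⟩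
      obtain ⟨-, ⟨h4, h5⟩ | ⟨h4, h5⟩⟩ := hγ e (he.elim (fun h => hP h) fun h => hT h)
      · rw [← h4, ← h5, h3, h3, h2]
      · rw [← h4, ← h5, h3, h3, h2]
    obtain ⟨x, hx, hxv⟩ := h1
    exact hfib x v hxv hx
  · intro g hsupp hflow
    have hover : ∀ e ∈ Q ∪ T, g (γ e) = 0 := by
      intro e he
      obtain ⟨C, hC, hCo⟩ := hgood.bridge e he
      have hcross : ∀ f ∈ M, ((G.src (γ f) ∈ r ⁻¹' C ↔ G.tgt (γ f) ∈ r ⁻¹' C) ↔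
          (f.1 ∈ C ↔ f.2 ∈ C)) := by
        intro f hf
        obtain ⟨-, ⟨h4, h5⟩ | ⟨h4, h5⟩⟩ := hγ f hf
        · rw [Set.mem_preimage, Set.mem_preimage, h4, h5]
        · rw [Set.mem_preimage, Set.mem_preimage, h4, h5]
          exact iff_comm
      refine flow_eq_zero_of_cut hflow (r ⁻¹' C) ?_ ?_
      · rwa [hcross e (he.elim (fun h => hQ h) fun h => hT h)]
      · intro f hfe hf0
        have hf : f ∈ γ '' T ∪ F ∪ J \ I := by
          by_contra h
          exact hf0 (hsupp f h)
        have key : ∀ f' ∈ Q ∪ T, γ f' = f → (G.src f ∈ r ⁻¹' C ↔ G.tgt f ∈ r ⁻¹' C) := by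
          rintro f' hf' rfl
          rw [hcross f' (hf'.elim (fun h => hQ h) fun h => hT h)]
          refine hCo f' hf' ?_
          rintro rfl
          exact hfe rfl
        rcases hf with (⟨f', hf', h⟩ | hf) | hf
        · exact key f' (Or.inr hf') h
        · rw [Set.mem_preimage, Set.mem_preimage, hF.internal f hf]
        · obtain ⟨f', hf', h⟩ := hQe hf
          exact key f' (Or.inl hf') h
    have hout : ∀ e, e ∉ F → g e = 0 := by
      intro e he
      by_cases h : e ∈ γ '' T ∪ F ∪ J \ I
      · rcases h with (⟨f', hf', rfl⟩ | hf) | hf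
        · exact hover f' (Or.inr hf')
        · exact absurd hf he
        · obtain ⟨f', hf', rfl⟩ := hQe hf
          exact hover f' (Or.inl hf')
      · exact hsupp e h
    intro e
    by_cases he : e ∈ F
    · obtain ⟨C, hC, hCo⟩ := hF.bridge e he
      refine flow_eq_zero_of_cut hflow C hC fun f hfe hf0 => hCo f ?_ hfe
      by_contra h
      exact hf0 (hout f h)
    · exact hout e he

/-- A model extends to branch sets covering all the vertices of a connected graph. -/
theorem exists_covering {L : List (Fin n × Fin n)} (h : G.skel.Model n L)
    (hc : G.skel.Cn Set.univ) (hn : 0 < n) : ∃ X : Fin n → Set G.V, (∀ i, G.skel.Cn (X i)) ∧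
      (Pairwise fun i j => Disjoint (X i) (X j)) ∧ (∀ p ∈ L, G.skel.Touch (X p.1) (X p.2)) ∧
      ∀ v, ∃ i, v ∈ X i := by
  have hfin : Set.Finite {X : Fin n → Set G.V | (∀ i, G.skel.Cn (X i)) ∧
      (Pairwise fun i j => Disjoint (X i) (X j)) ∧ ∀ p ∈ L, G.skel.Touch (X p.1) (X p.2)} :=
    Set.toFinite _
  obtain ⟨X, ⟨h1, h2, h3⟩, hmax⟩ := hfin.exists_maximal h
  refine ⟨X, h1, h2, h3, ?_⟩
  have hun : (⋃ i, X i) = Set.univ := by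
    obtain ⟨v, hv⟩ := (h1 ⟨0, hn⟩).nonempty
    refine hc.eq_of_closed ⟨v, Set.mem_iUnion.2 ⟨_, hv⟩⟩ (Set.subset_univ _) ?_
    intro a ha b _ hab
    by_contra hb
    obtain ⟨i, hi⟩ := Set.mem_iUnion.1 ha
    have hb' : ∀ j, b ∉ X j := fun j hj => hb (Set.mem_iUnion.2 ⟨j, hj⟩)
    have hle : X ≤ Function.update X i (insert b (X i)) := by
      intro j
      by_cases hj : j = i
      · subst hj
        rw [Function.update_self]
        exact Set.subset_insert _ _
      · rw [Function.update_of_ne hj]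
    have := hmax (y := Function.update X i (insert b (X i))) ⟨?_, ?_, ?_⟩ hle i
    · rw [Function.update_self] at this
      exact hb' i (this (Set.mem_insert _ _))
    · intro j
      by_cases hj : j = i
      · subst hj
        rw [Function.update_self]
        exact (h1 j).insert ⟨b, rfl, a, hi, hab.symm⟩
      · rw [Function.update_of_ne hj]
        exact h1 j
    · intro j k hjk
      by_cases hj : j = i
      · subst hj
        rw [Function.update_self, Function.update_of_ne hjk.symm, Set.disjoint_insert_left]
        exact ⟨hb' k, h2 hjk⟩
      · rw [Function.update_of_ne hj]
        by_cases hk : k = i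
        · subst hk
          rw [Function.update_self, Set.disjoint_insert_right]
          exact ⟨hb' j, h2 hjk⟩
        · rw [Function.update_of_ne hk]
          exact h2 hjk
    · intro p hp
      exact (h3 p hp).mono (hle p.1) (hle p.2)
  intro v
  exact Set.mem_iUnion.1 (hun ▸ Set.mem_univ v)

/-- A connected graph with a model of `L` has a frame together with edges over those of `L`. -/
theorem exists_frame {L : List (Fin n × Fin n)} (h : G.skel.Model n L)
    (hc : G.skel.Cn Set.univ) (hne : ∃ p, p ∈ L) (hL : ∀ p ∈ L, p.1 ≠ p.2) :
    ∃ (r : G.V → ℕ) (F : Set G.E) (γ : ℕ × ℕ → G.E), G.Frame n r F ∧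
      ∀ p ∈ L, G.Over r γ (p.1.1, p.2.1) := by
  obtain ⟨X, h1, h2, h3, h4⟩ := exists_covering h hc (Fin.pos hne.choose.1)
  choose r hr using h4
  have hruniq : ∀ {v i}, v ∈ X i → r v = i := by
    intro v i hv
    by_contra hne
    exact Set.disjoint_left.1 (h2 hne) (hr v) hv
  let fib : Set G.E → Prop := fun F => (∀ e ∈ F, r (G.src e) = r (G.tgt e)) ∧
    ∀ C : Set G.V, (∀ e ∈ F, G.src e ∈ C ↔ G.tgt e ∈ C) → ∀ u v, r u = r v → u ∈ C → v ∈ C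
  have hall : fib {e | r (G.src e) = r (G.tgt e)} := by
    refine ⟨fun e he => he, fun C hC u v huv hu => ?_⟩
    have h5 := (h1 (r u)).eq_of_closed (K := X (r u) ∩ C) ⟨u, hr u, hu⟩ Set.inter_subset_left (by
      rintro a ⟨haX, haC⟩ b hbX ⟨-, e, -, ⟨rfl, rfl⟩ | ⟨rfl, rfl⟩⟩
      · exact ⟨hbX, (hC e ((hruniq haX).trans (hruniq hbX).symm)).1 haC⟩
      · exact ⟨hbX, (hC e ((hruniq hbX).trans (hruniq haX).symm)).2 haC⟩)
    have h6 : v ∈ X (r u) := huv ▸ hr v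
    exact (h5.symm ▸ h6 : v ∈ X (r u) ∩ C).2
  obtain ⟨F, ⟨hF1, hF2⟩, hmin⟩ := (Set.toFinite {F | fib F}).exists_minimal ⟨_, hall⟩
  have hedge : ∀ p : ℕ × ℕ, ∃ e : G.E, ∀ q ∈ L, p = (q.1.1, q.2.1) →
      ((r (G.src e)).1 = p.1 ∧ (r (G.tgt e)).1 = p.2) ∨
        ((r (G.src e)).1 = p.2 ∧ (r (G.tgt e)).1 = p.1) := by
    intro p
    have h5 : ∀ q ∈ L, ∃ e : G.E, ((r (G.src e)).1 = q.1.1 ∧ (r (G.tgt e)).1 = q.2.1) ∨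
        ((r (G.src e)).1 = q.2.1 ∧ (r (G.tgt e)).1 = q.1.1) := by
      intro q hq
      obtain ⟨a, ha, b, hb, -, e, -, ⟨rfl, rfl⟩ | ⟨rfl, rfl⟩⟩ := h3 q hq
      · exact ⟨e, Or.inl ⟨by rw [hruniq ha], by rw [hruniq hb]⟩⟩
      · exact ⟨e, Or.inr ⟨by rw [hruniq hb], by rw [hruniq ha]⟩⟩
    by_cases hp : ∃ q ∈ L, p = (q.1.1, q.2.1)
    · obtain ⟨q, hq, rfl⟩ := hp
      obtain ⟨e, he⟩ := h5 q hq
      exact ⟨e, fun _ _ _ => he⟩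
    · obtain ⟨q, hq⟩ := hne
      obtain ⟨e, -⟩ := h5 q hq
      exact ⟨e, fun q' hq' h => absurd ⟨q', hq', h⟩ hp⟩
  choose γ hγ using hedge
  refine ⟨fun v => (r v).1, F, γ, ⟨fun v => (r v).2, fun e he => congrArg Fin.val (hF1 e he),
    fun C hC u v huv => hF2 C hC u v (Fin.ext huv), ?_⟩, ?_⟩
  · intro f hf
    by_contra hcon
    have h5 : fib (F \ {f}) := by
      refine ⟨fun e he => hF1 e he.1, fun C hC => hF2 C ?_⟩
      intro e he
      by_cases hef : e = f
      · subst hef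
        by_contra hcr
        exact hcon ⟨C, hcr, fun e' he' hne => hC e' ⟨he', hne⟩⟩
      · exact hC e ⟨he, hef⟩
    exact (hmin h5 Set.sdiff_subset hf).2 rfl
  · intro p hp
    refine ⟨fun h => hL p hp (Fin.ext h), hγ _ p hp rfl⟩

end Multigraph

/-! ### Certifying that a configuration does not split -/

namespace Multigraph

/-- The bit mask of the set of ends of an edge. -/
def edgeMask (e : ℕ × ℕ) : ℕ := Nat.lor (Nat.pow 2 e.1) (Nat.pow 2 e.2)

/-- Evaluate the argument first. -/
def forced {α : Type} : ℕ → (ℕ → α) → α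
  | 0, f => f 0
  | m + 1, f => f (m + 1)

/-- Close the vertex set with bit mask `m` under the edges `l`, in the given number of rounds. -/
def closeMask : ℕ → List (ℕ × ℕ) → ℕ → ℕ
  | 0, _, m => m
  | k + 1, l, m => closeMask k l (roundMask l m)
where
  /-- Run through the edges of `l`: add both ends of an edge if one of them is present. -/
  roundMask : List (ℕ × ℕ) → ℕ → ℕ
  | [], m => m
  | e :: l, m => forced m fun m =>
      roundMask l (bif Nat.beq (Nat.land m (edgeMask e)) 0 then m else Nat.lor m (edgeMask e))

/-- The edge `e` leaves the vertex set with bit mask `m`. -/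
def crossMask (m : ℕ) (e : ℕ × ℕ) : Bool :=
  !(Nat.beq (Nat.land m (edgeMask e)) 0 || Nat.beq (Nat.land m (edgeMask e)) (edgeMask e))

/-- Equality test for pairs of numbers. -/
def pairEq (e f : ℕ × ℕ) : Bool := Nat.beq e.1 f.1 && Nat.beq e.2 f.2

/-- The edge `e` is the only edge of `l` that leaves the vertex set with bit mask `m`. -/
def cutsOnly (l : List (ℕ × ℕ)) (e : ℕ × ℕ) (m : ℕ) : Bool :=
  crossMask m e && l.all fun f => pairEq f e || !crossMask m f

/-- The edge `e` of `l` is a bridge of the graph with edges `l`. -/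
def isBridge (n : ℕ) (l : List (ℕ × ℕ)) (e : ℕ × ℕ) : Bool :=
  forced (closeMask n (l.filter fun f => !pairEq f e) (Nat.pow 2 e.1)) (cutsOnly l e)

/-- Test for `Good`. -/
def goodTest (n : ℕ) (P Q T : List (ℕ × ℕ)) : Bool :=
  Nat.beq (T.length + 3) n && (Nat.beq (closeMask n (P ++ T) 1) (2 ^ n - 1) &&
    (Q ++ T).all (isBridge n (Q ++ T)))

/-- Search for a subset of the list of edges that extends `T` to a good set. -/
def searchGood (n : ℕ) (P Q : List (ℕ × ℕ)) : List (ℕ × ℕ) → List (ℕ × ℕ) → Bool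
  | [], T => goodTest n P Q T
  | e :: R, T => searchGood n P Q R (e :: T) || searchGood n P Q R T

/-- Distribute the edges of the configuration in all possible ways, and search for good sets
among the edges `R`. -/
def configTest (n : ℕ) (R : List (ℕ × ℕ)) :
    List (ℕ × ℕ) → List (ℕ × ℕ) → List (ℕ × ℕ) → List (ℕ × ℕ) → Bool
  | [], P, Q, T => !(Nat.beq P.length 2 && Nat.beq Q.length 2) || searchGood n P Q R T
  | e :: S, P, Q, T => configTest n R S (e :: P) Q T && (configTest n R S P (e :: Q) T &&
      (configTest n R S P Q (e :: T) && configTest n R S P Q T))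

variable {n : ℕ} {P Q R S T l : List (ℕ × ℕ)} {m : ℕ} {e : ℕ × ℕ}

theorem forced_eq {α : Type} (m : ℕ) (f : ℕ → α) : forced m f = f m := by
  cases m <;> rfl

theorem testBit_edgeMask (e : ℕ × ℕ) (i : ℕ) :
    (edgeMask e).testBit i = true ↔ i = e.1 ∨ i = e.2 := by
  change (2 ^ e.1 ||| 2 ^ e.2).testBit i = true ↔ _
  rw [Nat.testBit_or, Nat.testBit_two_pow, Nat.testBit_two_pow, Bool.or_eq_true, decide_eq_true_iff,
    decide_eq_true_iff, eq_comm, eq_comm (b := i)]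

theorem land_edgeMask_eq_zero :
    Nat.land m (edgeMask e) = 0 ↔ m.testBit e.1 = false ∧ m.testBit e.2 = false := by
  change m &&& edgeMask e = 0 ↔ _
  constructor
  · intro h
    have h0 : ∀ i, (m &&& edgeMask e).testBit i = false := by simp [h]
    have h1 := h0 e.1
    have h2 := h0 e.2
    rw [Nat.testBit_and, (testBit_edgeMask e _).2 (Or.inl rfl), Bool.and_true] at h1
    rw [Nat.testBit_and, (testBit_edgeMask e _).2 (Or.inr rfl), Bool.and_true] at h2
    exact ⟨h1, h2⟩
  · rintro ⟨h1, h2⟩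
    refine Nat.eq_of_testBit_eq fun i => ?_
    have := testBit_edgeMask e i
    rw [Nat.testBit_and, Nat.zero_testBit]
    by_contra h
    grind

theorem land_edgeMask_eq_self :
    Nat.land m (edgeMask e) = edgeMask e ↔ m.testBit e.1 = true ∧ m.testBit e.2 = true := by
  change m &&& edgeMask e = edgeMask e ↔ _
  constructor
  · intro h
    have h0 : ∀ i, (m &&& edgeMask e).testBit i = (edgeMask e).testBit i := by simp [h]
    have h1 := h0 e.1
    have h2 := h0 e.2
    rw [Nat.testBit_and, (testBit_edgeMask e _).2 (Or.inl rfl), Bool.and_true] at h1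
    rw [Nat.testBit_and, (testBit_edgeMask e _).2 (Or.inr rfl), Bool.and_true] at h2
    exact ⟨h1, h2⟩
  · rintro ⟨h1, h2⟩
    refine Nat.eq_of_testBit_eq fun i => ?_
    have := testBit_edgeMask e i
    rw [Nat.testBit_and]
    by_contra h
    grind

theorem crossMask_eq_true :
    crossMask m e = true ↔ ¬ (m.testBit e.1 = true ↔ m.testBit e.2 = true) := by
  have h0 := land_edgeMask_eq_zero (m := m) (e := e)
  have h1 := land_edgeMask_eq_self (m := m) (e := e)
  unfold crossMask
  rw [Bool.not_eq_true', Bool.or_eq_false_iff, ← Bool.not_eq_true, ← Bool.not_eq_true,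
    Nat.beq_eq, Nat.beq_eq, h0, h1]
  grind

theorem pairEq_eq_true {f : ℕ × ℕ} : pairEq e f = true ↔ e = f := by
  unfold pairEq
  rw [Bool.and_eq_true, Nat.beq_eq, Nat.beq_eq, Prod.ext_iff]

theorem roundMask_subset {C : Set ℕ} (hC : ∀ e ∈ l, e.1 ∈ C ↔ e.2 ∈ C)
    (hm : ∀ i, m.testBit i = true → i ∈ C) {i : ℕ}
    (hi : (closeMask.roundMask l m).testBit i = true) : i ∈ C := by
  induction l generalizing m with
  | nil => exact hm i hi
  | cons e l ih =>
    rw [closeMask.roundMask, forced_eq] at hi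
    refine ih (fun f hf => hC f (List.mem_cons_of_mem _ hf)) (fun j hj => ?_) hi
    cases h : Nat.beq (Nat.land m (edgeMask e)) 0 with
    | true =>
      rw [h] at hj
      exact hm j hj
    | false =>
      rw [h, cond_false] at hj
      change (m ||| edgeMask e).testBit j = true at hj
      rw [Nat.testBit_or, Bool.or_eq_true, testBit_edgeMask] at hj
      have h' := land_edgeMask_eq_zero (m := m) (e := e)
      rw [← Nat.beq_eq, h] at h'
      have he := hC e List.mem_cons_self
      have h1 := hm e.1
      have h2 := hm e.2
      rcases hj with hj | hj
      · exact hm j hj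
      · grind

theorem closeMask_subset {C : Set ℕ} (hC : ∀ e ∈ l, e.1 ∈ C ↔ e.2 ∈ C)
    (hm : ∀ i, m.testBit i = true → i ∈ C) {k i : ℕ}
    (hi : (closeMask k l m).testBit i = true) : i ∈ C := by
  induction k generalizing m with
  | zero => exact hm i hi
  | succ k ih => exact ih (fun j hj => roundMask_subset hC hm hj) hi

theorem good_of_goodTest (h : goodTest n P Q T = true) :
    Good n {e | e ∈ P} {e | e ∈ Q} {e | e ∈ T} := by
  rw [goodTest, Bool.and_eq_true, Bool.and_eq_true, Nat.beq_eq, Nat.beq_eq] at h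
  obtain ⟨-, hconn, hbr⟩ := h
  have hall : ∀ C : Set ℕ, (∀ e ∈ P ++ T, e.1 ∈ C ↔ e.2 ∈ C) → 0 ∈ C → ∀ i < n, i ∈ C := by
    intro C hC h0 i hi
    refine closeMask_subset (m := 1) (k := n) hC ?_ (i := i) ?_
    · intro j hj
      rw [Nat.testBit_one_eq_true_iff_self_eq_zero] at hj
      exact hj ▸ h0
    · rw [hconn, Nat.testBit_two_pow_sub_one]
      exact decide_eq_true hi
  constructor
  · rintro C ⟨i, hiC, hi⟩ hC
    have hC' : ∀ e ∈ P ++ T, e.1 ∈ C ↔ e.2 ∈ C := fun e he => hC e (List.mem_append.1 he)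
    by_cases h0 : 0 ∈ C
    · exact hall C hC' h0
    · exact absurd hiC (hall Cᶜ (fun e he => not_congr (hC' e he)) h0 i hi)
  · intro e he
    have h1 := List.all_eq_true.1 hbr e (List.mem_append.2 he)
    rw [isBridge, forced_eq, cutsOnly, Bool.and_eq_true, crossMask_eq_true] at h1
    refine ⟨{i | (closeMask n ((Q ++ T).filter fun f => !pairEq f e)
      (Nat.pow 2 e.1)).testBit i = true},
      h1.1, fun f hf hfe => ?_⟩
    have h2 := List.all_eq_true.1 h1.2 f (List.mem_append.2 hf)
    rw [Bool.or_eq_true, pairEq_eq_true, Bool.not_eq_true', ← Bool.not_eq_true,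
      crossMask_eq_true, not_not] at h2
    exact h2.resolve_left hfe

theorem exists_good_of_searchGood (h : searchGood n P Q R T = true) :
    ∃ T' : Set (ℕ × ℕ), Good n {e | e ∈ P} {e | e ∈ Q} T' ∧ {e | e ∈ T} ⊆ T' ∧
      T' ⊆ {e | e ∈ T ∨ e ∈ R} := by
  induction R generalizing T with
  | nil => exact ⟨_, good_of_goodTest h, subset_rfl, fun e he => Or.inl he⟩
  | cons e R ih =>
    rw [searchGood, Bool.or_eq_true] at h
    rcases h with h | h
    · obtain ⟨T', h1, h2, h3⟩ := ih h
      refine ⟨T', h1, fun f hf => h2 (List.mem_cons_of_mem _ hf), fun f hf => ?_⟩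
      have := h3 hf
      simp only [Set.mem_ofPred_eq, List.mem_cons] at this ⊢
      tauto
    · obtain ⟨T', h1, h2, h3⟩ := ih h
      refine ⟨T', h1, h2, fun f hf => ?_⟩
      have := h3 hf
      simp only [Set.mem_ofPred_eq, List.mem_cons] at this ⊢
      tauto

theorem exists_good_of_configTest {i j : ℕ × ℕ → Prop} (h : configTest n R S P Q T = true)
    (hi : P.length + (S.filter fun e => i e ∧ ¬ j e).length = 2)
    (hj : Q.length + (S.filter fun e => j e ∧ ¬ i e).length = 2) {A B N : Set (ℕ × ℕ)}
    (hA : ∀ e, e ∈ A ↔ e ∈ P ∨ e ∈ S ∧ i e ∧ ¬ j e) (hB : ∀ e, e ∈ B ↔ e ∈ Q ∨ e ∈ S ∧ j e ∧ ¬ i e)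
    (hN : ∀ e, e ∈ N ↔ e ∈ T ∨ e ∈ S ∧ ¬ i e ∧ ¬ j e) :
    ∃ T' : Set (ℕ × ℕ), Good n A B T' ∧ N ⊆ T' ∧ T' ⊆ {e | e ∈ N ∨ e ∈ R} := by
  induction S generalizing P Q T with
  | nil =>
    simp only [List.filter_nil, List.length_nil, add_zero] at hi hj
    rw [configTest, hi, hj] at h
    obtain ⟨T', h1, h2, h3⟩ := exists_good_of_searchGood (by simpa using h)
    simp only [List.not_mem_nil, false_and, or_false] at hA hB hN
    obtain rfl : A = {e | e ∈ P} := Set.ext hA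
    obtain rfl : B = {e | e ∈ Q} := Set.ext hB
    obtain rfl : N = {e | e ∈ T} := Set.ext hN
    exact ⟨T', h1, h2, h3⟩
  | cons e S ih =>
    rw [configTest, Bool.and_eq_true, Bool.and_eq_true, Bool.and_eq_true] at h
    obtain ⟨hP, hQ, hT, hD⟩ := h
    by_cases hie : i e <;> by_cases hje : j e <;>
      simp only [List.filter_cons, hie, hje, not_true_eq_false, not_false_eq_true, and_true,
        and_false, decide_true, decide_false, if_true, if_false, Bool.false_eq_true,
        List.length_cons, and_self] at hi hj
    · refine ih hD hi hj ?_ ?_ ?_ <;> intro f <;> simp only [hA, hB, hN, List.mem_cons] <;>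
        by_cases hf : f = e <;> simp [hf, hie, hje]
    · refine ih hP (by rw [List.length_cons]; omega) hj ?_ ?_ ?_ <;> intro f <;>
        simp only [hA, hB, hN, List.mem_cons] <;> by_cases hf : f = e <;> simp [hf, hie, hje]
    · refine ih hQ hi (by rw [List.length_cons]; omega) ?_ ?_ ?_ <;> intro f <;>
        simp only [hA, hB, hN, List.mem_cons] <;> by_cases hf : f = e <;> simp [hf, hie, hje]
    · refine ih hT hi hj ?_ ?_ ?_ <;> intro f <;> simp only [hA, hB, hN, List.mem_cons] <;>
        by_cases hf : f = e <;> simp [hf, hie, hje]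

end Multigraph

namespace Multigraph

variable {G : Multigraph} {n : ℕ}

theorem ncard_setOf_mem {α : Type*} {l : List α} (h : l.Nodup) : {a | a ∈ l}.ncard = l.length := by
  rw [← List.toFinset_card_of_nodup h, ← Set.ncard_coe_finset]
  congr 1
  ext a
  simp

theorem Over.injective {r : G.V → ℕ} {γ : ℕ × ℕ → G.E} {e f : ℕ × ℕ} (he : G.Over r γ e)
    (hf : G.Over r γ f) (he' : e.1 < e.2) (hf' : f.1 < f.2) (h : γ e = γ f) : e = f := by
  have h1 := he.2
  have h2 := hf.2
  rw [h] at h1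
  refine Prod.ext ?_ ?_ <;> omega

theorem DodgsonConfig.ncard {S I J K : Set G.E} (h : G.DodgsonConfig S I J K) :
    I ⊆ S ∧ J ⊆ S ∧ K = S \ (I ∪ J) ∧ I.ncard = J.ncard ∧
      (I \ J).ncard = 2 ∧ (J \ I).ncard = 2 := by
  obtain ⟨rfl, h⟩ := h
  have hIJ := Set.ncard_inter_add_ncard_sdiff_eq_ncard I J
  have hJI := Set.ncard_inter_add_ncard_sdiff_eq_ncard J I
  rw [Set.inter_comm] at hJI
  refine ⟨fun e he => Or.inl (Or.inl he), fun e he => Or.inl (Or.inr he), ?_, ?_⟩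
  · rcases h with ⟨-, -, -, -, h1, h2⟩ | ⟨-, -, rfl, -⟩
    · rw [Set.union_sdiff_left, eq_comm, sdiff_eq_left, Set.disjoint_union_right,
        Set.disjoint_iff_inter_eq_empty, Set.disjoint_iff_inter_eq_empty, Set.inter_comm K,
        Set.inter_comm K]
      exact ⟨h1, h2⟩
    · simp
  · rcases h with ⟨h1, h2, -, h3, -⟩ | ⟨h1, h2, -, h3⟩
    · rw [h3, Set.ncard_empty] at hIJ hJI
      omega
    · omega

theorem not_feynmanSplit_of_configTest {L : List (Fin n × Fin n)} (h : G.skel.Model n L)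
    (hc : G.skel.Cn Set.univ) (hL : ∀ p ∈ L, p.1 ≠ p.2) (R S : List (ℕ × ℕ)) (hS : S.length = 5)
    (hd : (S ++ R).Nodup) (hlt : ∀ e ∈ S ++ R, e.1 < e.2)
    (hSR : ∀ e ∈ S ++ R, e ∈ L.map fun p => (p.1.1, p.2.1))
    (ht : configTest n R S [] [] [] = true) : ¬ G.FeynmanSplit := by
  have hne : ∃ p, p ∈ L := by
    obtain ⟨e, he⟩ := List.exists_mem_of_length_pos (l := S) (by omega)
    obtain ⟨p, hp, -⟩ := List.mem_map.1 (hSR e (List.mem_append_left _ he))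
    exact ⟨p, hp⟩
  obtain ⟨r, F, γ, hF, hγL⟩ := exists_frame h hc hne hL
  have hγ : ∀ e ∈ {e | e ∈ S ++ R}, G.Over r γ e := by
    intro e he
    obtain ⟨p, hp, rfl⟩ := List.mem_map.1 (hSR e he)
    exact hγL p hp
  have hinj : Set.InjOn γ {e | e ∈ S ++ R} := fun e he f hf hef =>
    (hγ e he).injective (hγ f hf) (hlt e he) (hlt f hf) hef
  have hSM : {e | e ∈ S} ⊆ {e | e ∈ S ++ R} := fun e he => List.mem_append_left _ he
  intro hsplit
  obtain ⟨I, J, K, hcfg, hzero⟩ := hsplit (γ '' {e | e ∈ S}) (by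
    rw [(hinj.mono hSM).ncard_image, ncard_setOf_mem (hd.of_append_left), hS])
  obtain ⟨hI, hJ, rfl, hIJ, hPc, hQc⟩ := hcfg.ncard
  have himage : ∀ A B : Set G.E, A ⊆ γ '' {e | e ∈ S} →
      γ '' {e | e ∈ S ∧ γ e ∈ A ∧ ¬ γ e ∈ B} = A \ B := by
    intro A B hA
    ext x
    constructor
    · rintro ⟨e, ⟨-, he⟩, rfl⟩
      exact he
    · rintro ⟨hxA, hxB⟩
      obtain ⟨e, he, rfl⟩ := hA hxA
      exact ⟨e, ⟨he, hxA, hxB⟩, rfl⟩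
  have hlen : ∀ A B : Set G.E, A ⊆ γ '' {e | e ∈ S} →
      (S.filter fun e => γ e ∈ A ∧ ¬ γ e ∈ B).length = (A \ B).ncard := by
    intro A B hA
    rw [← himage A B hA, Set.InjOn.ncard_image (hinj.mono fun e he => hSM he.1),
      ← ncard_setOf_mem (hd.of_append_left.filter _)]
    simp [List.mem_filter]
  obtain ⟨T, hgood, hNT, hTN⟩ := exists_good_of_configTest (i := fun e => γ e ∈ I)
    (j := fun e => γ e ∈ J) ht (by rw [hlen I J hI, hPc, List.length_nil])
    (by rw [hlen J I hJ, hQc, List.length_nil])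
    (A := {e | e ∈ S ∧ γ e ∈ I ∧ ¬ γ e ∈ J}) (B := {e | e ∈ S ∧ γ e ∈ J ∧ ¬ γ e ∈ I})
    (N := {e | e ∈ S ∧ ¬ γ e ∈ I ∧ ¬ γ e ∈ J}) (by simp) (by simp) (by simp)
  obtain ⟨v₀, -⟩ := hc.1
  refine hF.dodgson_ne_zero hγ (fun e he => hSM he.1) (fun e he => hSM he.1) ?_ hgood hIJ
    (hJ.trans (Set.image_mono hSM)) (himage I J hI).le (himage J I hJ).ge ?_ ?_ v₀ (hzero v₀)
  · intro e he
    rcases hTN he with he' | he'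
    · exact hSM he'.1
    · exact List.mem_append_right _ he'
  · rintro x ⟨⟨e, he, rfl⟩, hx⟩
    exact ⟨e, hNT ⟨he, fun h1 => hx (Or.inl h1), fun h1 => hx (Or.inr h1)⟩, rfl⟩
  · refine Set.disjoint_left.2 ?_
    rintro x ⟨e, he, rfl⟩ hxJ
    rcases hTN he with he' | he'
    · exact he'.2.2 hxJ
    · obtain ⟨f, hf, hfe⟩ := hJ hxJ
      have := hinj (hSM hf) (List.mem_append_right _ he') hfe
      exact (List.nodup_append.1 hd).2.2 f hf e he' this

theorem not_feynmanSplit_of_hasF0 (hc : G.skel.Cn Set.univ) (h : G.skel.HasF0) :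
    ¬ G.FeynmanSplit := by
  rcases h with h | h | h | h | h
  · exact not_feynmanSplit_of_configTest h hc (by decide) [(0, 5), (1, 5), (2, 3), (2, 4)]
      [(0, 3), (0, 4), (1, 3), (1, 4), (2, 5)] rfl (by decide) (by decide) (by decide)
      (by decide +kernel)
  · exact not_feynmanSplit_of_configTest h hc (by decide)
      [(0, 4), (1, 2), (1, 3), (2, 3), (3, 4)] [(0, 1), (0, 2), (0, 3), (1, 4), (2, 4)] rfl
      (by decide) (by decide) (by decide) (by decide +kernel)
  · exact not_feynmanSplit_of_configTest h hc (by decide)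
      [(0, 4), (1, 5), (2, 6), (3, 7), (4, 6), (5, 7), (6, 7)]
      [(0, 1), (0, 2), (1, 3), (2, 3), (4, 5)] rfl (by decide) (by decide) (by decide)
      (by decide +kernel)
  · exact not_feynmanSplit_of_configTest h hc (by decide)
      [(1, 2), (1, 3), (2, 4), (2, 5), (3, 6), (4, 6), (5, 6)]
      [(0, 1), (0, 2), (0, 3), (0, 4), (1, 5)] rfl (by decide) (by decide) (by decide)
      (by decide +kernel)
  · exact not_feynmanSplit_of_configTest h hc (by decide)
      [(1, 3), (1, 4), (1, 5), (2, 4), (2, 5), (3, 4), (3, 5)]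
      [(0, 2), (0, 3), (0, 4), (0, 5), (1, 2)] rfl (by decide) (by decide) (by decide)
      (by decide +kernel)

end Multigraph

theorem stmt9 (G : Multigraph) (hs : G.Simple) (h3 : G.ThreeConnected) :
    G.FeynmanSplit ↔
      (¬ G.HasMinor K33m ∧ ¬ G.HasMinor K5m ∧ ¬ G.HasMinor cubeM ∧
        ¬ G.HasMinor Hm ∧ ¬ G.HasMinor octaM) := by
  have hc : G.skel.Cn Set.univ := by
    rw [skel_cn_iff, ← Set.compl_empty]
    exact h3.2 ∅ (by simp)
  constructor
  · intro h
    have hno : ¬ (G.HasMinor K33m ∨ G.HasMinor K5m ∨ G.HasMinor cubeM ∨ G.HasMinor Hm ∨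
        G.HasMinor octaM) := fun hm => not_feynmanSplit_of_hasF0 hc (hasF0_of_hasMinor hm) h
    push Not at hno
    exact hno
  · rintro ⟨h1, h2, h3', h4, h5⟩
    refine feynmanSplit_of_not_hasF0 hs h3 fun h => ?_
    rcases hasMinor_of_hasF0 h with h | h | h | h | h
    exacts [h1 h, h2 h, h3' h, h4 h, h5 h]
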